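/- Let U, W ⊂ ℂⁿ be neighborhoods of 0 and suppose g : (U, 0) → (W, 0) is a finite holomorphic map, X ⊂ W is an irreducible analytic hypersurface that is singular at 0 whose singular locus X_sing has positive dimension and passes through the origin, and g⁻¹(X) is smooth. Then there exist open sets U' ⊂ U and W' ⊂ W with g(U') = W' and an affine hyperplane H in ℂⁿ such that: (1) X ∩ H is a singular hypersurface within H ∩ W'; (2) g⁻¹(H) is smooth within U'; and (3) g⁻¹(X ∩ H) is a smooth hypersurface in g⁻¹(H) ∩ U'. -/

import Mathlib

open Set Filter Topology

noncomputable section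

/-- `ℂⁿ`, modeled as the space of functions `Fin n → ℂ`. -/
abbrev Cn (n : ℕ) : Type := Fin n → ℂ

/-- `X` is an analytic hypersurface in the open set `W`, with its reduced structure:
near every point of `W` it is the zero set of a holomorphic function that does not
vanish identically on a connected neighborhood (hence every irreducible component of
`X` has codimension one). -/
def IsHypersurfaceIn {n : ℕ} (W X : Set (Cn n)) : Prop :=
  X ⊆ W ∧ ∀ p ∈ W, ∃ V : Set (Cn n), IsOpen V ∧ IsPreconnected V ∧ p ∈ V ∧ V ⊆ W ∧
    ∃ ψ : Cn n → ℂ, AnalyticOnNhd ℂ ψ V ∧ (∃ x ∈ V, ψ x ≠ 0) ∧ X ∩ V = {x ∈ V | ψ x = 0}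

/-- A hypersurface `X` is smooth at `p` if near `p` it is a codimension-one complex
submanifold of `ℂⁿ`, i.e. the zero set of a holomorphic function submersive at `p`.
"`X` is singular at `p`" is the negation of this. -/
def SmoothPointAt {n : ℕ} (X : Set (Cn n)) (p : Cn n) : Prop :=
  ∃ (V : Set (Cn n)) (φ : Cn n → ℂ), IsOpen V ∧ p ∈ V ∧ AnalyticOnNhd ℂ φ V ∧
    fderiv ℂ φ p ≠ 0 ∧ X ∩ V = {x ∈ V | φ x = 0}

/-- `S` is a (closed) analytic subset of the open set `U`: near every point of `U` it is
the common zero set of finitely many holomorphic functions. -/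
def IsAnalyticSubsetOf {n : ℕ} (U S : Set (Cn n)) : Prop :=
  S ⊆ U ∧ ∀ p ∈ U, ∃ V : Set (Cn n), IsOpen V ∧ p ∈ V ∧ V ⊆ U ∧
    ∃ (k : ℕ) (f : Fin k → Cn n → ℂ), (∀ i, AnalyticOnNhd ℂ (f i) V) ∧
      S ∩ V = {x ∈ V | ∀ i, f i x = 0}

/-- `S` is an irreducible analytic subset of `U`: a nonempty analytic subset that is not
the union of two proper (closed) analytic subsets of `U`. -/
def IsIrreducibleAnalyticSubsetOf {n : ℕ} (U S : Set (Cn n)) : Prop :=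
  IsAnalyticSubsetOf U S ∧ S.Nonempty ∧
  ∀ S₁ S₂ : Set (Cn n), IsAnalyticSubsetOf U S₁ → IsAnalyticSubsetOf U S₂ →
    S = S₁ ∪ S₂ → S = S₁ ∨ S = S₂

/-- `Y` is an analytic hypersurface of the slice `H ∩ W'`, where `H = {T = c}` is an
affine hyperplane: near every point of `H ∩ W'` it is the zero set inside `H` of a
holomorphic function not vanishing identically on `H` there. -/
def IsHypersurfaceInSlice {n : ℕ} (T : Cn n →L[ℂ] ℂ) (c : ℂ) (W' Y : Set (Cn n)) :
    Prop :=
  Y ⊆ W' ∩ {x : Cn n | T x = c} ∧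
  ∀ p ∈ W' ∩ {x : Cn n | T x = c}, ∃ V : Set (Cn n), IsOpen V ∧ p ∈ V ∧ V ⊆ W' ∧
    ∃ ψ : Cn n → ℂ, AnalyticOnNhd ℂ ψ V ∧ (∃ x ∈ V, T x = c ∧ ψ x ≠ 0) ∧
      Y ∩ V = {x ∈ V | T x = c ∧ ψ x = 0}

/-- `Y ⊆ H` is smooth at `p` as a subvariety of the affine hyperplane `H = {T = c}`:
near `p` it is cut out of `H` by a holomorphic function whose differential at `p` is
nonzero in some direction tangent to `H`. -/
def SmoothPointWithinHyperplane {n : ℕ} (T : Cn n →L[ℂ] ℂ) (c : ℂ) (Y : Set (Cn n))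
    (p : Cn n) : Prop :=
  ∃ (V : Set (Cn n)) (φ : Cn n → ℂ), IsOpen V ∧ p ∈ V ∧ AnalyticOnNhd ℂ φ V ∧
    (∃ u : Cn n, T u = 0 ∧ fderiv ℂ φ p u ≠ 0) ∧
    Y ∩ V = {x ∈ V | T x = c ∧ φ x = 0}

/-- `Y ⊆ g⁻¹(H)` is smooth at `p` as a subvariety of the hypersurface
`g⁻¹(H) = {T ∘ g = c}`: near `p` it is cut out of `g⁻¹(H)` by a holomorphic function
whose differential at `p` is nonzero in some direction tangent to `g⁻¹(H)` at `p`. -/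
def SmoothPointWithinPreimageHyperplane {n : ℕ} (g : Cn n → Cn n) (T : Cn n →L[ℂ] ℂ)
    (c : ℂ) (Y : Set (Cn n)) (p : Cn n) : Prop :=
  ∃ (V : Set (Cn n)) (φ : Cn n → ℂ), IsOpen V ∧ p ∈ V ∧ AnalyticOnNhd ℂ φ V ∧
    (∃ u : Cn n, fderiv ℂ (fun x => T (g x)) p u = 0 ∧ fderiv ℂ φ p u ≠ 0) ∧
    Y ∩ V = {x ∈ V | T (g x) = c ∧ φ x = 0}

/-- A finite set of rotations moving every point of the unit circle close to `1`. -/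
lemma exists_finset_rotations {η : ℝ} (hη : 0 < η) :
    ∃ t : Finset ℂ, (∀ ω ∈ t, ‖ω‖ = 1) ∧ ∀ z : ℂ, ‖z‖ = 1 → ∃ ω ∈ t, ‖ω * z - 1‖ < η := by
  classical
  have hc : IsCompact (Metric.sphere (0 : ℂ) 1) := isCompact_sphere _ _
  obtain ⟨s, hs, hcov⟩ := hc.elim_nhds_subcover (fun w => Metric.ball w η)
    (fun w _ => Metric.ball_mem_nhds w hη)
  refine ⟨s.image (starRingEnd ℂ), ?_, ?_⟩
  · intro ω hω
    obtain ⟨w, hw, rfl⟩ := Finset.mem_image.1 hω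
    simpa using hs w hw
  · intro z hz
    have : z ∈ ⋃ w ∈ s, Metric.ball w η := hcov (by simpa using hz)
    simp only [mem_iUnion, exists_prop] at this
    obtain ⟨w, hw, hzw⟩ := this
    refine ⟨_, Finset.mem_image_of_mem _ hw, ?_⟩
    have hw1 : ‖w‖ = 1 := by simpa using hs w hw
    have h1 : (starRingEnd ℂ) w * w = 1 := by
      rw [mul_comm, Complex.mul_conj, Complex.normSq_eq_norm_sq, hw1]; simp
    have : (starRingEnd ℂ) w * z - 1 = (starRingEnd ℂ) w * (z - w) := by
      rw [mul_sub, h1]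
    rw [this, norm_mul, RCLike.norm_conj, hw1, one_mul]
    simpa [dist_eq_norm] using hzw

/-- A compact multivalued function on the closed unit disc that has local holomorphic sections
through its nonzero values and vanishes on an arc of the circle vanishes at the centre. -/
lemma disc_relation_eq_zero {M : Set (ℂ × ℂ)} (hM : IsCompact M) (hsub : ∀ p ∈ M, ‖p.1‖ ≤ 1)
    (hsec : ∀ z a, (z, a) ∈ M → ‖z‖ < 1 → a ≠ 0 →
      ∃ h : ℂ → ℂ, AnalyticAt ℂ h z ∧ h z = a ∧ ∀ᶠ z' in 𝓝 z, (z', h z') ∈ M)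
    {η : ℝ} (hη : 0 < η) (harc : ∀ z a, (z, a) ∈ M → ‖z‖ = 1 → ‖z - 1‖ < η → a = 0)
    {a : ℂ} (ha : ((0 : ℂ), a) ∈ M) : a = 0 := by
  by_contra hne
  obtain ⟨t, ht1, ht⟩ := exists_finset_rotations hη
  obtain ⟨ω₀, hω₀, -⟩ := ht 1 (by simp)
  let Q : Set (ℂ × (t → ℂ)) := {q | ∀ ω : t, ((ω : ℂ) * q.1, q.2 ω) ∈ M}
  have hQclosed : IsClosed Q := by
    have : Q = ⋂ ω : t, (fun q : ℂ × (t → ℂ) => ((ω : ℂ) * q.1, q.2 ω)) ⁻¹' M := by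
      ext q; simp [Q]
    rw [this]
    exact isClosed_iInter fun ω => hM.isClosed.preimage (by fun_prop)
  obtain ⟨R, hR⟩ := hM.isBounded.subset_closedBall 0
  have hQb : Q ⊆ Metric.closedBall 0 (max 1 R) := by
    intro q hq
    rw [mem_closedBall_zero_iff, Prod.norm_def]
    refine max_le_max ?_ ?_
    · have := hsub _ (hq ⟨ω₀, hω₀⟩)
      simpa [ht1 ω₀ hω₀] using this
    · have hR0 : 0 ≤ R := by
        have := hR (hq ⟨ω₀, hω₀⟩)
        rw [mem_closedBall_zero_iff] at this
        exact (norm_nonneg _).trans this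
      refine (pi_norm_le_iff_of_nonneg hR0).2 fun ω => ?_
      have := hR (hq ω)
      rw [mem_closedBall_zero_iff] at this
      exact (norm_snd_le _).trans this
  have hQc : IsCompact Q := (isCompact_closedBall _ _).of_isClosed_subset hQclosed hQb
  have hmem0 : ((0 : ℂ), fun _ : t => a) ∈ Q := fun ω => by simpa using ha
  have hfc : Continuous fun q : ℂ × (t → ℂ) => ‖∏ ω, q.2 ω‖ := by fun_prop
  obtain ⟨q₀, hq₀, hmax⟩ := hQc.exists_isMaxOn ⟨_, hmem0⟩ hfc.continuousOn
  set m := ‖∏ ω, q₀.2 ω‖ with hm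
  have hmpos : 0 < m := by
    have : ‖∏ ω : t, a‖ ≤ m := hmax hmem0
    refine lt_of_lt_of_le ?_ this
    rw [norm_pos_iff]
    exact Finset.prod_ne_zero_iff.2 fun _ _ => hne
  let K : Set ℂ := Prod.fst '' (Q ∩ {q | ‖∏ ω, q.2 ω‖ = m})
  have hKc : IsCompact K :=
    (hQc.inter_right (isClosed_eq hfc continuous_const)).image continuous_fst
  have hKo : IsOpen K := by
    rw [isOpen_iff_mem_nhds]
    rintro z ⟨⟨z', b⟩, ⟨hq, hqm⟩, rfl⟩
    simp only [mem_ofPred_eq] at hqm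
    have hb : ∀ ω, b ω ≠ 0 := by
      have : ∏ ω, b ω ≠ 0 := by
        rw [← norm_pos_iff, hqm]; exact hmpos
      exact fun ω => Finset.prod_ne_zero_iff.1 this ω (Finset.mem_univ _)
    have hnorm : ∀ ω : t, ‖(ω : ℂ) * z'‖ = ‖z'‖ := fun ω => by simp [ht1 ω ω.2]
    have hz1 : ‖z'‖ < 1 := by
      have hle : ‖z'‖ ≤ 1 := by rw [← hnorm ⟨ω₀, hω₀⟩]; exact hsub _ (hq _)
      refine lt_of_le_of_ne hle fun h1 => ?_
      obtain ⟨ω, hω, hlt⟩ := ht z' h1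
      exact hb ⟨ω, hω⟩ (harc _ _ (hq ⟨ω, hω⟩) (by rw [hnorm, h1]) hlt)
    choose h hh1 hh2 hh3 using fun ω : t => hsec _ _ (hq ω) (by rw [hnorm]; exact hz1) (hb ω)
    let H : ℂ → ℂ := fun x => ∏ ω, h ω (ω * x)
    have hHan : AnalyticAt ℂ H z' := by
      refine Finset.analyticAt_fun_prod _ fun ω _ => ?_
      exact AnalyticAt.fun_comp (hh1 ω) (by fun_prop)
    have hev : ∀ᶠ x in 𝓝 z', (x, fun ω : t => h ω (ω * x)) ∈ Q := by
      have : ∀ ω : t, ∀ᶠ x in 𝓝 z', ((ω : ℂ) * x, h ω (ω * x)) ∈ M := fun ω => by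
        have hc : Tendsto (fun x : ℂ => (ω : ℂ) * x) (𝓝 z') (𝓝 (ω * z')) :=
          (continuous_const.mul continuous_id).tendsto _
        exact hc.eventually (hh3 ω)
      exact (eventually_all.2 this).mono fun x hx => hx
    have hHz : ‖H z'‖ = m := by
      simp only [H, hh2]; exact hqm
    have hloc : IsLocalMax (norm ∘ H) z' := by
      filter_upwards [hev] with x hx
      simp only [Function.comp, hHz]
      exact hmax hx
    have hd : ∀ᶠ x in 𝓝 z', DifferentiableAt ℂ H x :=
      hHan.eventually_analyticAt.mono fun x hx => hx.differentiableAt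
    have hconst := Complex.eventually_eq_of_isLocalMax_norm hd hloc
    filter_upwards [hev, hconst] with x hx hx2
    refine ⟨_, ⟨hx, ?_⟩, rfl⟩
    change ‖H x‖ = m
    rw [hx2, hHz]
  have hclopen : IsClopen K := ⟨hKc.isClosed, hKo⟩
  have hKne : K.Nonempty := ⟨q₀.1, q₀, ⟨hq₀, rfl⟩, rfl⟩
  have huniv := hclopen.eq_univ hKne
  rw [huniv] at hKc
  exact noncompact_univ ℂ hKc

/-- A multivalued function on a connected open set, compact over compact sets and having local
holomorphic sections along complex lines through its nonzero values, vanishes identically as soon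
as it vanishes on a nonempty open set. -/
lemma relation_eq_zero {E : Type*} [NormedAddCommGroup E] [NormedSpace ℂ E]
    {W A : Set E} (hW : IsOpen W) (hWc : IsPreconnected W) {M : Set (E × ℂ)}
    (hM : ∀ K ⊆ W, IsCompact K → IsCompact (M ∩ Prod.fst ⁻¹' K))
    (hsec : ∀ w a, (w, a) ∈ M → w ∈ W → a ≠ 0 → ∀ v : E,
      ∃ h : ℂ → ℂ, AnalyticAt ℂ h 0 ∧ h 0 = a ∧ ∀ᶠ t in 𝓝 (0 : ℂ), (w + t • v, h t) ∈ M)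
    (hA : IsOpen A) (hAne : (W ∩ A).Nonempty) (hA0 : ∀ w ∈ A, ∀ a, (w, a) ∈ M → a = 0)
    {w : E} (hw : w ∈ W) {a : ℂ} (ha : (w, a) ∈ M) : a = 0 := by
  let Z : Set E := {w | ∀ a, (w, a) ∈ M → a = 0}
  have hAZ : A ⊆ interior Z := interior_maximal (fun w hw => hA0 w hw) hA
  suffices h : W ⊆ interior Z from interior_subset (h hw) a ha
  refine hWc.subset_of_closure_inter_subset isOpen_interior
    (hAne.mono (inter_subset_inter_right _ hAZ)) ?_
  rintro b ⟨hb, hbW⟩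
  obtain ⟨r, hr, hrW⟩ := Metric.isOpen_iff.1 hW b hbW
  obtain ⟨e, he, heb⟩ := Metric.mem_closure_iff.1 hb (r / 3) (by positivity)
  rw [dist_comm] at heb
  suffices h : Metric.ball b (r / 3) ⊆ Z from
    interior_maximal h Metric.isOpen_ball (Metric.mem_ball_self (by positivity))
  intro w hw a ha
  rw [Metric.mem_ball] at hw
  let L : ℂ → E := fun z => w + z • (e - w)
  have hLc : Continuous L := by fun_prop
  have hLW : ∀ z : ℂ, ‖z‖ ≤ 1 → L z ∈ W := by
    intro z hz
    apply hrW
    rw [Metric.mem_ball]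
    have h1 : dist (L z) w ≤ dist e w := by
      simp only [L, dist_eq_norm, add_sub_cancel_left, norm_smul]
      exact mul_le_of_le_one_left (norm_nonneg _) hz
    have h2 : dist e w ≤ dist e b + dist w b := dist_triangle_right _ _ _
    have h3 := dist_triangle (L z) w b
    linarith
  obtain ⟨δ, hδ, hδZ⟩ := Metric.isOpen_iff.1 isOpen_interior e he
  have hKc : IsCompact (L '' Metric.closedBall 0 1) := (isCompact_closedBall _ _).image hLc
  have hKW : L '' Metric.closedBall 0 1 ⊆ W := by
    rintro _ ⟨z, hz, rfl⟩
    exact hLW z (by simpa using hz)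
  have hMK := hM _ hKW hKc
  let M' : Set (ℂ × ℂ) := {q | ‖q.1‖ ≤ 1 ∧ (L q.1, q.2) ∈ M}
  have hM'eq : M' = (Metric.closedBall (0 : ℂ) 1 ×ˢ
      (Prod.snd '' (M ∩ Prod.fst ⁻¹' (L '' Metric.closedBall 0 1)))) ∩
      (fun q : ℂ × ℂ => (L q.1, q.2)) ⁻¹' (M ∩ Prod.fst ⁻¹' (L '' Metric.closedBall 0 1)) := by
    ext ⟨z, c⟩
    constructor
    · rintro ⟨h1, h2⟩
      have hz : z ∈ Metric.closedBall (0 : ℂ) 1 := by simpa using h1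
      exact ⟨⟨hz, ⟨(L z, c), ⟨h2, mem_image_of_mem _ hz⟩, rfl⟩⟩, h2, mem_image_of_mem _ hz⟩
    · rintro ⟨⟨h1, -⟩, h2, -⟩
      exact ⟨by simpa using h1, h2⟩
  have hM'c : IsCompact M' := by
    rw [hM'eq]
    exact ((isCompact_closedBall _ _).prod (hMK.image continuous_snd)).inter_right
      (hMK.isClosed.preimage (by fun_prop))
  have hη : 0 < δ / (‖e - w‖ + 1) := by positivity
  refine disc_relation_eq_zero hM'c (fun q hq => hq.1) ?_ hη ?_ (a := a)
    ⟨by simp, by simpa [L] using ha⟩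
  · rintro z c ⟨hz, hzc⟩ hz1 hc
    obtain ⟨h, h1, h2, h3⟩ := hsec _ _ hzc (hLW z hz) hc (e - w)
    refine ⟨fun x => h (x - z), ?_, by simpa using h2, ?_⟩
    · refine AnalyticAt.fun_comp (f := fun x : ℂ => x - z) (g := h) ?_ (by fun_prop)
      simpa using h1
    · have ht : Tendsto (fun x : ℂ => x - z) (𝓝 z) (𝓝 0) := by
        have : Continuous fun x : ℂ => x - z := by fun_prop
        simpa using this.tendsto z
      have hlt : ∀ᶠ x in 𝓝 z, ‖x‖ < 1 := continuous_norm.continuousAt.eventually_lt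
        continuousAt_const hz1
      filter_upwards [ht.eventually h3, hlt] with x hx hx1
      refine ⟨hx1.le, ?_⟩
      convert hx using 2
      simp only [L]
      module
  · rintro z c ⟨hz, hzc⟩ hz1 hzη
    refine interior_subset (hδZ ?_) c hzc
    rw [Metric.mem_ball, dist_eq_norm]
    have : L z - e = (z - 1) • (e - w) := by simp only [L]; module
    rw [this, norm_smul]
    calc ‖z - 1‖ * ‖e - w‖ ≤ ‖z - 1‖ * (‖e - w‖ + 1) := by gcongr; linarith
      _ < δ / (‖e - w‖ + 1) * (‖e - w‖ + 1) := by gcongr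
      _ = δ := by field_simp

/-- The determinant is an analytic function on endomorphisms. -/
lemma analyticAt_det {E : Type*} [NormedAddCommGroup E] [NormedSpace ℂ E]
    [FiniteDimensional ℂ E] (L : E →L[ℂ] E) :
    AnalyticAt ℂ (fun L : E →L[ℂ] E => L.det) L := by
  let b := Module.finBasis ℂ E
  have h : (fun L : E →L[ℂ] E => L.det) = fun L : E →L[ℂ] E =>
      ∑ σ : Equiv.Perm (Fin (Module.finrank ℂ E)), (Equiv.Perm.sign σ : ℤ) •
        ∏ i, b.equivFunL (L (b i)) (σ i) := by
    funext L
    rw [ContinuousLinearMap.det, ← LinearMap.det_toMatrix b, Matrix.det_apply]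
    simp [LinearMap.toMatrix_apply, Units.smul_def]
  rw [h]
  refine Finset.analyticAt_fun_sum _ fun σ _ => ?_
  simp only [zsmul_eq_mul]
  refine analyticAt_const.mul (Finset.analyticAt_fun_prod _ fun i _ => ?_)
  exact (((ContinuousLinearMap.proj (R := ℂ) (φ := fun _ => ℂ) (σ i)).comp
    (b.equivFunL : E →L[ℂ] (Fin (Module.finrank ℂ E) → ℂ))).comp
    (ContinuousLinearMap.apply ℂ E (b i))).analyticAt L

/-- The holomorphic inverse function theorem. -/
lemma exists_analytic_local_inverse {E F : Type*} [NormedAddCommGroup E] [NormedSpace ℂ E]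
    [CompleteSpace E] [NormedAddCommGroup F] [NormedSpace ℂ F] [CompleteSpace F] {f : E → F}
    {x : E} (hf : AnalyticAt ℂ f x)
    (e : E ≃L[ℂ] F) (he : fderiv ℂ f x = (e : E →L[ℂ] F)) :
    ∃ S : F → E, AnalyticAt ℂ S (f x) ∧ S (f x) = x ∧ (∀ᶠ w in 𝓝 (f x), f (S w) = w) ∧
      (∀ᶠ z in 𝓝 x, S (f z) = z) ∧ HasFDerivAt S (e.symm : F →L[ℂ] E) (f x) := by
  have hs : HasStrictFDerivAt f (e : E →L[ℂ] F) x := he ▸ hf.hasStrictFDerivAt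
  let P := hs.toOpenPartialHomeomorph f
  have hP : (P : E → F) = f := hs.toOpenPartialHomeomorph_coe
  have hx : x ∈ P.source := hs.mem_toOpenPartialHomeomorph_source
  refine ⟨P.symm, ?_, ?_, ?_, ?_, ?_⟩
  · have := P.analyticAt_symm' (i := e) hx (by rw [hP]; exact hf) (by rw [hP]; exact he)
    rwa [hP] at this
  · have := P.left_inv hx
    rwa [hP] at this
  · have := P.eventually_right_inverse' hx
    rwa [hP] at this
  · have := P.eventually_left_inverse hx
    rwa [hP] at this
  · exact hs.to_localInverse.hasFDerivAt

lemma isCompact_fibre_graph {E : Type*} [NormedAddCommGroup E]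
    {F : E → E} {C K : Set E} (hC : IsCompact C) (hF : ContinuousOn F C) (hK : IsCompact K)
    (N : ℕ) :
    IsCompact {q : E × (Fin N → E) | q.1 ∈ K ∧ ∀ i, q.2 i ∈ C ∧ F (q.2 i) = q.1} := by
  have hS : IsCompact (K ×ˢ (univ.pi fun _ : Fin N => C)) :=
    hK.prod (isCompact_univ_pi fun _ => hC)
  have hc : ContinuousOn (fun q : E × (Fin N → E) => fun i => F (q.2 i) - q.1)
      (K ×ˢ (univ.pi fun _ : Fin N => C)) := by
    refine continuousOn_pi.2 fun i => ContinuousOn.sub ?_ continuousOn_fst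
    exact hF.comp (by fun_prop) fun q hq => hq.2 i (mem_univ i)
  have := hc.preimage_isClosed_of_isClosed hS.isClosed (isClosed_singleton (x := 0))
  convert hS.of_isClosed_subset this inter_subset_left using 1
  ext ⟨w, x⟩
  simp only [mem_ofPred_eq, mem_inter_iff, mem_prod, mem_univ_pi, mem_preimage,
    mem_singleton_iff, funext_iff, Pi.zero_apply, sub_eq_zero]
  exact ⟨fun h => ⟨⟨h.1, fun i => (h.2 i).1⟩, fun i => (h.2 i).2⟩,
    fun h => ⟨h.1.1, fun i => ⟨h.1.2 i, h.2 i⟩⟩⟩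

/-- An analytic relation between the points of a generic fibre of a proper holomorphic map,
weighted by Jacobians, propagates to all fibres. -/
lemma fibre_relation_eq_zero {E : Type*} [NormedAddCommGroup E] [NormedSpace ℂ E]
    [FiniteDimensional ℂ E] {F : E → E} {O W A : Set E} (hO : IsOpen O)
    (hOb : Bornology.IsBounded O) (hF : AnalyticOnNhd ℂ F (closure O)) (hW : IsOpen W)
    (hWc : IsPreconnected W) (hFW : ∀ x ∈ frontier O, F x ∉ W) {N : ℕ}
    {f : (Fin N → E) → ℂ} (hf : AnalyticOnNhd ℂ f univ) (hA : IsOpen A)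
    (hAne : (W ∩ A).Nonempty)
    (hA0 : ∀ w ∈ W ∩ A, ∀ x : Fin N → E, (∀ i, x i ∈ O ∧ F (x i) = w) →
      f x * ∏ i, (fderiv ℂ F (x i)).det = 0) {w : E} (hw : w ∈ W) {x : Fin N → E}
    (hx : ∀ i, x i ∈ O ∧ F (x i) = w) : f x * ∏ i, (fderiv ℂ F (x i)).det = 0 := by
  have : ProperSpace E := FiniteDimensional.proper ℂ E
  have : CompleteSpace E := FiniteDimensional.complete ℂ E
  let C := closure O
  have hC : IsCompact C := hOb.isCompact_closure
  let Φ : E × (Fin N → E) → E × ℂ := fun q => (q.1, f q.2 * ∏ i, (fderiv ℂ F (q.2 i)).det)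
  let G : Set (E × (Fin N → E)) := {q | ∀ i, q.2 i ∈ C ∧ F (q.2 i) = q.1}
  have hGO : ∀ q ∈ G, q.1 ∈ W → ∀ i, q.2 i ∈ O := by
    intro q hq hqW i
    by_contra hi
    refine hFW (q.2 i) ?_ ((hq i).2 ▸ hqW)
    rw [hO.frontier_eq]
    exact ⟨(hq i).1, hi⟩
  have hJ : ∀ x ∈ C, AnalyticAt ℂ (fun x => (fderiv ℂ F x).det) x := fun x hx =>
    (analyticAt_det _).fun_comp (hF x hx).fderiv
  refine relation_eq_zero hW hWc (M := Φ '' G) ?_ ?_ (hW.inter hA) (by rwa [← inter_assoc, inter_self]) ?_ hw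
    (a := f x * ∏ i, (fderiv ℂ F (x i)).det)
    ⟨(w, x), fun i => ⟨subset_closure (hx i).1, (hx i).2⟩, rfl⟩
  · intro K _ hK
    have h1 := isCompact_fibre_graph hC hF.continuousOn hK N
    have h2 : ContinuousOn Φ
        {q : E × (Fin N → E) | q.1 ∈ K ∧ ∀ i, q.2 i ∈ C ∧ F (q.2 i) = q.1} := by
      refine continuousOn_fst.prodMk (ContinuousOn.mul ?_ ?_)
      · exact hf.continuousOn.comp continuousOn_snd fun _ _ => mem_univ _
      · refine continuousOn_finsetProd _ fun i _ => ?_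
        have : ContinuousOn (fun x => (fderiv ℂ F x).det) C := fun x hx =>
          (hJ x hx).continuousAt.continuousWithinAt
        exact this.comp (by fun_prop) fun q hq => (hq.2 i).1
    convert h1.image_of_continuousOn h2 using 1
    ext ⟨w, a⟩
    constructor
    · rintro ⟨⟨q, hq, hqe⟩, hK⟩
      refine ⟨q, ⟨?_, hq⟩, hqe⟩
      rw [← hqe] at hK
      exact hK
    · rintro ⟨q, hq, hqe⟩
      refine ⟨⟨q, hq.2, hqe⟩, ?_⟩
      rw [← hqe]
      exact hq.1
  · rintro w a ⟨⟨w', x⟩, hx, hxe⟩ hw ha v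
    obtain ⟨rfl, rfl⟩ := Prod.mk_inj.1 hxe
    dsimp only at hw ha ⊢
    have hxO := hGO _ hx hw
    have hdet : ∀ i, (fderiv ℂ F (x i)).det ≠ 0 := fun i =>
      Finset.prod_ne_zero_iff.1 (right_ne_zero_of_mul ha) i (Finset.mem_univ i)
    have hinv := fun i => exists_analytic_local_inverse (hF (x i) (hx i).1)
      ((fderiv ℂ F (x i)).toContinuousLinearEquivOfDetNeZero (hdet i)) (by ext; rfl)
    choose S hS hSx hSr hSl hS' using hinv
    have hFw : ∀ i, F (x i) = w' := fun i => (hx i).2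
    simp only [hFw] at hS hSx hSr
    have hline : AnalyticAt ℂ (fun t : ℂ => w' + t • v) 0 := by fun_prop
    have hl0 : w' + (0 : ℂ) • v = w' := by simp
    have hSa : ∀ i, AnalyticAt ℂ (fun t : ℂ => S i (w' + t • v)) 0 := fun i =>
      AnalyticAt.fun_comp_of_eq (hS i) hline hl0
    refine ⟨fun t => f (fun i => S i (w' + t • v)) *
      ∏ i, (fderiv ℂ F (S i (w' + t • v))).det, ?_, ?_, ?_⟩
    · refine AnalyticAt.mul ?_ (Finset.analyticAt_fun_prod _ fun i _ => ?_)
      · exact (hf _ (mem_univ _)).fun_comp (analyticAt_pi_iff.2 hSa)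
      · refine AnalyticAt.fun_comp_of_eq (g := fun x => (fderiv ℂ F x).det) (hJ (x i) (hx i).1)
          (hSa i) ?_
        simp [hSx]
    · simp [hSx]
    · have ht : Tendsto (fun t : ℂ => w' + t • v) (𝓝 0) (𝓝 w') := by
        have := hline.continuousAt.tendsto
        rwa [hl0] at this
      have hnear : ∀ᶠ t in 𝓝 (0 : ℂ), ∀ i, S i (w' + t • v) ∈ O := by
        refine eventually_all.2 fun i => ?_
        have := (hSa i).continuousAt.tendsto
        simp only [hl0, hSx] at this
        exact this (hO.mem_nhds (hxO i))
      filter_upwards [hnear, eventually_all.2 fun i => ht.eventually (hSr i)] with t h1 h2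
      exact ⟨(w' + t • v, fun i => S i (w' + t • v)),
        fun i => ⟨subset_closure (h1 i), h2 i⟩, rfl⟩
  · rintro w hw a ⟨⟨w', x⟩, hx, hxe⟩
    obtain ⟨rfl, rfl⟩ := Prod.mk_inj.1 hxe
    exact hA0 _ hw x fun i => ⟨hGO _ hx hw.1 i, (hx i).2⟩

lemma eventually_det_add_smul_ne_zero {E : Type*} [NormedAddCommGroup E] [NormedSpace ℂ E]
    [FiniteDimensional ℂ E] (L : E →L[ℂ] E) :
    ∀ᶠ ε in 𝓝[≠] (0 : ℂ), (L + ε • ContinuousLinearMap.id ℂ E).det ≠ 0 := by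
  let p := LinearMap.charpoly (-(L : E →ₗ[ℂ] E))
  have hp : p ≠ 0 := (LinearMap.charpoly_monic _).ne_zero
  have hfin : {ε : ℂ | p.IsRoot ε}.Finite := Polynomial.finite_setOfPred_isRoot hp
  have h : ∀ᶠ ε in 𝓝[≠] (0 : ℂ), ε ∉ {ε : ℂ | p.IsRoot ε} :=
    Filter.le_cofinite_iff_compl_singleton_mem.2 (fun ε => by
      rcases eq_or_ne ε 0 with rfl | h
      · exact self_mem_nhdsWithin
      · exact mem_nhdsWithin_of_mem_nhds (isOpen_ne.mem_nhds h.symm))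
      hfin.compl_mem_cofinite
  filter_upwards [h] with ε hε
  change ¬ p.IsRoot ε at hε
  rw [Polynomial.IsRoot, LinearMap.eval_charpoly] at hε
  rw [ContinuousLinearMap.det]
  convert hε using 2
  ext x
  simp [add_comm]

/-- A holomorphic map between spaces of the same dimension is open at an isolated point of
its fibre. -/
lemma nhds_le_map_of_isolated {E : Type*} [NormedAddCommGroup E] [NormedSpace ℂ E]
    [FiniteDimensional ℂ E] {F : E → E} {x₀ : E} (hF : AnalyticAt ℂ F x₀)
    (hiso : ∀ᶠ x in 𝓝[≠] x₀, F x ≠ F x₀) : 𝓝 (F x₀) ≤ map F (𝓝 x₀) := by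
  have : ProperSpace E := FiniteDimensional.proper ℂ E
  have : NormedSpace ℝ E := NormedSpace.restrictScalars ℝ ℂ E
  intro s hs
  rw [mem_map] at hs
  obtain ⟨r, hr, hrs⟩ : ∃ r > 0, ∀ x ∈ Metric.closedBall x₀ r,
      AnalyticAt ℂ F x ∧ (x ≠ x₀ → F x ≠ F x₀) ∧ F x ∈ s := by
    have h := hF.eventually_analyticAt.and ((eventually_nhdsWithin_iff.1 hiso).and hs)
    obtain ⟨r, hr, h⟩ := Metric.nhds_basis_closedBall.eventually_iff.1 h
    exact ⟨r, hr, fun x hx => h hx⟩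
  have hcont : ContinuousOn F (Metric.closedBall x₀ r) := fun x hx =>
    (hrs x hx).1.continuousAt.continuousWithinAt
  have hne : F x₀ ∉ F '' Metric.sphere x₀ r := by
    rintro ⟨x, hx, hxe⟩
    refine (hrs x (Metric.sphere_subset_closedBall hx)).2.1 ?_ hxe
    rintro rfl
    simp at hx
    exact hr.ne hx
  have hcl : IsClosed (F '' Metric.sphere x₀ r) :=
    ((isCompact_sphere x₀ r).image_of_continuousOn
      (hcont.mono Metric.sphere_subset_closedBall)).isClosed
  obtain ⟨δ, hδ, hδs⟩ := Metric.isOpen_iff.1 hcl.isOpen_compl _ hne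
  refine mem_of_superset (Metric.ball_mem_nhds (F x₀) (half_pos hδ)) ?_
  suffices h : Metric.ball (F x₀) (δ / 2) ⊆ closure (F '' Metric.closedBall x₀ r) by
    rw [((isCompact_closedBall x₀ r).image_of_continuousOn hcont).isClosed.closure_eq] at h
    intro w hw
    obtain ⟨x, hx, rfl⟩ := h hw
    exact (hrs x hx).2.2
  intro w hw
  rw [Metric.mem_closure_iff]
  intro η hη
  obtain ⟨ε, hdet, hε⟩ : ∃ ε : ℂ,
      (fderiv ℂ F x₀ + ε • ContinuousLinearMap.id ℂ E).det ≠ 0 ∧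
      ‖ε‖ * r < min η (δ / 2) := by
    have h1 : ∀ᶠ ε : ℂ in 𝓝[≠] 0, ‖ε‖ * r < min η (δ / 2) := by
      refine mem_nhdsWithin_of_mem_nhds ?_
      have : ContinuousAt (fun ε : ℂ => ‖ε‖ * r) 0 := by fun_prop
      exact this.eventually_lt continuousAt_const (by simp; exact ⟨hη, hδ⟩)
    exact ((eventually_det_add_smul_ne_zero _).and h1).exists
  let Fε : E → E := fun x => F x + ε • (x - x₀)
  have hFε : ∀ x ∈ Metric.closedBall x₀ r, AnalyticAt ℂ Fε x := fun x hx => by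
    have := (hrs x hx).1
    fun_prop
  have hnear : ∀ x ∈ Metric.closedBall x₀ r, dist (F x) (Fε x) < min η (δ / 2) := by
    intro x hx
    refine lt_of_le_of_lt ?_ hε
    simp only [Fε, dist_self_add_right, norm_smul]
    gcongr
    simpa [dist_eq_norm] using hx
  by_contra! hcon
  have hw' : w ∉ Fε '' Metric.closedBall x₀ r := by
    rintro ⟨x, hx, rfl⟩
    have := hcon _ (mem_image_of_mem F hx)
    rw [dist_comm] at this
    exact absurd ((hnear x hx).trans_le (min_le_left _ _)) this.not_gt
  have hcl' : IsClosed (Fε '' Metric.closedBall x₀ r) :=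
    ((isCompact_closedBall x₀ r).image_of_continuousOn
      fun x hx => (hFε x hx).continuousAt.continuousWithinAt).isClosed
  have hx₀ : Fε x₀ = F x₀ := by simp [Fε]
  have hder : fderiv ℂ Fε x₀ = fderiv ℂ F x₀ + ε • ContinuousLinearMap.id ℂ E := by
    have h1 := (hrs x₀ (Metric.mem_closedBall_self hr.le)).1.differentiableAt.hasFDerivAt
    exact (h1.add (((hasFDerivAt_id x₀).sub_const x₀).const_smul ε)).fderiv
  have hclos : closure (Metric.ball x₀ r) = Metric.closedBall x₀ r := closure_ball x₀ hr.ne'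
  have key := fibre_relation_eq_zero (F := Fε) (O := Metric.ball x₀ r)
    (W := Metric.ball (F x₀) (δ / 2)) (A := (Fε '' Metric.closedBall x₀ r)ᶜ) Metric.isOpen_ball
    Metric.isBounded_ball (by rw [hclos]; exact hFε) Metric.isOpen_ball
    (convex_ball _ _).isPreconnected ?_ (N := 1) (f := fun _ => 1) (fun _ _ => analyticAt_const)
    hcl'.isOpen_compl ⟨w, hw, hw'⟩ ?_ (w := F x₀) (Metric.mem_ball_self (half_pos hδ))
    (x := fun _ => x₀) (fun _ => ⟨Metric.mem_ball_self hr, hx₀⟩)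
  · simp [hder] at key
    exact hdet key
  · intro x hx hxW
    have hx' : x ∈ Metric.sphere x₀ r := by rwa [frontier_ball x₀ hr.ne'] at hx
    have h1 : F x ∉ Metric.ball (F x₀) δ := fun h => hδs h (mem_image_of_mem F hx')
    rw [Metric.mem_ball] at h1 hxW
    have h2 := (hnear x (Metric.sphere_subset_closedBall hx')).trans_le (min_le_right _ _)
    have := dist_triangle (F x) (Fε x) (F x₀)
    linarith
  · rintro w' ⟨-, hw'⟩ x hx
    exact absurd ⟨x 0, Metric.ball_subset_closedBall (hx 0).1, (hx 0).2⟩ hw'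

lemma det_eq_zero_iff_exists {E : Type*} [NormedAddCommGroup E] [NormedSpace ℂ E]
    [FiniteDimensional ℂ E] (L : E →L[ℂ] E) : L.det = 0 ↔ ∃ v, v ≠ 0 ∧ L v = 0 := by
  rw [ContinuousLinearMap.det, LinearMap.det_eq_zero_iff_ker_ne_bot, Submodule.ne_bot_iff]
  exact ⟨fun ⟨v, h1, h2⟩ => ⟨v, h2, h1⟩, fun ⟨v, h1, h2⟩ => ⟨v, h2, h1⟩⟩

/-- Sard's theorem for equidimensional holomorphic maps. -/
lemma exists_regular_value {E : Type*} [NormedAddCommGroup E] [NormedSpace ℂ E]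
    [FiniteDimensional ℂ E] {F : E → E} {O W : Set E} (hF : AnalyticOnNhd ℂ F O)
    (hW : IsOpen W) (hne : W.Nonempty) :
    ∃ w ∈ W, ∀ x ∈ O, F x = w → (fderiv ℂ F x).det ≠ 0 := by
  let _ : NormedSpace ℝ E := NormedSpace.restrictScalars ℝ ℂ E
  have : IsScalarTower ℝ ℂ E := IsScalarTower.of_algebraMap_smul fun r x => rfl
  have : FiniteDimensional ℝ E := FiniteDimensional.trans ℝ ℂ E
  let _ : MeasurableSpace E := borel E
  have : BorelSpace E := ⟨rfl⟩
  let μ : MeasureTheory.Measure E := MeasureTheory.Measure.addHaar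
  by_contra! hcon
  have h0 : μ (F '' {x ∈ O | (fderiv ℂ F x).det = 0}) = 0 := by
    refine MeasureTheory.addHaar_image_eq_zero_of_det_fderivWithin_eq_zero μ
      (f' := fun x => (fderiv ℂ F x).restrictScalars ℝ) ?_ ?_
    · intro x hx
      exact ((hF x hx.1).differentiableAt.hasFDerivAt.restrictScalars ℝ).hasFDerivWithinAt
    · intro x hx
      obtain ⟨v, hv, hv0⟩ := (det_eq_zero_iff_exists _).1 hx.2
      rw [ContinuousLinearMap.det, LinearMap.det_eq_zero_iff_ker_ne_bot, Submodule.ne_bot_iff]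
      exact ⟨v, hv0, hv⟩
  refine (hW.measure_pos μ hne).ne' (MeasureTheory.measure_mono_null ?_ h0)
  intro w hw
  obtain ⟨x, hx, hxw, hd⟩ := hcon w hw
  exact ⟨x, ⟨hx, hd⟩, hxw⟩

/-- An analytic map with injective derivative is locally injective. -/
lemma exists_nhds_injOn_of_det_ne_zero {E : Type*} [NormedAddCommGroup E] [NormedSpace ℂ E]
    [FiniteDimensional ℂ E] {F : E → E} {x : E} (hF : AnalyticAt ℂ F x)
    (hd : (fderiv ℂ F x).det ≠ 0) : ∃ V, IsOpen V ∧ x ∈ V ∧ InjOn F V := by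
  have : CompleteSpace E := FiniteDimensional.complete ℂ E
  obtain ⟨S, -, -, -, hS, -⟩ := exists_analytic_local_inverse hF
    ((fderiv ℂ F x).toContinuousLinearEquivOfDetNeZero hd) (by ext; rfl)
  obtain ⟨V, hV, hVo, hxV⟩ := mem_nhds_iff.1 hS
  refine ⟨V, hVo, hxV, fun a ha b hb hab => ?_⟩
  have h1 : S (F a) = a := hV ha
  have h2 : S (F b) = b := hV hb
  rw [← h1, ← h2, hab]

lemma finite_of_isCompact_of_locally_finite {E : Type*} [TopologicalSpace E] {K : Set E}
    (hK : IsCompact K) (h : ∀ x ∈ K, ∃ V ∈ 𝓝 x, (K ∩ V).Finite) : K.Finite := by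
  choose! V hV hfin using h
  obtain ⟨t, ht, hcov⟩ := hK.elim_nhds_subcover V hV
  refine (t.finite_toSet.biUnion fun x hx => hfin x (ht x hx)).subset fun y hy => ?_
  obtain ⟨x, hx, hyx⟩ := mem_iUnion₂.1 (hcov hy)
  exact mem_iUnion₂.2 ⟨x, hx, hy, hyx⟩

/-- Fibres near a finite regular fibre have no more points than that fibre. -/
lemma exists_nhds_fibre_not_injective {E : Type*} [NormedAddCommGroup E] [NormedSpace ℂ E]
    [FiniteDimensional ℂ E] {F : E → E} {O : Set E}
    (hOb : Bornology.IsBounded O) (hF : AnalyticOnNhd ℂ F (closure O)) {w : E} (s : Finset E)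
    (hs : ∀ x ∈ closure O, F x = w → x ∈ s) (hd : ∀ x ∈ s, AnalyticAt ℂ F x ∧
      (fderiv ℂ F x).det ≠ 0) {N : ℕ} (hN : s.card < N) :
    ∃ A, IsOpen A ∧ w ∈ A ∧ ∀ v ∈ A, ∀ x : Fin N → E, (∀ i, x i ∈ O ∧ F (x i) = v) →
      ∃ i j, i < j ∧ x i = x j := by
  have : ProperSpace E := FiniteDimensional.proper ℂ E
  choose! V hVo hxV hVi using fun x (hx : x ∈ s) =>
    exists_nhds_injOn_of_det_ne_zero (hd x hx).1 (hd x hx).2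
  let C := closure O \ ⋃ x ∈ s, V x
  have hC : IsCompact C := hOb.isCompact_closure.diff
    (isOpen_biUnion fun x hx => hVo x hx)
  have hFC : IsClosed (F '' C) :=
    (hC.image_of_continuousOn (hF.continuousOn.mono sdiff_subset)).isClosed
  refine ⟨(F '' C)ᶜ, hFC.isOpen_compl, ?_, ?_⟩
  · rintro ⟨x, ⟨hx, hxn⟩, hxw⟩
    exact hxn (mem_iUnion₂.2 ⟨x, hs x hx hxw, hxV x (hs x hx hxw)⟩)
  · intro v hv x hx
    have h : ∀ i, ∃ y ∈ s, x i ∈ V y := by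
      intro i
      by_contra! hcon
      refine hv ⟨x i, ⟨subset_closure (hx i).1, ?_⟩, (hx i).2⟩
      simpa using hcon
    choose y hy hxy using h
    obtain ⟨i, j, hij, he⟩ : ∃ i j, i ≠ j ∧ y i = y j := by
      obtain ⟨i, -, j, -, hij, he⟩ := Finset.exists_ne_map_eq_of_card_lt_of_maps_to
        (s := (Finset.univ : Finset (Fin N))) (t := s) (by simpa using hN) (f := y)
        (fun i _ => hy i)
      exact ⟨i, j, hij, he⟩
    have hx' : x i = x j :=
      hVi (y i) (hy i) (hxy i) (he ▸ hxy j) ((hx i).2.trans (hx j).2.symm)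
    rcases lt_or_gt_of_ne hij with h | h
    · exact ⟨i, j, h, hx'⟩
    · exact ⟨j, i, h, hx'.symm⟩

/-- A vector field with prescribed zeros at finitely many points and identity derivative
there. -/
lemma exists_analytic_vanishing {E : Type*} [NormedAddCommGroup E] [NormedSpace ℂ E]
    {N : ℕ} {a : Fin N → E} (ha : Function.Injective a) :
    ∃ L : E → E, (∀ x, AnalyticAt ℂ L x) ∧
      ∀ i, L (a i) = 0 ∧ HasFDerivAt L (ContinuousLinearMap.id ℂ E) (a i) := by
  have hex : ∀ i j, ∃ l : E →L[ℂ] ℂ, i ≠ j → l (a i - a j) = 1 := by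
    intro i j
    by_cases h : i = j
    · exact ⟨0, fun h' => absurd h h'⟩
    · obtain ⟨l, hl⟩ := SeparatingDual.exists_eq_one (R := ℂ) (sub_ne_zero.2 (ha.ne h))
      exact ⟨l, fun _ => hl⟩
  choose l hl using hex
  let lam : Fin N → E → ℂ := fun j x => ∏ k ∈ Finset.univ.erase j, l j k (x - a k)
  have hlamA : ∀ j x, AnalyticAt ℂ (lam j) x := fun j x => by
    refine Finset.analyticAt_fun_prod _ fun k _ => ?_
    exact ((l j k).analyticAt _).comp_of_eq (analyticAt_id.sub analyticAt_const) rfl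
  have hlam1 : ∀ j, lam j (a j) = 1 := fun j => Finset.prod_eq_one fun k hk =>
    hl j k (Finset.ne_of_mem_erase hk).symm
  have hlam0 : ∀ j k, j ≠ k → lam j (a k) = 0 := fun j k hjk =>
    Finset.prod_eq_zero (Finset.mem_erase.2 ⟨hjk.symm, Finset.mem_univ _⟩) (by simp)
  refine ⟨fun x => ∑ j, lam j x ^ 2 • (x - a j), fun x => ?_, fun i => ⟨?_, ?_⟩⟩
  · exact Finset.analyticAt_fun_sum _ fun j _ =>
      ((hlamA j x).pow 2).smul (analyticAt_id.sub analyticAt_const)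
  · refine Finset.sum_eq_zero fun j _ => ?_
    rcases eq_or_ne j i with rfl | h
    · simp
    · simp [hlam0 j i h]
  · have hterm : ∀ j, HasFDerivAt (fun x => lam j x ^ 2 • (x - a j))
        (if j = i then ContinuousLinearMap.id ℂ E else 0) (a i) := by
      intro j
      have h1 := ((hlamA j (a i)).differentiableAt.hasFDerivAt.pow 2).smul
        ((hasFDerivAt_id (a i)).sub_const (a j))
      refine h1.congr_fderiv ?_
      split_ifs with h
      · subst h
        simp [hlam1]
      · ext v
        simp [hlam0 j i h]
    have := HasFDerivAt.fun_sum (u := Finset.univ) fun j _ => hterm j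
    simpa using this

lemma hasFDerivAt_deformation {E : Type*} [NormedAddCommGroup E] [NormedSpace ℂ E]
    {F L : E → E} {F' L' : E →L[ℂ] E} {x : E} (hF : HasFDerivAt F F' x)
    (hL : HasFDerivAt L L' x) (ε : ℂ) :
    ∃ D : E × ℂ →L[ℂ] E × ℂ,
      HasFDerivAt (fun q : E × ℂ => (F q.1 + q.2 • L q.1, q.2)) D (x, ε) ∧
      ∀ v τ, D (v, τ) = (F' v + ε • L' v + τ • L x, τ) := by
  have h1 : HasFDerivAt (fun q : E × ℂ => F q.1) _ (x, ε) :=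
    HasFDerivAt.comp (x, ε) hF (hasFDerivAt_fst (𝕜 := ℂ) (E := E) (F := ℂ))
  have h2 : HasFDerivAt (fun q : E × ℂ => L q.1) _ (x, ε) :=
    HasFDerivAt.comp (x, ε) hL (hasFDerivAt_fst (𝕜 := ℂ) (E := E) (F := ℂ))
  have h3 : HasFDerivAt (fun q : E × ℂ => q.2) _ (x, ε) :=
    hasFDerivAt_snd (𝕜 := ℂ) (E := E) (F := ℂ)
  refine ⟨_, (h1.add (h3.smul h2)).prodMk h3, fun v τ => ?_⟩
  simp [add_assoc]

/-- A holomorphic map that is proper over a neighborhood of `w₀` has finite fibre over `w₀`. -/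
lemma finite_fibre {E : Type*} [NormedAddCommGroup E] [NormedSpace ℂ E]
    [FiniteDimensional ℂ E] {F : E → E} {O : Set E} (hO : IsOpen O)
    (hOb : Bornology.IsBounded O) (hF : AnalyticOnNhd ℂ F (closure O)) {w₀ : E}
    (hw₀ : ∀ x ∈ frontier O, F x ≠ w₀) : {x ∈ O | F x = w₀}.Finite := by
  have : ProperSpace E := FiniteDimensional.proper ℂ E
  let _ : NormedSpace ℝ E := NormedSpace.restrictScalars ℝ ℂ E
  have hC : IsCompact (closure O) := hOb.isCompact_closure
  have hfr : IsClosed (F '' frontier O) :=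
    ((hC.of_isClosed_subset isClosed_frontier frontier_subset_closure).image_of_continuousOn
      (hF.continuousOn.mono frontier_subset_closure)).isClosed
  obtain ⟨R, hR, hRF⟩ := Metric.isOpen_iff.1 hfr.isOpen_compl w₀
    (fun ⟨x, hx, hxw⟩ => hw₀ x hx hxw)
  let δ := R / 2
  have hδ : 0 < δ := half_pos hR
  obtain ⟨w₁, hw₁, hreg⟩ := exists_regular_value (hF.mono subset_closure)
    (Metric.isOpen_ball (x := w₀) (ε := δ)) ⟨w₀, Metric.mem_ball_self hδ⟩
  have hfront : ∀ x ∈ closure O, x ∉ O → R ≤ dist (F x) w₀ := by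
    intro x hx hxO
    by_contra! h
    exact hRF (Metric.mem_ball.2 h) ⟨x, by rw [hO.frontier_eq]; exact ⟨hx, hxO⟩, rfl⟩
  have hKO : ∀ x ∈ closure O, F x = w₁ → x ∈ O := by
    intro x hx hxw
    by_contra hxO
    have := hfront x hx hxO
    rw [hxw] at this
    have h2 := Metric.mem_ball.1 hw₁
    simp only [δ] at h2
    linarith
  have hKfin : (closure O ∩ F ⁻¹' {w₁}).Finite := by
    refine finite_of_isCompact_of_locally_finite (hC.of_isClosed_subset
      (hF.continuousOn.preimage_isClosed_of_isClosed isClosed_closure isClosed_singleton)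
      inter_subset_left) fun x hx => ?_
    obtain ⟨V, hVo, hxV, hVi⟩ := exists_nhds_injOn_of_det_ne_zero (hF x hx.1)
      (hreg x (hKO x hx.1 hx.2) hx.2)
    refine ⟨V, hVo.mem_nhds hxV, Set.Subsingleton.finite fun a ha b hb => ?_⟩
    exact hVi ha.2 hb.2 (ha.1.2.trans hb.1.2.symm)
  let s := hKfin.toFinset
  by_contra hinf
  let N := s.card + 1
  let a : Fin N → E := fun i => (Set.Infinite.natEmbedding _ hinf i : E)
  have ha : Function.Injective a := fun i j hij =>
    Fin.val_injective ((Set.Infinite.natEmbedding _ hinf).injective (Subtype.val_injective hij))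
  have haO : ∀ i, a i ∈ O ∧ F (a i) = w₀ := fun i => (Set.Infinite.natEmbedding _ hinf i).2
  obtain ⟨L, hL, hLa⟩ := exists_analytic_vanishing ha
  obtain ⟨B, hB⟩ := hC.exists_bound_of_continuousOn (f := L)
    fun x _ => (hL x).continuousAt.continuousWithinAt
  let ρ := δ / (|B| + 1)
  have hρ : 0 < ρ := by positivity
  have hρB : ρ * |B| ≤ δ := by
    have : ρ * (|B| + 1) = δ := div_mul_cancel₀ _ (by positivity)
    nlinarith
  let O' : Set (E × ℂ) := O ×ˢ Metric.ball 0 ρ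
  let F' : E × ℂ → E × ℂ := fun q => (F q.1 + q.2 • L q.1, q.2)
  have hcl : closure O' = closure O ×ˢ Metric.closedBall 0 ρ := by
    rw [closure_prod_eq, closure_ball _ hρ.ne']
  have hF' : ∀ q : E × ℂ, q.1 ∈ closure O → AnalyticAt ℂ F' q := by
    intro q hq
    have h1 : AnalyticAt ℂ (fun q : E × ℂ => F q.1) q := (hF q.1 hq).fun_comp analyticAt_fst
    have h2 : AnalyticAt ℂ (fun q : E × ℂ => L q.1) q := (hL q.1).fun_comp analyticAt_fst
    exact (h1.add (analyticAt_snd.smul h2)).prod analyticAt_snd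
  have hdet : ∀ x ∈ closure O, ∀ ε : ℂ, (fderiv ℂ F x + ε • fderiv ℂ L x).det ≠ 0 →
      (fderiv ℂ F' (x, ε)).det ≠ 0 := by
    intro x hx ε hd hd'
    obtain ⟨D, hD, hDv⟩ := hasFDerivAt_deformation (hF x hx).differentiableAt.hasFDerivAt
      (hL x).differentiableAt.hasFDerivAt ε
    rw [hD.fderiv] at hd'
    obtain ⟨⟨v, τ⟩, hv, hv0⟩ := (det_eq_zero_iff_exists _).1 hd'
    rw [hDv, Prod.mk_eq_zero] at hv0
    obtain ⟨h1, rfl⟩ := hv0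
    refine hd ((det_eq_zero_iff_exists _).2 ⟨v, fun h => hv (by simp [h]), ?_⟩)
    simpa using h1
  have hO'b : Bornology.IsBounded O' := hOb.prod Metric.isBounded_ball
  obtain ⟨A, hA, hwA, hAinj⟩ := exists_nhds_fibre_not_injective (F := F') (O := O')
    (w := (w₁, 0)) hO'b (fun q hq => hF' q (by rw [hcl] at hq; exact hq.1))
    (s.map (Function.Embedding.sectL E (0 : ℂ))) (N := N) (by
      rintro ⟨x, ε⟩ hx hxw
      rw [hcl] at hx
      obtain ⟨h1, h2⟩ := Prod.mk_inj.1 hxw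
      dsimp only at h1 h2
      subst h2
      simp only [zero_smul, add_zero] at h1
      simp only [Finset.mem_map, s, Finite.mem_toFinset]
      exact ⟨x, ⟨hx.1, h1⟩, rfl⟩) (by
      rintro q hq
      simp only [Finset.mem_map, s, Finite.mem_toFinset] at hq
      obtain ⟨x, hx, rfl⟩ := hq
      exact ⟨hF' _ hx.1, hdet x hx.1 0 (by simpa using hreg x (hKO x hx.1 hx.2) hx.2)⟩) (by
      simp [N])
  obtain ⟨ε, hεd, hερ⟩ : ∃ ε : ℂ,
      (∀ i, (fderiv ℂ F (a i) + ε • ContinuousLinearMap.id ℂ E).det ≠ 0) ∧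
      ε ∈ Metric.ball (0 : ℂ) ρ :=
    ((eventually_all.2 fun i => eventually_det_add_smul_ne_zero (fderiv ℂ F (a i))).and
      (mem_nhdsWithin_of_mem_nhds (Metric.ball_mem_nhds _ hρ))).exists
  have hex : ∀ i j, ∃ l : E →L[ℂ] ℂ, i ≠ j → l (a i - a j) = 1 := by
    intro i j
    by_cases h : i = j
    · exact ⟨0, fun h' => absurd h h'⟩
    · obtain ⟨l, hl⟩ := SeparatingDual.exists_eq_one (R := ℂ) (sub_ne_zero.2 (ha.ne h))
      exact ⟨l, fun _ => hl⟩
  choose l hl using hex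
  have key := fibre_relation_eq_zero (F := F') (O := O')
    (W := Metric.ball w₀ δ ×ˢ Metric.ball 0 ρ) (A := A) (hO.prod Metric.isOpen_ball) hO'b
    (fun q hq => hF' q (by rw [hcl] at hq; exact hq.1))
    (Metric.isOpen_ball.prod Metric.isOpen_ball)
    ((convex_ball _ _).isPreconnected.prod (convex_ball _ _).isPreconnected) ?_ (N := N)
    (f := fun x => ∏ i, ∏ j ∈ Finset.univ.filter (fun j => i < j), l i j ((x i).1 - (x j).1)) ?_
    hA ⟨(w₁, 0), ⟨hw₁, Metric.mem_ball_self hρ⟩, hwA⟩ ?_ (w := (w₀, ε))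
    ⟨Metric.mem_ball_self hδ, hερ⟩ (x := fun i => (a i, ε)) (fun i => ⟨⟨(haO i).1, hερ⟩, ?_⟩)
  · refine mul_ne_zero ?_ (Finset.prod_ne_zero_iff.2 fun i _ => ?_) key
    · refine Finset.prod_ne_zero_iff.2 fun i _ => Finset.prod_ne_zero_iff.2 fun j hj => ?_
      rw [hl i j (Finset.mem_filter.1 hj).2.ne]
      exact one_ne_zero
    · refine hdet _ (subset_closure (haO i).1) ε ?_
      rw [(hLa i).2.fderiv]
      exact hεd i
  · rintro ⟨x, η⟩ hx ⟨hxW, hη⟩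
    rw [(hO.prod Metric.isOpen_ball).frontier_eq, hcl] at hx
    obtain ⟨⟨hx1, hx2⟩, hx3⟩ := hx
    have hxO : x ∉ O := fun h => hx3 ⟨h, hη⟩
    have h1 := hfront x hx1 hxO
    have h2 : dist (F x) (F x + η • L x) ≤ δ := by
      rw [dist_self_add_right, norm_smul]
      refine le_trans ?_ hρB
      have h3 : ‖η‖ ≤ ρ := by simpa using hx2
      exact mul_le_mul h3 ((hB x hx1).trans (le_abs_self B)) (norm_nonneg _) hρ.le
    have h3 : dist (F x + η • L x) w₀ < δ := hxW
    have h4 := dist_triangle (F x) (F x + η • L x) w₀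
    have h5 : R = δ + δ := by simp [δ]
    linarith
  · intro x _
    refine Finset.analyticAt_fun_prod _ fun i _ => Finset.analyticAt_fun_prod _ fun j _ => ?_
    exact ((l i j).comp ((ContinuousLinearMap.fst ℂ E ℂ).comp
      (ContinuousLinearMap.proj (R := ℂ) (φ := fun _ : Fin N => E × ℂ) i -
        ContinuousLinearMap.proj (R := ℂ) (φ := fun _ : Fin N => E × ℂ) j))).analyticAt x
  · rintro w ⟨-, hw⟩ x hx
    obtain ⟨i, j, hij, he⟩ := hAinj w hw x hx
    refine mul_eq_zero_of_left (Finset.prod_eq_zero (Finset.mem_univ i)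
      (Finset.prod_eq_zero (i := j) (by simpa using hij) ?_)) _
    simp [he]
  · simp [F', (haO i).2, (hLa i).1]

lemma countable_of_locally_countable {E : Type*} [TopologicalSpace E]
    [SecondCountableTopology E] {S : Set E}
    (h : ∀ x ∈ S, ∃ V ∈ 𝓝 x, (S ∩ V).Countable) : S.Countable := by
  choose! V hV hc using h
  obtain ⟨t, ht, hts, hcov⟩ := (HereditarilyLindelofSpace.isLindelof S).elim_nhds_subcover V hV
  refine (ht.biUnion fun x hx => hc x (hts x hx)).mono fun y hy => ?_
  obtain ⟨x, hx, hyx⟩ := mem_iUnion₂.1 (hcov hy)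
  exact mem_iUnion₂.2 ⟨x, hx, hy, hyx⟩

lemma isolated_of_countable_fibre {E : Type*} [NormedAddCommGroup E] [NormedSpace ℂ E]
    [FiniteDimensional ℂ E] {h : E → E} {a : E} (hh : AnalyticAt ℂ h a)
    {V : Set E} (hV : V ∈ 𝓝 a) (hc : {x ∈ V | h x = 0}.Countable) :
    ∀ᶠ x in 𝓝[≠] a, h x ≠ 0 := by
  let _ : NormedSpace ℝ E := NormedSpace.restrictScalars ℝ ℂ E
  obtain ⟨R, hR, hRV⟩ := Metric.nhds_basis_closedBall.eventually_iff.1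
    (hh.eventually_analyticAt.and hV)
  obtain ⟨s, hs, hsc⟩ : ∃ s ∈ Ioo 0 R, s ∉ (fun x => dist x a) '' {x ∈ V | h x = 0} :=
    (hc.image _).dense_compl ℝ |>.exists_mem_open isOpen_Ioo (nonempty_Ioo.2 hR) |>.imp
      fun s hs => ⟨hs.2, hs.1⟩
  have hcl : closure (Metric.ball a s) = Metric.closedBall a s := closure_ball a hs.1.ne'
  have hsub : Metric.closedBall a s ⊆ Metric.closedBall a R :=
    Metric.closedBall_subset_closedBall hs.2.le
  have hfin := finite_fibre (F := h) (w₀ := 0) Metric.isOpen_ball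
    (Metric.isBounded_ball (x := a) (r := s))
    (by rw [hcl]; exact fun x hx => (hRV (hsub hx)).1) (by
      intro x hx hx0
      rw [frontier_ball a hs.1.ne'] at hx
      exact hsc ⟨x, ⟨(hRV (hsub (Metric.sphere_subset_closedBall hx))).2, hx0⟩, hx⟩)
  have h1 : ({x ∈ Metric.ball a s | h x = 0} \ {a})ᶜ ∈ 𝓝 a :=
    (hfin.subset sdiff_subset).isClosed.isOpen_compl.mem_nhds (by simp)
  filter_upwards [mem_nhdsWithin_of_mem_nhds h1, self_mem_nhdsWithin,
    mem_nhdsWithin_of_mem_nhds (Metric.ball_mem_nhds a hs.1)] with x hx1 hx2 hx3 hx0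
  exact hx1 ⟨⟨hx3, hx0⟩, hx2⟩

/-- One of `r + 1` equations on a space of dimension at most `r` can be eliminated without
creating an uncountable zero set. -/
lemma exists_fewer_equations {E : Type*} [NormedAddCommGroup E] [NormedSpace ℂ E]
    [FiniteDimensional ℂ E] {r : ℕ} (hr : Module.finrank ℂ E ≤ r) {V : Set E}
    {f : Fin (r + 1) → E → ℂ} (hf : ∀ i, AnalyticOnNhd ℂ (f i) V)
    (hc : {x ∈ V | ∀ i, f i x = 0}.Countable) :
    ∃ μ : Fin r → ℂ, {x ∈ V | ∀ i, f i.castSucc x - μ i * f (Fin.last r) x = 0}.Countable := by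
  have : ProperSpace E := FiniteDimensional.proper ℂ E
  have : CompleteSpace E := FiniteDimensional.complete ℂ E
  have : SecondCountableTopology E := secondCountable_of_proper
  let b := Module.finBasis ℂ E
  let P : (Fin r → ℂ) →ₗ[ℂ] E :=
    (b.equivFun.symm : (Fin (Module.finrank ℂ E) → ℂ) →ₗ[ℂ] E) ∘ₗ
      LinearMap.funLeft ℂ ℂ (Fin.castLE hr)
  have hPs : Function.Surjective P := b.equivFun.symm.surjective.comp
    (LinearMap.funLeft_surjective_of_injective _ _ _ (Fin.castLE_injective hr))
  have hPo : IsOpenMap P := P.isOpenMap_of_finiteDimensional hPs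
  have hPa : ∀ y, AnalyticAt ℂ P y := fun y => (LinearMap.toContinuousLinearMap P).analyticAt y
  let φ := f (Fin.last r)
  let k : E → Fin r → ℂ := fun x i => f i.castSucc x / φ x
  let V' := {x ∈ V | φ x ≠ 0}
  have hk : ∀ x ∈ V', AnalyticAt ℂ k x := fun x hx =>
    analyticAt_pi_iff.2 fun i => (hf _ x hx.1).div (hf _ x hx.1) hx.2
  have hkP : AnalyticOnNhd ℂ (fun y => k (P y)) (P ⁻¹' V') := fun y hy =>
    (hk _ hy).fun_comp (hPa y)
  obtain ⟨μ, -, hμ⟩ := exists_regular_value hkP isOpen_univ univ_nonempty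
  refine ⟨μ, (hc.union (s := {x ∈ V | ∀ i, f i x = 0}) (t := {x ∈ V' | k x = μ}) ?_).mono ?_⟩
  · refine countable_of_locally_countable fun x hx => ?_
    obtain ⟨y, rfl⟩ := hPs x
    obtain ⟨B, hBo, hyB, hBi⟩ := exists_nhds_injOn_of_det_ne_zero (hkP y hx.1) (hμ y hx.1 hx.2)
    refine ⟨P '' B, hPo.image_mem_nhds (hBo.mem_nhds hyB),
      (Set.Subsingleton.finite (s := _) ?_).countable⟩
    rintro _ ⟨hx1, y1, hy1, rfl⟩ _ ⟨hx2, y2, hy2, rfl⟩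
    rw [hBi hy1 hy2 (hx1.2.trans hx2.2.symm)]
  · rintro x ⟨hx, hx0⟩
    by_cases hφ : φ x = 0
    · refine Or.inl ⟨hx, fun i => ?_⟩
      induction i using Fin.lastCases with
      | last => exact hφ
      | cast i => simpa [φ, show f (Fin.last r) x = 0 from hφ] using hx0 i
    · refine Or.inr ⟨⟨hx, hφ⟩, funext fun i => ?_⟩
      simp only [k]
      rw [div_eq_iff hφ]
      exact sub_eq_zero.1 (hx0 i)

/-- A countable analytic set consists of isolated points. -/
lemma isolated_of_countable_zeros {E : Type*} [NormedAddCommGroup E] [NormedSpace ℂ E]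
    [FiniteDimensional ℂ E] {a : E} {V : Set E} (hV : IsOpen V) (ha : a ∈ V) {r : ℕ} :
    ∀ {f : Fin r → E → ℂ}, (∀ i, AnalyticOnNhd ℂ (f i) V) → (∀ i, f i a = 0) →
      {x ∈ V | ∀ i, f i x = 0}.Countable → ∀ᶠ x in 𝓝[≠] a, ∃ i, f i x ≠ 0 := by
  induction r with
  | zero =>
    intro f hf h0 hc
    have := isolated_of_countable_fibre (h := fun _ => (0 : E)) (a := a) analyticAt_const
      (hV.mem_nhds ha) (by simpa using hc)
    exact this.mono fun x hx => absurd rfl hx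
  | succ r ih =>
    intro f hf h0 hc
    rcases le_or_gt (Module.finrank ℂ E) r with hr | hr
    · obtain ⟨μ, hμ⟩ := exists_fewer_equations hr hf hc
      refine (ih (f := fun i x => f i.castSucc x - μ i * f (Fin.last r) x)
        (fun i x hx => (hf _ x hx).sub (analyticAt_const.mul (hf _ x hx)))
        (fun i => by simp [h0]) hμ).mono ?_
      rintro x ⟨i, hi⟩
      by_contra! hcon
      exact hi (by simp [hcon])
    · let b := Module.finBasis ℂ E
      let h : E → E := fun x => ∑ i : Fin (r + 1), f i x • b (Fin.castLE hr i)
      have hb : LinearIndependent ℂ fun i : Fin (r + 1) => b (Fin.castLE hr i) :=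
        b.linearIndependent.comp _ (Fin.castLE_injective hr)
      have hh : ∀ x, h x = 0 ↔ ∀ i, f i x = 0 := fun x =>
        ⟨fun hx => Fintype.linearIndependent_iff.1 hb _ hx, fun hx => by simp [h, hx]⟩
      refine (isolated_of_countable_fibre (h := h) (a := a) ?_
        (hV.mem_nhds ha) (by simpa only [hh] using hc)).mono fun x hx => ?_
      · exact Finset.analyticAt_fun_sum _ fun i _ => (hf i a ha).smul analyticAt_const
      · simpa [hh] using hx

/-- Local parametrization of a smooth analytic hypersurface by the kernel of the derivative of its
equation. -/
lemma exists_kernel_param {E : Type*} [NormedAddCommGroup E] [NormedSpace ℂ E]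
    [CompleteSpace E] {h : E → ℂ} {x₀ : E} (hh : AnalyticAt ℂ h x₀) (h0 : h x₀ = 0)
    {u : E} (hu : fderiv ℂ h x₀ u ≠ 0) :
    ∃ (Ψ : (fderiv ℂ h x₀).ker → E) (π : E → (fderiv ℂ h x₀).ker),
      AnalyticAt ℂ Ψ 0 ∧ Ψ 0 = x₀ ∧ HasFDerivAt Ψ (fderiv ℂ h x₀).ker.subtypeL 0 ∧
      (∀ᶠ y in 𝓝 0, h (Ψ y) = 0) ∧ Continuous π ∧ π x₀ = 0 ∧
      (∀ᶠ x in 𝓝 x₀, h x = 0 → Ψ (π x) = x) ∧ ∀ᶠ y in 𝓝 0, π (Ψ y) = y := by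
  obtain ⟨u, hu⟩ : ∃ u, fderiv ℂ h x₀ u = 1 :=
    ⟨(fderiv ℂ h x₀ u)⁻¹ • u, by simp [hu]⟩
  set L := fderiv ℂ h x₀ with hL
  have : CompleteSpace L.ker := L.isClosed_ker.completeSpace_coe
  let p : E →L[ℂ] L.ker := (ContinuousLinearMap.id ℂ E - L.smulRight u).codRestrict L.ker
    (by intro x; simp [hu])
  have hp : ∀ x, ((p x : L.ker) : E) = x - L x • u := fun x => by simp [p]
  let e : E ≃L[ℂ] L.ker × ℂ := ContinuousLinearEquiv.equivOfInverse (p.prod L)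
    (L.ker.subtypeL.coprod ((ContinuousLinearMap.id ℂ ℂ).smulRight u))
    (by intro x; simp [hp]) (by
      rintro ⟨y, s⟩
      have hy : L (y : E) = 0 := y.2
      refine Prod.ext (Subtype.ext ?_) ?_
      · simp [hp, hy, hu]
      · simp [hy, hu])
  let Φ : E → L.ker × ℂ := fun x => (p (x - x₀), h x)
  have hΦ : AnalyticAt ℂ Φ x₀ :=
    (AnalyticAt.fun_comp (p.analyticAt _) (analyticAt_id.sub analyticAt_const)).prod hh
  have hΦ' : HasFDerivAt Φ (e : E →L[ℂ] L.ker × ℂ) x₀ := by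
    have h1 : HasFDerivAt (fun x => p (x - x₀)) p x₀ :=
      p.hasFDerivAt.comp x₀ ((hasFDerivAt_id x₀).sub_const x₀)
    exact h1.prodMk hh.differentiableAt.hasFDerivAt
  obtain ⟨S, hS, hSx, hSr, hSl, hS'⟩ := exists_analytic_local_inverse hΦ e hΦ'.fderiv
  have hΦx : Φ x₀ = (0, 0) := by simp [Φ, h0]
  rw [hΦx] at hS hSx hSr hS'
  have hi : Tendsto (fun y : L.ker => (y, (0 : ℂ))) (𝓝 0) (𝓝 (0, 0)) :=
    Continuous.tendsto' (by fun_prop) _ _ rfl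
  refine ⟨fun y => S (y, 0), fun x => p (x - x₀),
    AnalyticAt.fun_comp (g := S) (f := fun y : L.ker => (y, (0 : ℂ))) hS
      (analyticAt_id.prod analyticAt_const), hSx, ?_, ?_,
    by fun_prop, by simp, ?_, ?_⟩
  · have h1 : HasFDerivAt (fun y : L.ker => (y, (0 : ℂ)))
        ((ContinuousLinearMap.id ℂ L.ker).prod 0) 0 :=
      (hasFDerivAt_id 0).prodMk (hasFDerivAt_const _ _)
    refine (HasFDerivAt.comp (0 : L.ker) hS' h1).congr_fderiv ?_
    ext y
    simp [e, ContinuousLinearEquiv.symm_equivOfInverse]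
  · filter_upwards [hi.eventually hSr] with y hy
    exact (Prod.mk_inj.1 hy).2
  · filter_upwards [hSl] with x hx hx0
    rw [← hx0]
    exact hx
  · filter_upwards [hi.eventually hSr] with y hy
    exact (Prod.mk_inj.1 hy).1

/-- The iterated derivative of a function in a fixed direction. -/
def dirDeriv {E : Type*} [NormedAddCommGroup E] [NormedSpace ℂ E] (e : E) (k : ℕ)
    (f : E → ℂ) : E → ℂ := (fun h : E → ℂ => fun x => fderiv ℂ h x e)^[k] f

section dirDeriv

variable {E : Type*} [NormedAddCommGroup E] [NormedSpace ℂ E] {e : E} {f : E → ℂ} {x : E}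

lemma dirDeriv_zero : dirDeriv e 0 f = f := rfl

lemma dirDeriv_succ (k : ℕ) : dirDeriv e (k + 1) f = fun x => fderiv ℂ (dirDeriv e k f) x e :=
  Function.iterate_succ_apply' _ _ _

lemma AnalyticAt.dirDeriv [CompleteSpace E] (hf : AnalyticAt ℂ f x) (k : ℕ) :
    AnalyticAt ℂ (dirDeriv e k f) x := by
  induction k with
  | zero => exact hf
  | succ k ih =>
    rw [dirDeriv_succ]
    exact ((ContinuousLinearMap.apply ℂ ℂ e).analyticAt _).fun_comp ih.fderiv

lemma hasDerivAt_line {t : ℂ} (hf : AnalyticAt ℂ f (x + t • e)) :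
    HasDerivAt (fun t : ℂ => f (x + t • e)) (fderiv ℂ f (x + t • e) e) t := by
  have h1 : HasDerivAt (fun t : ℂ => x + t • e) e t := by
    simpa using ((hasDerivAt_id t).smul_const e).const_add x
  exact hf.differentiableAt.hasFDerivAt.comp_hasDerivAt t h1

lemma analyticAt_line {t : ℂ} (hf : AnalyticAt ℂ f (x + t • e)) :
    AnalyticAt ℂ (fun t : ℂ => f (x + t • e)) t :=
  AnalyticAt.fun_comp (f := fun t : ℂ => x + t • e) hf (by fun_prop)

lemma iteratedDeriv_line [CompleteSpace E] (hf : AnalyticAt ℂ f x) (k : ℕ) :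
    ∀ᶠ t in 𝓝 (0 : ℂ), iteratedDeriv k (fun t : ℂ => f (x + t • e)) t =
      dirDeriv e k f (x + t • e) := by
  have hA : ∀ᶠ t in 𝓝 (0 : ℂ), AnalyticAt ℂ f (x + t • e) := by
    have : Tendsto (fun t : ℂ => x + t • e) (𝓝 0) (𝓝 x) :=
      Continuous.tendsto' (by fun_prop) _ _ (by simp)
    exact this.eventually hf.eventually_analyticAt
  induction k with
  | zero => simp [dirDeriv_zero]
  | succ k ih =>
    filter_upwards [ih.eventually_nhds, hA] with t ht hAt
    rw [iteratedDeriv_succ, dirDeriv_succ, Filter.EventuallyEq.deriv_eq ht]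
    exact (hasDerivAt_line (hAt.dirDeriv k)).deriv

/-- If the restriction of `f` to a line through a zero does not vanish identically, some
directional derivative of `f` vanishes there to first order exactly. -/
lemma exists_dirDeriv_simple_zero [CompleteSpace E] (hf : AnalyticAt ℂ f x) (hx : f x = 0)
    (he : ¬ ∀ᶠ t in 𝓝 (0 : ℂ), f (x + t • e) = 0) :
    ∃ k, (∀ j ≤ k, dirDeriv e j f x = 0) ∧ dirDeriv e (k + 1) f x ≠ 0 := by
  have hx0 : x + (0 : ℂ) • e = x := by simp
  have hA : AnalyticAt ℂ (fun t : ℂ => f (x + t • e)) 0 := analyticAt_line (by rwa [hx0])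
  have hex : ∃ k, dirDeriv e k f x ≠ 0 := by
    by_contra! hcon
    refine he (analyticOrderAt_eq_top.1 (ENat.eq_top_iff_forall_ge.2 fun n => ?_))
    rw [natCast_le_analyticOrderAt_iff_iteratedDeriv_eq_zero hA]
    intro i _
    rw [(iteratedDeriv_line hf i).self_of_nhds, hx0, hcon]
  classical
  have h0 : Nat.find hex ≠ 0 := by
    intro h
    have := Nat.find_spec hex
    rw [h] at this
    exact this hx
  obtain ⟨k, hk⟩ := Nat.exists_eq_succ_of_ne_zero h0
  refine ⟨k, fun j hj => ?_, ?_⟩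
  · by_contra h
    have := Nat.find_le (h := hex) (n := j) h
    omega
  · have := Nat.find_spec hex
    rwa [hk] at this

/-- A function which is not locally zero is nonzero along some line in a given dense set of
directions. -/
lemma exists_direction {D : Set E} (hD : Dense D) (hf : AnalyticAt ℂ f x)
    (h : ¬ ∀ᶠ z in 𝓝 x, f z = 0) :
    ∃ e ∈ D, ¬ ∀ᶠ t in 𝓝 (0 : ℂ), f (x + t • e) = 0 := by
  by_contra! hcon
  obtain ⟨ρ, hρ, hA⟩ := Metric.nhds_basis_ball.eventually_iff.1 hf.eventually_analyticAt
  refine h (Metric.nhds_basis_ball.eventually_iff.2 ⟨ρ, hρ, ?_⟩)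
  have hDv : ∀ v ∈ D, x + v ∈ Metric.ball x ρ → f (x + v) = 0 := by
    intro v hv hvb
    have hm : ∀ t ∈ Metric.closedBall (0 : ℂ) 1, x + t • v ∈ Metric.ball x ρ := by
      intro t ht
      rw [mem_ball_iff_norm, add_sub_cancel_left] at hvb ⊢
      rw [norm_smul]
      exact (mul_le_of_le_one_left (norm_nonneg _) (by simpa using ht)).trans_lt hvb
    have han : AnalyticOnNhd ℂ (fun t : ℂ => f (x + t • v)) (Metric.closedBall 0 1) :=
      fun t ht => analyticAt_line (hA (hm t ht))
    have := han.eqOn_zero_of_preconnected_of_eventuallyEq_zero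
      (convex_closedBall (0 : ℂ) 1).isPreconnected (Metric.mem_closedBall_self zero_le_one)
      (hcon v hv)
    simpa using this (show (1 : ℂ) ∈ Metric.closedBall 0 1 by simp)
  have hdense : Dense ((fun v => x + v) '' D) :=
    (Homeomorph.addLeft x).surjective.denseRange.dense_image (by fun_prop) hD
  have hcl : Metric.ball x ρ ⊆ closure (Metric.ball x ρ ∩ (fun v => x + v) '' D) :=
    hdense.open_subset_closure_inter Metric.isOpen_ball
  have hcont : ContinuousOn f (Metric.ball x ρ) := fun z hz =>
    (hA hz).continuousAt.continuousWithinAt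
  intro z hz
  have hz' := hcl hz
  have h1 : MapsTo f (Metric.ball x ρ ∩ (fun v => x + v) '' D) {0} := by
    rintro _ ⟨hb, v, hv, rfl⟩
    exact hDv v hv hb
  have h2 := ((hcont z hz).mono inter_subset_left).mem_closure hz' h1
  simpa using h2

end dirDeriv

lemma exists_analytic_disc_aux (d : ℕ) : ∀ {E : Type*} [NormedAddCommGroup E] [NormedSpace ℂ E]
    [FiniteDimensional ℂ E], Module.finrank ℂ E = d → ∀ {V : Set E}, IsOpen V →
    ∀ {ι : Type} [Finite ι] {f : ι → E → ℂ}, (∀ i, AnalyticOnNhd ℂ (f i) V) →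
      ¬ {x ∈ V | ∀ i, f i x = 0}.Countable →
      ∃ δ : ℂ → E, AnalyticAt ℂ δ 0 ∧ δ 0 ∈ V ∧ (∀ᶠ t in 𝓝[≠] 0, δ t ≠ δ 0) ∧
        ∀ᶠ t in 𝓝 0, ∀ i, f i (δ t) = 0 := by
  induction d using Nat.strong_induction_on with
  | _ d ih =>
  intro E _ _ _ hd V hV ι _ f hf hunc
  have : ProperSpace E := FiniteDimensional.proper ℂ E
  have : CompleteSpace E := FiniteDimensional.complete ℂ E
  have : SecondCountableTopology E := secondCountable_of_proper
  let Z := {x ∈ V | ∀ i, f i x = 0}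
  by_cases hloc : ∃ x ∈ Z, ∀ i, ∀ᶠ z in 𝓝 x, f i z = 0
  · obtain ⟨x, hx, hz⟩ := hloc
    have : Nontrivial E := by
      by_contra h
      rw [not_nontrivial_iff_subsingleton] at h
      exact hunc (Set.subsingleton_of_subsingleton.countable)
    obtain ⟨v, hv⟩ := exists_ne (0 : E)
    have ht : Tendsto (fun t : ℂ => x + t • v) (𝓝 0) (𝓝 x) :=
      Continuous.tendsto' (by fun_prop) _ _ (by simp)
    refine ⟨fun t => x + t • v, by fun_prop, by simpa using hx.1, ?_,
      ht.eventually (eventually_all.2 hz)⟩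
    filter_upwards [self_mem_nhdsWithin] with t ht0
    simpa [hv] using ht0
  · push Not at hloc
    obtain ⟨D, hDc, hDd⟩ := TopologicalSpace.exists_countable_dense E
    let P : ι × D × ℕ → Set E := fun q =>
      {x ∈ Z | dirDeriv (q.2.1 : E) q.2.2 (f q.1) x = 0 ∧
        dirDeriv (q.2.1 : E) (q.2.2 + 1) (f q.1) x ≠ 0}
    have hcov : Z ⊆ ⋃ q, P q := by
      intro x hx
      obtain ⟨i, hi⟩ := hloc x hx
      obtain ⟨e, he, hne⟩ := exists_direction hDd (hf i x hx.1) (not_eventually.2 hi)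
      obtain ⟨k, hk, hk1⟩ := exists_dirDeriv_simple_zero (hf i x hx.1) (hx.2 i) hne
      exact mem_iUnion.2 ⟨(i, ⟨e, he⟩, k), hx, hk k le_rfl, hk1⟩
    have : Countable D := hDc.to_subtype
    obtain ⟨⟨i, ⟨e, he⟩, k⟩, hq⟩ : ∃ q, ¬ (P q).Countable := by
      by_contra! h
      exact hunc ((countable_iUnion h).mono hcov)
    obtain ⟨x₀, hx₀, hcond⟩ : ∃ x ∈ P (i, ⟨e, he⟩, k), ∀ N ∈ 𝓝 x,
        ¬ (P (i, ⟨e, he⟩, k) ∩ N).Countable := by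
      by_contra! h
      exact hq (countable_of_locally_countable h)
    let h := dirDeriv e k (f i)
    have hh : AnalyticAt ℂ h x₀ := (hf i x₀ hx₀.1.1).dirDeriv k
    have hu : fderiv ℂ h x₀ e ≠ 0 := by
      have := hx₀.2.2
      rwa [dirDeriv_succ] at this
    obtain ⟨Ψ, π, hΨ, hΨ0, -, -, hπc, hπ0, hΨπ, hπΨ⟩ := exists_kernel_param hh hx₀.2.1 hu
    have hΨV : ∀ᶠ y in 𝓝 0, Ψ y ∈ V := by
      have := hΨ.continuousAt.tendsto
      rw [hΨ0] at this
      exact this (hV.mem_nhds hx₀.1.1)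
    obtain ⟨V₂, hV₂, hV₂o, h0V₂⟩ :=
      mem_nhds_iff.1 (hΨV.and (hΨ.eventually_analyticAt.and hπΨ))
    have hker : Module.finrank ℂ (fderiv ℂ h x₀).ker < d := by
      rw [← hd]
      refine Submodule.finrank_lt fun htop => hu ?_
      have : e ∈ (fderiv ℂ h x₀).ker := htop ▸ Submodule.mem_top
      exact this
    have hnear : ∀ᶠ x in 𝓝 x₀, π x ∈ V₂ := by
      have := hπc.tendsto x₀
      rw [hπ0] at this
      exact this (hV₂o.mem_nhds h0V₂)
    obtain ⟨δ, hδ, hδV, hδne, hδf⟩ := ih _ hker rfl hV₂o (f := fun j y => f j (Ψ y))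
      (fun j y hy => (hf j _ (hV₂ hy).1).fun_comp (hV₂ hy).2.1) (fun hc => by
        refine hcond _ (hnear.and hΨπ) ((hc.image Ψ).mono ?_)
        rintro x ⟨hx, hx1, hx2⟩
        have hx3 := hx2 hx.2.1
        refine ⟨π x, ⟨hx1, fun j => ?_⟩, hx3⟩
        rw [hx3]
        exact hx.1.2 j)
    refine ⟨fun t => Ψ (δ t), (hV₂ hδV).2.1.fun_comp hδ, (hV₂ hδV).1, ?_, hδf⟩
    filter_upwards [hδne, mem_nhdsWithin_of_mem_nhds
      (hδ.continuousAt.preimage_mem_nhds (hV₂o.mem_nhds hδV))] with t ht htV heq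
    refine ht ?_
    rw [← (hV₂ htV).2.2, ← (hV₂ hδV).2.2, heq]

/-- An uncountable analytic set contains a nonconstant holomorphic disc. -/
lemma exists_analytic_disc {E : Type*} [NormedAddCommGroup E] [NormedSpace ℂ E]
    [FiniteDimensional ℂ E] {V : Set E} (hV : IsOpen V) {ι : Type} [Finite ι] {f : ι → E → ℂ}
    (hf : ∀ i, AnalyticOnNhd ℂ (f i) V) (hunc : ¬ {x ∈ V | ∀ i, f i x = 0}.Countable) :
    ∃ δ : ℂ → E, AnalyticAt ℂ δ 0 ∧ δ 0 ∈ V ∧ (∀ᶠ t in 𝓝[≠] 0, δ t ≠ δ 0) ∧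
      ∀ᶠ t in 𝓝 0, ∀ i, f i (δ t) = 0 :=
  exists_analytic_disc_aux _ rfl hV hf hunc

/-- Holomorphic dependence of circle integrals on a parameter. -/
lemma differentiableOn_circleIntegral {g : ℂ × ℂ → ℂ} {D : Set ℂ} (hD : IsOpen D) {r : ℝ}
    (hr : 0 ≤ r) (hg : AnalyticOnNhd ℂ g (D ×ˢ Metric.sphere 0 r)) :
    DifferentiableOn ℂ (fun t => ∮ s in C(0, r), g (t, s)) D := by
  intro t₀ ht₀
  obtain ⟨ρ, hρ, hρD⟩ := Metric.nhds_basis_closedBall.mem_iff.1 (hD.mem_nhds ht₀)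
  have hmem : ∀ t ∈ Metric.closedBall t₀ ρ, ∀ θ : ℝ,
      (t, circleMap 0 r θ) ∈ D ×ˢ Metric.sphere (0 : ℂ) r := fun t ht θ =>
    ⟨hρD ht, circleMap_mem_sphere 0 hr θ⟩
  let g' : ℂ × ℂ → ℂ := fun q => fderiv ℂ g q (1, 0)
  have hg' : ContinuousOn g' (D ×ˢ Metric.sphere 0 r) := fun q hq =>
    (((ContinuousLinearMap.apply ℂ ℂ ((1, 0) : ℂ × ℂ)).analyticAt _).fun_comp
      (hg q hq).fderiv).continuousAt.continuousWithinAt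
  obtain ⟨B, hB⟩ := ((isCompact_closedBall t₀ ρ).prod
    (isCompact_sphere (0 : ℂ) r)).exists_bound_of_continuousOn
    (hg'.mono (prod_mono hρD subset_rfl))
  have hcont : ∀ {k : ℂ × ℂ → ℂ}, ContinuousOn k (D ×ˢ Metric.sphere 0 r) →
      ∀ t ∈ Metric.closedBall t₀ ρ,
        Continuous fun θ : ℝ => deriv (circleMap 0 r) θ • k (t, circleMap 0 r θ) := by
    intro k hk t ht
    have h1 : Continuous fun θ : ℝ => deriv (circleMap 0 r) θ := by
      simp only [deriv_circleMap]
      fun_prop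
    exact h1.smul (hk.comp_continuous (by fun_prop) (hmem t ht))
  have h0 : t₀ ∈ Metric.closedBall t₀ ρ := Metric.mem_closedBall_self hρ.le
  refine (intervalIntegral.hasDerivAt_integral_of_dominated_loc_of_deriv_le
    (F' := fun t θ => deriv (circleMap 0 r) θ • g' (t, circleMap 0 r θ))
    (bound := fun θ => |r| * B) (Metric.closedBall_mem_nhds t₀ hρ) ?_ ?_ ?_ ?_ ?_
    ?_).2.differentiableAt.differentiableWithinAt
  · filter_upwards [Metric.closedBall_mem_nhds t₀ hρ] with t ht
    exact (hcont hg.continuousOn t ht).aestronglyMeasurable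
  · exact (hcont hg.continuousOn t₀ h0).intervalIntegrable _ _
  · exact (hcont hg' t₀ h0).aestronglyMeasurable
  · refine MeasureTheory.ae_of_all _ fun θ _ t ht => ?_
    rw [norm_smul]
    refine mul_le_mul (by simp) (hB _ ⟨ht, circleMap_mem_sphere 0 hr θ⟩) (norm_nonneg _)
      (abs_nonneg _)
  · exact intervalIntegrable_const
  · refine MeasureTheory.ae_of_all _ fun θ _ t ht => ?_
    have h1 := (hg _ (hmem t ht θ)).differentiableAt.hasFDerivAt
    have h2 : HasDerivAt (fun t : ℂ => (t, circleMap 0 r θ)) (1, 0) t :=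
      (hasDerivAt_id t).prodMk (hasDerivAt_const _ _)
    exact (h1.comp_hasDerivAt t h2).const_smul (deriv (circleMap 0 r) θ)

/-- The argument principle on a disc, with weights. -/
lemma circleIntegral_logDeriv (Z : Finset ℂ) {r : ℝ} (hr : 0 < r) : ∀ {F : ℂ → ℂ},
    AnalyticOnNhd ℂ F (Metric.closedBall 0 r) → (∀ a ∈ Z, a ∈ Metric.ball (0 : ℂ) r) →
    (∀ s ∈ Metric.closedBall (0 : ℂ) r, s ∉ Z → F s ≠ 0) → ∀ {P : ℂ → ℂ}, Differentiable ℂ P →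
    ∮ s in C(0, r), P s * (deriv F s / F s) =
      2 * Real.pi * Complex.I * ∑ a ∈ Z, (analyticOrderNatAt F a : ℂ) * P a := by
  classical
  induction Z using Finset.induction_on with
  | empty =>
    intro F hF _ hne P hP
    simp only [Finset.sum_empty, mul_zero]
    refine Complex.circleIntegral_eq_zero_of_differentiable_on_off_countable hr.le
      countable_empty ?_ ?_
    · intro s hs
      have h1 := (hF s hs).deriv.continuousAt.div (hF s hs).continuousAt
        (hne s hs (Finset.notMem_empty _))
      exact (hP.continuous.continuousAt.mul h1).continuousWithinAt
    · intro s hs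
      have hs' := Metric.ball_subset_closedBall hs.1
      exact (hP s).mul ((hF s hs').deriv.differentiableAt.div (hF s hs').differentiableAt
        (hne s hs' (Finset.notMem_empty _)))
  | insert a Z haZ ih =>
    intro F hF hZ hne P hP
    have haB := hZ a (Finset.mem_insert_self _ _)
    have haC := Metric.ball_subset_closedBall haB
    have hnt : analyticOrderAt F a ≠ ⊤ := by
      intro htop
      rw [analyticOrderAt_eq_top] at htop
      have h1 : ∀ᶠ s in 𝓝[≠] a, s ∉ Z :=
        mem_nhdsWithin_of_mem_nhds (Z.finite_toSet.isClosed.isOpen_compl.mem_nhds haZ)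
      have h2 : ∀ᶠ s in 𝓝[≠] a, F s = 0 := mem_nhdsWithin_of_mem_nhds htop
      have h3 : ∀ᶠ s in 𝓝[≠] a, s ∈ Metric.ball (0 : ℂ) r :=
        mem_nhdsWithin_of_mem_nhds (Metric.isOpen_ball.mem_nhds haB)
      have h4 : ∀ᶠ s in 𝓝[≠] a, s ≠ a := self_mem_nhdsWithin
      obtain ⟨s, hs1, hs2, hs3, hs4⟩ := (h2.and (h1.and (h4.and h3))).exists
      refine hne s (Metric.ball_subset_closedBall hs4) ?_ hs1
      rw [Finset.mem_insert]
      exact fun h => h.elim hs3 hs2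
    set n := analyticOrderNatAt F a with hn
    have hn' : analyticOrderAt F a = n := (Nat.cast_analyticOrderNatAt hnt).symm
    obtain ⟨u, hu, hua, hFu⟩ := ((hF a haC).analyticOrderAt_eq_natCast).1 hn'
    let G : ℂ → ℂ := fun s => if s = a then u a else F s / (s - a) ^ n
    have hGa : G =ᶠ[𝓝 a] u := by
      filter_upwards [hFu] with s hs
      by_cases h : s = a
      · simp [G, h]
      · simp only [G, h, if_false, hs, smul_eq_mul]
        rw [mul_div_cancel_left₀]
        exact pow_ne_zero _ (sub_ne_zero.2 h)
    have hGne : ∀ b, b ≠ a → G =ᶠ[𝓝 b] fun s => F s / (s - a) ^ n := fun b hb => by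
      filter_upwards [isOpen_ne.mem_nhds hb] with s hs
      simp [G, show s ≠ a from hs]
    have hGA : AnalyticOnNhd ℂ G (Metric.closedBall 0 r) := by
      intro s hs
      by_cases h : s = a
      · rw [h]
        exact hu.congr hGa.symm
      · refine AnalyticAt.congr ?_ (hGne s h).symm
        exact (hF s hs).div (by fun_prop) (pow_ne_zero _ (sub_ne_zero.2 h))
    have hFG : ∀ s ∈ Metric.closedBall (0 : ℂ) r, F =ᶠ[𝓝 s] fun s => (s - a) ^ n * G s := by
      intro s hs
      by_cases h : s = a
      · rw [h]
        filter_upwards [hFu, hGa] with z hz hz'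
        rw [hz, hz', smul_eq_mul]
      · filter_upwards [hGne s h, isOpen_ne.mem_nhds h] with z hz hz'
        rw [hz, mul_div_cancel₀]
        exact pow_ne_zero _ (sub_ne_zero.2 hz')
    have hGz : ∀ s ∈ Metric.closedBall (0 : ℂ) r, s ∉ Z → G s ≠ 0 := by
      intro s hs hsZ
      by_cases h : s = a
      · rw [h, hGa.self_of_nhds]
        exact hua
      · intro h0
        refine hne s hs (by simp [h, hsZ]) ?_
        rw [(hFG s hs).self_of_nhds]
        change (s - a) ^ n * G s = 0
        rw [h0, mul_zero]
    have hord : ∀ b ∈ Z, analyticOrderNatAt F b = analyticOrderNatAt G b := by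
      intro b hb
      have hba : b ≠ a := fun h => haZ (h ▸ hb)
      have hbC := Metric.ball_subset_closedBall (hZ b (Finset.mem_insert_of_mem hb))
      have h1 : AnalyticAt ℂ (fun s : ℂ => (s - a) ^ n) b := by fun_prop
      have h2 : analyticOrderAt (fun s : ℂ => (s - a) ^ n) b = 0 :=
        h1.analyticOrderAt_eq_zero.2 (pow_ne_zero _ (sub_ne_zero.2 hba))
      have h3 : analyticOrderAt F b = analyticOrderAt G b := by
        rw [analyticOrderAt_congr (hFG b hbC)]
        have := analyticOrderAt_mul h1 (hGA b hbC)
        rw [h2, zero_add] at this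
        exact this
      simp only [analyticOrderNatAt, h3]
    have hih := ih hGA (fun b hb => hZ b (Finset.mem_insert_of_mem hb)) hGz hP
    have hsph : ∀ s ∈ Metric.sphere (0 : ℂ) r, s ≠ a ∧ s ∉ Z := by
      intro s hs
      refine ⟨?_, fun h => ?_⟩
      · rintro rfl
        exact absurd (Metric.mem_sphere.1 hs) (Metric.mem_ball.1 haB).ne
      · exact absurd (Metric.mem_sphere.1 hs)
          (Metric.mem_ball.1 (hZ s (Finset.mem_insert_of_mem h))).ne
    have hlog : ∀ s ∈ Metric.sphere (0 : ℂ) r, P s * (deriv F s / F s) =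
        n * ((s - a)⁻¹ * P s) + P s * (deriv G s / G s) := by
      intro s hs
      have hsC := Metric.sphere_subset_closedBall hs
      have hsa := sub_ne_zero.2 (hsph s hs).1
      have hGs := hGz s hsC (hsph s hs).2
      have h1 : HasDerivAt (fun s : ℂ => (s - a) ^ n) (n * (s - a) ^ (n - 1) * 1) s :=
        ((hasDerivAt_id s).sub_const a).pow n
      have h2 := h1.mul (hGA s hsC).differentiableAt.hasDerivAt
      have h3 : deriv F s = n * (s - a) ^ (n - 1) * 1 * G s + (s - a) ^ n * deriv G s := by
        rw [Filter.EventuallyEq.deriv_eq (hFG s hsC)]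
        exact h2.deriv
      rw [h3, (hFG s hsC).self_of_nhds]
      rcases n with _ | k
      · simp
      · simp only [Nat.add_sub_cancel, pow_succ]
        have := pow_ne_zero k hsa
        field_simp
    rw [circleIntegral.integral_congr hr.le hlog]
    have hcP : Continuous P := hP.continuous
    rw [circleIntegral.integral_add, circleIntegral.integral_const_mul, hih,
      Finset.sum_insert haZ]
    · have h1 := hP.differentiableOn.circleIntegral_sub_inv_smul (c := 0) (R := r) (w := a) haB
      simp only [smul_eq_mul] at h1
      have hsum : ∑ b ∈ Z, (analyticOrderNatAt F b : ℂ) * P b =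
          ∑ b ∈ Z, (analyticOrderNatAt G b : ℂ) * P b :=
        Finset.sum_congr rfl fun b hb => by rw [hord b hb]
      rw [h1, hsum]
      ring
    · refine ContinuousOn.circleIntegrable hr.le ?_
      refine continuousOn_const.mul (ContinuousOn.mul ?_ hcP.continuousOn)
      exact ContinuousOn.inv₀ (by fun_prop) fun s hs => sub_ne_zero.2 (hsph s hs).1
    · refine ContinuousOn.circleIntegrable hr.le ?_
      refine hcP.continuousOn.mul ?_
      intro s hs
      have hsC := Metric.sphere_subset_closedBall hs
      exact ((hGA s hsC).deriv.continuousAt.div (hGA s hsC).continuousAt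
        (hGz s hsC (hsph s hs).2)).continuousWithinAt

/-- The `e`-lines through the points of the ball of radius `δ` at `q` meet the zero set of `ψ`
nicely within parameter radius `r`. -/
structure IsWeierstrassBox {E : Type*} [NormedAddCommGroup E] [NormedSpace ℂ E] (ψ : E → ℂ)
    (e q : E) (r δ : ℝ) : Prop where
  r_pos : 0 < r
  δ_pos : 0 < δ
  analyticAt : ∀ x ∈ Metric.ball q δ, ∀ s ∈ Metric.closedBall (0 : ℂ) r, AnalyticAt ℂ ψ (x + s • e)
  ne_zero : ∀ x ∈ Metric.ball q δ, ∀ s ∈ Metric.sphere (0 : ℂ) r, ψ (x + s • e) ≠ 0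

section WeierstrassBox

variable {E : Type*} [NormedAddCommGroup E] [NormedSpace ℂ E] {ψ : E → ℂ} {e q : E}

lemma exists_isWeierstrassBox (hψ : AnalyticAt ℂ ψ q)
    (he : ¬ ∀ᶠ t in 𝓝 (0 : ℂ), ψ (q + t • e) = 0) {V : Set E} (hV : V ∈ 𝓝 q) :
    ∃ r δ, IsWeierstrassBox ψ e q r δ ∧
      ∀ x ∈ Metric.ball q δ, ∀ s ∈ Metric.closedBall (0 : ℂ) r, x + s • e ∈ V := by
  have hq0 : q + (0 : ℂ) • e = q := by simp
  have hnz : ∀ᶠ t in 𝓝[≠] (0 : ℂ), ψ (q + t • e) ≠ 0 :=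
    (analyticAt_line (by rwa [hq0])).eventually_eq_zero_or_eventually_ne_zero.resolve_left he
  rw [eventually_nhdsWithin_iff] at hnz
  have htend : Tendsto (fun z : E × ℂ => z.1 + z.2 • e) (𝓝 (q, 0)) (𝓝 q) :=
    Continuous.tendsto' (by fun_prop) _ _ (by simp)
  have h1 : ∀ᶠ z : E × ℂ in 𝓝 (q, 0), AnalyticAt ℂ ψ (z.1 + z.2 • e) ∧ z.1 + z.2 • e ∈ V :=
    htend.eventually (hψ.eventually_analyticAt.and hV)
  rw [nhds_prod_eq, (Metric.nhds_basis_ball.prod Metric.nhds_basis_closedBall).eventually_iff] at h1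
  obtain ⟨⟨δ₁, r₁⟩, ⟨hδ₁, hr₁⟩, h1⟩ := h1
  obtain ⟨r₂, hr₂, h2⟩ := Metric.nhds_basis_closedBall.eventually_iff.1 hnz
  set r := min r₁ r₂ with hr
  have hrpos : 0 < r := lt_min hr₁ hr₂
  have hsub : ∀ s ∈ Metric.sphere (0 : ℂ) r, ∀ᶠ z : E × ℂ in 𝓝 (q, s), ψ (z.1 + z.2 • e) ≠ 0 := by
    intro s hs
    have hs1 : s ∈ Metric.closedBall (0 : ℂ) r := Metric.sphere_subset_closedBall hs
    have hne : ψ (q + s • e) ≠ 0 := by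
      refine h2 (Metric.closedBall_subset_closedBall (min_le_right _ _) hs1) ?_
      rintro rfl
      simp at hs
      exact hrpos.ne hs
    have hA : AnalyticAt ℂ ψ (q + s • e) := (h1 (x := (q, s)) ⟨Metric.mem_ball_self hδ₁,
      Metric.closedBall_subset_closedBall (min_le_left _ _) hs1⟩).1
    have hc : ContinuousAt (fun z : E × ℂ => ψ (z.1 + z.2 • e)) (q, s) :=
      ContinuousAt.comp (f := fun z : E × ℂ => z.1 + z.2 • e) (g := ψ) hA.continuousAt (by fun_prop)
    exact hc.eventually_ne hne
  obtain ⟨δ₂, hδ₂, h3⟩ := Metric.nhds_basis_ball.eventually_iff.1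
    ((isCompact_sphere (0 : ℂ) r).eventually_forall_of_forall_eventually (P := fun x s =>
      ψ (x + s • e) ≠ 0) hsub)
  refine ⟨r, min δ₁ δ₂, ⟨hrpos, lt_min hδ₁ hδ₂, fun x hx s hs => ?_, fun x hx s hs => ?_⟩,
    fun x hx s hs => ?_⟩
  · exact (h1 (x := (x, s)) ⟨Metric.ball_subset_ball (min_le_left _ _) hx,
      Metric.closedBall_subset_closedBall (min_le_left _ _) hs⟩).1
  · exact h3 (Metric.ball_subset_ball (min_le_right _ _) hx) s hs
  · exact (h1 (x := (x, s)) ⟨Metric.ball_subset_ball (min_le_left _ _) hx,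
      Metric.closedBall_subset_closedBall (min_le_left _ _) hs⟩).2

namespace IsWeierstrassBox

variable {r δ : ℝ} (hb : IsWeierstrassBox ψ e q r δ) {x : E} (hx : x ∈ Metric.ball q δ)
include hb

lemma mem_ball_self : q ∈ Metric.ball q δ := Metric.mem_ball_self hb.δ_pos

include hx

lemma analyticOnNhd : AnalyticOnNhd ℂ (fun s : ℂ => ψ (x + s • e)) (Metric.closedBall 0 r) :=
  fun s hs => analyticAt_line (hb.analyticAt x hx s hs)

lemma not_frequently_zero {s : ℂ} (hs : s ∈ Metric.closedBall (0 : ℂ) r) :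
    ¬ ∃ᶠ t in 𝓝[≠] s, ψ (x + t • e) = 0 := by
  intro h
  have h1 := (hb.analyticOnNhd hx).eqOn_zero_of_preconnected_of_frequently_eq_zero
    (convex_closedBall (0 : ℂ) r).isPreconnected hs h
  have hr : (r : ℂ) ∈ Metric.sphere (0 : ℂ) r := by simp [abs_of_pos hb.r_pos]
  exact hb.ne_zero x hx r hr (h1 (Metric.sphere_subset_closedBall hr))

lemma finite_zeros : {s ∈ Metric.closedBall (0 : ℂ) r | ψ (x + s • e) = 0}.Finite := by
  by_contra hinf
  obtain ⟨s, hs, hacc⟩ := Set.Infinite.exists_accPt_of_subset_isCompact hinf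
    (isCompact_closedBall (0 : ℂ) r) (fun s hs => hs.1)
  rw [accPt_iff_frequently_nhdsNE] at hacc
  exact hb.not_frequently_zero hx hs (hacc.mono fun t ht => ht.2)

lemma analyticOrderAt_ne_top {s : ℂ} (hs : s ∈ Metric.closedBall (0 : ℂ) r) :
    analyticOrderAt (fun s : ℂ => ψ (x + s • e)) s ≠ ⊤ := by
  intro h
  rw [analyticOrderAt_eq_top] at h
  refine hb.not_frequently_zero hx hs (Eventually.frequently ?_)
  exact h.filter_mono nhdsWithin_le_nhds

lemma analyticOrderNatAt_pos {s : ℂ} (hs : s ∈ Metric.closedBall (0 : ℂ) r)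
    (h0 : ψ (x + s • e) = 0) : analyticOrderNatAt (fun s : ℂ => ψ (x + s • e)) s ≠ 0 := by
  intro h
  have h1 := Nat.cast_analyticOrderNatAt (hb.analyticOrderAt_ne_top hx hs)
  rw [h, Nat.cast_zero] at h1
  exact (hb.analyticOnNhd hx s hs).analyticOrderAt_eq_zero.1 h1.symm h0

/-- The zeros of `ψ` on the `e`-line through `x`. -/
def zeros : Finset ℂ := (hb.finite_zeros hx).toFinset

lemma mem_zeros {s : ℂ} :
    s ∈ hb.zeros hx ↔ s ∈ Metric.closedBall (0 : ℂ) r ∧ ψ (x + s • e) = 0 := by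
  simp [zeros]

/-- The order of vanishing of `ψ` at a point of the `e`-line through `x`. -/
def order (_ : IsWeierstrassBox ψ e q r δ) (_ : x ∈ Metric.ball q δ) (s : ℂ) : ℕ :=
  analyticOrderNatAt (fun s : ℂ => ψ (x + s • e)) s

lemma integral_eq {P : ℂ → ℂ} (hP : Differentiable ℂ P) :
    ∮ s in C(0, r), P s * (fderiv ℂ ψ (x + s • e) e / ψ (x + s • e)) =
      2 * Real.pi * Complex.I * ∑ a ∈ hb.zeros hx, (hb.order hx a : ℂ) * P a := by
  rw [show ∑ a ∈ hb.zeros hx, (hb.order hx a : ℂ) * P a = ∑ a ∈ hb.zeros hx,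
    (analyticOrderNatAt (fun s : ℂ => ψ (x + s • e)) a : ℂ) * P a from rfl,
    ← circleIntegral_logDeriv _ hb.r_pos (hb.analyticOnNhd hx) ?_ ?_ hP]
  · refine circleIntegral.integral_congr hb.r_pos.le fun s hs => ?_
    rw [(hasDerivAt_line (hb.analyticAt x hx s (Metric.sphere_subset_closedBall hs))).deriv]
  · intro a ha
    rw [mem_zeros] at ha
    refine (Metric.mem_closedBall.1 ha.1).lt_of_ne fun h => ?_
    exact hb.ne_zero x hx a h ha.2
  · intro s hs hsZ h0
    exact hsZ ((hb.mem_zeros hx).2 ⟨hs, h0⟩)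

omit hx

omit hb in
lemma convex_line (x v : E) : Convex ℝ {t : ℂ | x + t • v ∈ Metric.ball q δ} := by
  intro t ht s hs a b ha hb hab
  simp only [mem_ofPred_eq, mem_ball_iff_norm] at ht hs ⊢
  have h1 : x + (a • t + b • s) • v - q = (a : ℂ) • (x + t • v - q) + (b : ℂ) • (x + s • v - q) := by
    have : (a : ℂ) + b = 1 := by exact_mod_cast hab
    have hb' : (b : ℂ) = 1 - a := by linear_combination this
    simp only [Complex.real_smul]
    rw [hb']
    module
  rw [h1]
  have h2 := norm_add_le ((a : ℂ) • (x + t • v - q)) ((b : ℂ) • (x + s • v - q))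
  rw [norm_smul, norm_smul, Complex.norm_real, Complex.norm_real, Real.norm_of_nonneg ha,
    Real.norm_of_nonneg hb] at h2
  refine h2.trans_lt ?_
  rcases ha.eq_or_lt with rfl | ha'
  · have : b = 1 := by linarith
    subst this
    linarith
  · have h3 : a * δ + b * δ = δ := by rw [← add_mul, hab, one_mul]
    linarith [mul_lt_mul_of_pos_left ht ha', mul_le_mul_of_nonneg_left hs.le hb]

omit hb in
lemma isOpen_line (x v : E) : IsOpen {t : ℂ | x + t • v ∈ Metric.ball q δ} :=
  Metric.isOpen_ball.preimage (by fun_prop : Continuous fun t : ℂ => x + t • v)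

/-- The weighted counts of zeros depend holomorphically on the line. -/
lemma differentiableOn_integral [CompleteSpace E] {P : ℂ → ℂ} (hP : Differentiable ℂ P) (x v : E) :
    DifferentiableOn ℂ (fun t => ∮ s in C(0, r), P s *
      (fderiv ℂ ψ (x + t • v + s • e) e / ψ (x + t • v + s • e)))
      {t : ℂ | x + t • v ∈ Metric.ball q δ} := by
  refine differentiableOn_circleIntegral (g := fun z : ℂ × ℂ => P z.2 *
      (fderiv ℂ ψ (x + z.1 • v + z.2 • e) e / ψ (x + z.1 • v + z.2 • e)))
      (isOpen_line x v) hb.r_pos.le ?_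
  rintro ⟨t, s⟩ ⟨ht, hs⟩
  have hA : AnalyticAt ℂ ψ (x + t • v + s • e) :=
    hb.analyticAt _ ht s (Metric.sphere_subset_closedBall hs)
  have hl : AnalyticAt ℂ (fun z : ℂ × ℂ => x + z.1 • v + z.2 • e) (t, s) :=
    (analyticAt_const.add (analyticAt_fst.smul analyticAt_const)).add
      (analyticAt_snd.smul analyticAt_const)
  have h1 : AnalyticAt ℂ (fun z : ℂ × ℂ => ψ (x + z.1 • v + z.2 • e)) (t, s) :=
    AnalyticAt.fun_comp (f := fun z : ℂ × ℂ => x + z.1 • v + z.2 • e) (g := ψ) hA hl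
  have h2 : AnalyticAt ℂ (fun z : ℂ × ℂ => fderiv ℂ ψ (x + z.1 • v + z.2 • e) e) (t, s) :=
    AnalyticAt.fun_comp (f := fun z : ℂ × ℂ => x + z.1 • v + z.2 • e)
      (g := fun y => fderiv ℂ ψ y e)
      (((ContinuousLinearMap.apply ℂ ℂ e).analyticAt _).fun_comp hA.fderiv) hl
  have h3 : AnalyticAt ℂ (fun z : ℂ × ℂ => P z.2) (t, s) :=
    AnalyticAt.fun_comp (f := fun z : ℂ × ℂ => z.2) (g := P) (hP.analyticAt s) analyticAt_snd
  exact h3.mul (h2.div h1 (hb.ne_zero _ ht s hs))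

/-- The number of zeros, counted with multiplicity, is the same on all lines. -/
lemma exists_sum_order_eq [CompleteSpace E] : ∃ m : ℕ, ∀ (x : E) (hx : x ∈ Metric.ball q δ),
    ∑ a ∈ hb.zeros hx, hb.order hx a = m := by
  refine ⟨∑ a ∈ hb.zeros hb.mem_ball_self, hb.order hb.mem_ball_self a, fun x hx => ?_⟩
  set v := x - q
  have hv0 : (0 : ℂ) ∈ {t : ℂ | q + t • v ∈ Metric.ball q δ} := by
    change q + (0 : ℂ) • v ∈ Metric.ball q δ
    simpa using hb.mem_ball_self
  have hv1 : (1 : ℂ) ∈ {t : ℂ | q + t • v ∈ Metric.ball q δ} := by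
    change q + (1 : ℂ) • v ∈ Metric.ball q δ
    simpa [v] using hx
  have hD := hb.differentiableOn_integral (P := fun _ => 1) (by fun_prop) q v
  have hpi : (2 * Real.pi * Complex.I : ℂ) ≠ 0 := by
    simp [Real.pi_ne_zero]
  have hval : ∀ t : ℂ, ∀ ht : q + t • v ∈ Metric.ball q δ, (2 * Real.pi * Complex.I : ℂ)⁻¹ *
      (∮ s in C(0, r), (1 : ℂ) * (fderiv ℂ ψ (q + t • v + s • e) e / ψ (q + t • v + s • e))) =
        ((∑ a ∈ hb.zeros ht, hb.order ht a : ℕ) : ℂ) := by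
    intro t ht
    rw [hb.integral_eq ht (P := fun _ => 1) (by fun_prop)]
    push_cast
    field_simp
  have hcont : ContinuousOn (fun t : ℂ => ((2 * Real.pi * Complex.I : ℂ)⁻¹ *
      (∮ s in C(0, r), (1 : ℂ) * (fderiv ℂ ψ (q + t • v + s • e) e / ψ (q + t • v + s • e)))).re)
      {t : ℂ | q + t • v ∈ Metric.ball q δ} :=
    Complex.continuous_re.comp_continuousOn (continuousOn_const.mul hD.continuousOn)
  have hdisc : IsDiscrete (range (Nat.cast : ℕ → ℝ)) :=
    ⟨Nat.isClosedEmbedding_coe_real.isEmbedding.toHomeomorph.symm.isEmbedding.discreteTopology⟩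
  have hc := (convex_line q v).isPreconnected.constant_of_mapsTo hdisc hcont (fun t ht => by
    beta_reduce
    rw [hval t ht, Complex.natCast_re]
    exact mem_range_self _) hv0 hv1
  beta_reduce at hc
  rw [hval 0 hv0, hval 1 hv1, Complex.natCast_re, Complex.natCast_re, Nat.cast_inj] at hc
  have e0 : q + (0 : ℂ) • v = q := by simp
  have e1 : q + (1 : ℂ) • v = x := by simp [v]
  have hcongr : ∀ {y z : E} (h : y = z) (hy : y ∈ Metric.ball q δ) (hz : z ∈ Metric.ball q δ),
      ∑ a ∈ hb.zeros hy, hb.order hy a = ∑ a ∈ hb.zeros hz, hb.order hz a := by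
    rintro y _ rfl hy hz
    rfl
  rw [hcongr e0 hv0 hb.mem_ball_self, hcongr e1 hv1 hx] at hc
  exact hc.symm

end IsWeierstrassBox

end WeierstrassBox

/-- A weighted family of complex numbers all of whose moments are those of a single point is
concentrated at that point. -/
lemma eq_of_moments (Z : Finset ℂ) (n : ℂ → ℕ) (m : ℕ) (a : ℂ) (hn : ∀ s ∈ Z, n s ≠ 0)
    (h : ∀ k : ℕ, ∑ s ∈ Z, (n s : ℂ) * s ^ k = m * a ^ k) : ∀ s ∈ Z, s = a := by
  have hP : ∀ P : Polynomial ℂ, ∑ s ∈ Z, (n s : ℂ) * P.eval s = m * P.eval a := by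
    intro P
    induction P using Polynomial.induction_on' with
    | add P Q hP hQ => simp only [Polynomial.eval_add, mul_add, Finset.sum_add_distrib, hP, hQ]
    | monomial k c =>
      simp only [Polynomial.eval_monomial]
      linear_combination (exp := 1) c * h k + (by
        rw [Finset.mul_sum]
        exact Finset.sum_congr rfl fun s _ => by ring :
        ∑ s ∈ Z, (n s : ℂ) * (c * s ^ k) = c * ∑ s ∈ Z, (n s : ℂ) * s ^ k)
  classical
  intro s hs
  by_contra hsa
  have h1 := hP ((Polynomial.X - Polynomial.C a) * ∏ b ∈ Z.erase s, (Polynomial.X - Polynomial.C b))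
  simp only [Polynomial.eval_mul, Polynomial.eval_sub, Polynomial.eval_X, Polynomial.eval_C,
    Polynomial.eval_prod, sub_self, zero_mul, mul_zero] at h1
  rw [Finset.sum_eq_single_of_mem s hs] at h1
  · have h2 : ∏ b ∈ Z.erase s, (s - b) ≠ 0 :=
      Finset.prod_ne_zero_iff.2 fun b hb => sub_ne_zero.2 (Finset.ne_of_mem_erase hb).symm
    exact mul_ne_zero (Nat.cast_ne_zero.2 (hn s hs)) (mul_ne_zero (sub_ne_zero.2 hsa) h2) h1
  · intro b hb hbs
    rw [Finset.prod_eq_zero (Finset.mem_erase.2 ⟨hbs, hb⟩) (sub_self b), mul_zero, mul_zero]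

section

variable {E : Type*} [NormedAddCommGroup E] [NormedSpace ℂ E] {ψ : E → ℂ} {e q : E}

namespace IsWeierstrassBox

variable {r δ : ℝ} (hb : IsWeierstrassBox ψ e q r δ) {x : E} (hx : x ∈ Metric.ball q δ)
include hb hx

lemma order_ne_zero {s : ℂ} (hs : s ∈ hb.zeros hx) : hb.order hx s ≠ 0 := by
  rw [mem_zeros] at hs
  exact hb.analyticOrderNatAt_pos hx hs.1 hs.2

lemma exists_zero [CompleteSpace E] (hq : ψ q = 0) :
    ∃ s ∈ Metric.closedBall (0 : ℂ) r, ψ (x + s • e) = 0 := by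
  obtain ⟨m, hm⟩ := hb.exists_sum_order_eq
  have h0 : (0 : ℂ) ∈ hb.zeros hb.mem_ball_self := by
    rw [mem_zeros]
    exact ⟨Metric.mem_closedBall_self hb.r_pos.le, by simpa using hq⟩
  have hpos : m ≠ 0 := by
    rw [← hm q hb.mem_ball_self]
    intro h
    exact hb.order_ne_zero _ h0 (Finset.sum_eq_zero_iff.1 h _ h0)
  by_contra! hcon
  refine hpos ?_
  rw [← hm x hx]
  refine Finset.sum_eq_zero fun s hs => ?_
  rw [mem_zeros] at hs
  exact absurd hs.2 (hcon s hs.1)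

/-- If the lines through the points of an open set meet the zero set once, so do all lines. -/
lemma subsingleton_zeros [CompleteSpace E] (hq : ψ q = 0) {A : Set E} (hA : IsOpen A)
    (hAne : A.Nonempty) (hAB : A ⊆ Metric.ball q δ)
    (huniq : ∀ x ∈ A, {s ∈ Metric.closedBall (0 : ℂ) r | ψ (x + s • e) = 0}.Subsingleton) :
    {s ∈ Metric.closedBall (0 : ℂ) r | ψ (x + s • e) = 0}.Subsingleton := by
  obtain ⟨m, hm⟩ := hb.exists_sum_order_eq
  obtain ⟨y, hy⟩ := hAne
  set v := x - y
  have hpi : (2 * Real.pi * Complex.I : ℂ) ≠ 0 := by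
    simp [Real.pi_ne_zero]
  let p : ℕ → ℂ → ℂ := fun k t => (2 * Real.pi * Complex.I : ℂ)⁻¹ * ∮ s in C(0, r), s ^ k *
      (fderiv ℂ ψ (y + t • v + s • e) e / ψ (y + t • v + s • e))
  set D : Set ℂ := {t : ℂ | y + t • v ∈ Metric.ball q δ} with hDdef
  have hDo : IsOpen D := isOpen_line y v
  have hpd : ∀ k, DifferentiableOn ℂ (p k) D := fun k =>
    (hb.differentiableOn_integral (P := fun s => s ^ k) (by fun_prop) y v).const_mul _
  have hpv : ∀ k t, ∀ ht : y + t • v ∈ Metric.ball q δ,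
      p k t = ∑ s ∈ hb.zeros ht, (hb.order ht s : ℂ) * s ^ k := by
    intro k t ht
    simp only [p]
    rw [hb.integral_eq ht (P := fun s => s ^ k) (by fun_prop)]
    field_simp
  have hv0 : (0 : ℂ) ∈ D := by
    change y + (0 : ℂ) • v ∈ Metric.ball q δ
    simpa using hAB hy
  have e1 : y + (1 : ℂ) • v = x := by simp [v]
  have hv1 : (1 : ℂ) ∈ D := by
    change y + (1 : ℂ) • v ∈ Metric.ball q δ
    rwa [e1]
  have hid : ∀ k : ℕ, (fun t => p (k + 1) t * m ^ k - p 1 t ^ (k + 1)) =ᶠ[𝓝 0] 0 := by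
    intro k
    have : ∀ᶠ t in 𝓝 (0 : ℂ), y + t • v ∈ A :=
      (Continuous.tendsto' (by fun_prop : Continuous fun t : ℂ => y + t • v) 0 y (by simp)).eventually
        (hA.mem_nhds hy)
    filter_upwards [this] with t ht
    have htB := hAB ht
    have hms := hm _ htB
    have hsub : ∀ s ∈ hb.zeros htB, ∀ s' ∈ hb.zeros htB, s = s' := fun s hs s' hs' =>
      huniq _ ht ((hb.mem_zeros htB).1 hs) ((hb.mem_zeros htB).1 hs')
    obtain ⟨s₀, hs₀⟩ := hb.exists_zero htB hq
    have hZ : hb.zeros htB = {s₀} := by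
      refine Finset.eq_singleton_iff_unique_mem.2 ⟨(hb.mem_zeros htB).2 hs₀, fun s hs => ?_⟩
      exact hsub s hs s₀ ((hb.mem_zeros htB).2 hs₀)
    rw [hZ, Finset.sum_singleton] at hms
    simp only [hpv _ t htB, hZ, Finset.sum_singleton, hms, Pi.zero_apply]
    ring
  have hm0 : (m : ℂ) ≠ 0 := by
    intro h
    obtain ⟨s₀, hs₀⟩ := hb.exists_zero hx hq
    rw [Nat.cast_eq_zero] at h
    have h1 := hm x hx
    rw [h] at h1
    have h2 := (hb.mem_zeros hx).2 hs₀
    exact hb.order_ne_zero hx h2 (Finset.sum_eq_zero_iff.1 h1 _ h2)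
  have hx' : y + (1 : ℂ) • v ∈ Metric.ball q δ := hv1
  have hmom : ∀ k : ℕ, ∑ s ∈ hb.zeros hx', (hb.order hx' s : ℂ) * s ^ k =
      m * (p 1 1 / m) ^ k := by
    intro k
    rw [← hpv]
    rcases k with _ | k
    · rw [hpv _ _ hx', ← hm _ hx']
      push_cast
      simp
    · have hdiff : DifferentiableOn ℂ (fun t => p (k + 1) t * m ^ k - p 1 t ^ (k + 1)) D :=
        ((hpd _).mul_const _).sub ((hpd 1).pow _)
      have := (hdiff.analyticOnNhd hDo).eqOn_zero_of_preconnected_of_eventuallyEq_zero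
        (convex_line y v).isPreconnected hv0 (hid k) hv1
      simp only [Pi.zero_apply] at this
      rw [div_pow, pow_succ (m : ℂ) k]
      field_simp
      linear_combination this
  have hall := eq_of_moments _ _ m _ (fun s hs => hb.order_ne_zero hx' hs) hmom
  rw [← e1]
  intro s hs s' hs'
  rw [hall s ((hb.mem_zeros hx').2 hs), hall s' ((hb.mem_zeros hx').2 hs')]

end IsWeierstrassBox

/-- Near a point where the derivative in the direction `e` is nonzero, an analytic function is
injective on `e`-lines. -/
lemma exists_nhds_line_injective [CompleteSpace E] {h : E → ℂ} (hh : AnalyticAt ℂ h q)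
    (he : fderiv ℂ h q e ≠ 0) :
    ∃ V ∈ 𝓝 q, ∀ x (s : ℂ), x ∈ V → x + s • e ∈ V → h (x + s • e) = h x → s = 0 := by
  have he0 : e ≠ 0 := by
    rintro rfl
    simp at he
  have hstrict := hh.hasStrictFDerivAt.isLittleO.def
    (show 0 < ‖fderiv ℂ h q e‖ / (2 * ‖e‖) by positivity)
  rw [nhds_prod_eq] at hstrict
  obtain ⟨V, hV, hV'⟩ := eventually_prod_self_iff (r := fun x y =>
    ‖h x - h y - fderiv ℂ h q (x - y)‖ ≤ ‖fderiv ℂ h q e‖ / (2 * ‖e‖) * ‖x - y‖) |>.1 hstrict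
  refine ⟨V, hV, fun x s hx hs hxs => ?_⟩
  have h3 := hV' _ hs _ hx
  simp only [hxs, add_sub_cancel_left, map_smul, smul_eq_mul, sub_self, zero_sub, norm_neg,
    norm_mul, norm_smul] at h3
  have hn : 0 < ‖fderiv ℂ h q e‖ := norm_pos_iff.2 he
  have hen : 0 < ‖e‖ := norm_pos_iff.2 he0
  have h5 : ‖fderiv ℂ h q e‖ / (2 * ‖e‖) * (‖s‖ * ‖e‖) = ‖s‖ * ‖fderiv ℂ h q e‖ / 2 := by
    field_simp
  rw [h5] at h3
  by_contra hs0'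
  have := mul_pos (norm_pos_iff.2 hs0') hn
  linarith

/-- An analytic germ vanishing on the zero set of `ψ` and having nonzero derivative in some
direction vanishes nowhere else. -/
lemma eventually_zero_of_fderiv_ne_zero [CompleteSpace E] {h : E → ℂ} (hψ : AnalyticAt ℂ ψ q)
    (hh : AnalyticAt ℂ h q) (hq : ψ q = 0) (he : fderiv ℂ h q e ≠ 0)
    (hsub : ∀ᶠ x in 𝓝 q, ψ x = 0 → h x = 0) : ∀ᶠ x in 𝓝 q, h x = 0 → ψ x = 0 := by
  have hq0 : q + (0 : ℂ) • e = q := by simp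
  have hnz : ¬ ∀ᶠ t in 𝓝 (0 : ℂ), ψ (q + t • e) = 0 := by
    intro hz
    have htend : Tendsto (fun t : ℂ => q + t • e) (𝓝 0) (𝓝 q) :=
      Continuous.tendsto' (by fun_prop) _ _ (by simp)
    have h1 : (fun t : ℂ => h (q + t • e)) =ᶠ[𝓝 0] fun _ => 0 := by
      filter_upwards [hz, htend.eventually hsub] with t ht ht'
      exact ht' ht
    have h2 := hasDerivAt_line (x := q) (e := e) (t := 0) (f := h) (by rwa [hq0])
    rw [hq0] at h2
    exact he (h2.unique ((hasDerivAt_const 0 0).congr_of_eventuallyEq h1))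
  obtain ⟨V₁, hV₁, hV₁'⟩ := exists_nhds_line_injective hh he
  obtain ⟨r, δ, hb, hV⟩ := exists_isWeierstrassBox hψ hnz (inter_mem hV₁ hsub)
  filter_upwards [Metric.ball_mem_nhds q hb.δ_pos] with x hx hx0
  obtain ⟨s, hs, hs0⟩ := hb.exists_zero hx hq
  have h1 := hV x hx s hs
  have h2 := hV x hx 0 (Metric.mem_closedBall_self hb.r_pos.le)
  rw [zero_smul, add_zero] at h2
  have h6 : s = 0 := hV₁' x s h2.1 h1.1 ((h1.2 hs0).trans hx0.symm)
  simpa [h6] using hs0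

lemma IsWeierstrassBox.dirDeriv_order [CompleteSpace E] {r δ : ℝ}
    (hb : IsWeierstrassBox ψ e q r δ) {x : E} (hx : x ∈ Metric.ball q δ) :
    (∀ k < hb.order hx 0, dirDeriv e k ψ x = 0) ∧ dirDeriv e (hb.order hx 0) ψ x ≠ 0 := by
  have h0 : (0 : ℂ) ∈ Metric.closedBall (0 : ℂ) r := Metric.mem_closedBall_self hb.r_pos.le
  have hx0 : x + (0 : ℂ) • e = x := by simp
  have hA : AnalyticAt ℂ ψ x := by simpa using hb.analyticAt x hx 0 h0
  have h1 := (Nat.cast_analyticOrderNatAt (hb.analyticOrderAt_ne_top hx h0)).symm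
  rw [analyticOrderAt_eq_nat_iff_iteratedDeriv_eq_zero (hb.analyticOnNhd hx 0 h0)] at h1
  refine ⟨fun k hk => ?_, ?_⟩
  · rw [← h1.1 k hk, (iteratedDeriv_line hA k).self_of_nhds, hx0]
  · have := h1.2
    rwa [(iteratedDeriv_line hA _).self_of_nhds, hx0] at this

/-- If all nearby `e`-lines meet the zero set of `ψ` once, this set is smooth. -/
lemma IsWeierstrassBox.exists_reduced_equation [CompleteSpace E] {r δ : ℝ}
    (hb : IsWeierstrassBox ψ e q r δ) (hq : ψ q = 0)
    (huniq : ∀ x ∈ Metric.ball q δ,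
      {s ∈ Metric.closedBall (0 : ℂ) r | ψ (x + s • e) = 0}.Subsingleton) :
    ∃ h : E → ℂ, AnalyticAt ℂ h q ∧ fderiv ℂ h q e ≠ 0 ∧ ∀ᶠ x in 𝓝 q, ψ x = 0 ↔ h x = 0 := by
  have h0 : (0 : ℂ) ∈ Metric.closedBall (0 : ℂ) r := Metric.mem_closedBall_self hb.r_pos.le
  obtain ⟨m, hm⟩ := hb.exists_sum_order_eq
  have hord : ∀ (x : E) (hx : x ∈ Metric.ball q δ), ψ x = 0 → hb.order hx 0 = m := by
    intro x hx hx0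
    have hz : (0 : ℂ) ∈ hb.zeros hx := (hb.mem_zeros hx).2 ⟨h0, by simpa using hx0⟩
    have hZ : hb.zeros hx = {0} := Finset.eq_singleton_iff_unique_mem.2 ⟨hz, fun s hs =>
      huniq x hx ((hb.mem_zeros hx).1 hs) ((hb.mem_zeros hx).1 hz)⟩
    have := hm x hx
    rwa [hZ, Finset.sum_singleton] at this
  have hqB := hb.mem_ball_self
  have hψ : AnalyticAt ℂ ψ q := by simpa using hb.analyticAt q hqB 0 h0
  obtain ⟨k, rfl⟩ : ∃ k, m = k + 1 := by
    refine Nat.exists_eq_succ_of_ne_zero ?_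
    rw [← hord q hqB hq]
    exact hb.order_ne_zero hqB ((hb.mem_zeros hqB).2 ⟨h0, by simpa using hq⟩)
  have hd : fderiv ℂ (dirDeriv e k ψ) q e ≠ 0 := by
    have := (hb.dirDeriv_order hqB).2
    rwa [hord q hqB hq, dirDeriv_succ] at this
  have hsub : ∀ᶠ x in 𝓝 q, ψ x = 0 → dirDeriv e k ψ x = 0 := by
    filter_upwards [Metric.ball_mem_nhds q hb.δ_pos] with x hx hx0
    exact (hb.dirDeriv_order hx).1 k (by rw [hord x hx hx0]; exact Nat.lt_succ_self k)
  refine ⟨dirDeriv e k ψ, hψ.dirDeriv k, hd, ?_⟩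
  filter_upwards [hsub, eventually_zero_of_fderiv_ne_zero hψ (hψ.dirDeriv k) hq hd hsub]
    with x h1 h2 using ⟨h1, h2⟩

/-- The zero set of an analytic function has a smooth point near each of its points. -/
lemma exists_smooth_zero [CompleteSpace E] (hψ : AnalyticAt ℂ ψ q) (hq : ψ q = 0)
    (hne : ¬ ∀ᶠ x in 𝓝 q, ψ x = 0) {V : Set E} (hV : V ∈ 𝓝 q) :
    ∃ q' ∈ V, ψ q' = 0 ∧ ∃ h : E → ℂ, AnalyticAt ℂ h q' ∧ fderiv ℂ h q' ≠ 0 ∧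
      ∀ᶠ x in 𝓝 q', ψ x = 0 ↔ h x = 0 := by
  obtain ⟨e, -, he⟩ := exists_direction dense_univ hψ hne
  obtain ⟨k₀, -, hk₀⟩ := exists_dirDeriv_simple_zero hψ hq he
  have hcont : ∀ᶠ x in 𝓝 q, dirDeriv e (k₀ + 1) ψ x ≠ 0 :=
    (hψ.dirDeriv _).continuousAt.eventually_ne hk₀
  obtain ⟨N, hN, hNo, hqN⟩ := mem_nhds_iff.1
    (inter_mem hV (hcont.and hψ.eventually_analyticAt))
  let p : ℕ → Prop := fun k => ∃ x ∈ N, ψ x = 0 ∧ dirDeriv e k ψ x ≠ 0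
  classical
  have hex : ∃ k, p k := ⟨k₀ + 1, q, hqN, hq, hk₀⟩
  obtain ⟨q', hq'N, hq', hd⟩ := Nat.find_spec hex
  obtain ⟨k, hk⟩ : ∃ k, Nat.find hex = k + 1 := by
    refine Nat.exists_eq_succ_of_ne_zero fun h => ?_
    rw [h] at hd
    exact hd hq'
  rw [hk, dirDeriv_succ] at hd
  have hψ' : AnalyticAt ℂ ψ q' := (hN hq'N).2.2
  have hsub : ∀ᶠ x in 𝓝 q', ψ x = 0 → dirDeriv e k ψ x = 0 := by
    filter_upwards [hNo.mem_nhds hq'N] with x hx hx0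
    by_contra hcon
    exact Nat.find_min hex (by rw [hk]; exact Nat.lt_succ_self k) ⟨x, hx, hx0, hcon⟩
  refine ⟨q', (hN hq'N).1, hq', dirDeriv e k ψ, hψ'.dirDeriv k, fun h => hd ?_, ?_⟩
  · beta_reduce
    rw [h, zero_apply]
  · filter_upwards [hsub, eventually_zero_of_fderiv_ne_zero hψ' (hψ'.dirDeriv k) hq' hd hsub]
      with x h1 h2 using ⟨h1, h2⟩

end

/-- The germ at `q` of the set `X` is a smooth hypersurface germ. -/
def IsSmoothGerm {E : Type*} [NormedAddCommGroup E] [NormedSpace ℂ E] (X : Set E) (q : E) : Prop :=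
  ∃ h : E → ℂ, AnalyticAt ℂ h q ∧ fderiv ℂ h q ≠ 0 ∧ ∀ᶠ x in 𝓝 q, x ∈ X ↔ h x = 0

section

variable {E : Type*} [NormedAddCommGroup E] [NormedSpace ℂ E]

lemma isOpen_setOf_isSmoothGerm (X : Set E) : IsOpen {q | IsSmoothGerm X q} := by
  rw [isOpen_iff_mem_nhds]
  rintro q ⟨h, hh, hd, he⟩
  filter_upwards [hh.eventually_analyticAt, hh.fderiv.continuousAt.eventually_ne hd,
    he.eventually_nhds] with x h1 h2 h3 using ⟨h, h1, h2, h3⟩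

/-- If two functions have the same zeros on the affine plane through `q` spanned by `e` and `v`
and `φ` is submersive in the direction `e`, then so is `χ`, provided it is submersive in the
direction `v`. -/
lemma fderiv_ne_zero_of_same_zeros {φ χ : E → ℂ} {q e v : E} (hφ : AnalyticAt ℂ φ q)
    (hχ : AnalyticAt ℂ χ q) (hφq : φ q = 0) (hχq : χ q = 0) (he : fderiv ℂ φ q e ≠ 0)
    (hv : fderiv ℂ χ q v ≠ 0)
    (h : ∀ᶠ z : ℂ × ℂ in 𝓝 0, χ (q + z.1 • e + z.2 • v) = 0 → φ (q + z.1 • e + z.2 • v) = 0) :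
    fderiv ℂ χ q e ≠ 0 := by
  intro h0
  let l : ℂ × ℂ →L[ℂ] E := (ContinuousLinearMap.fst ℂ ℂ ℂ).smulRight e +
    (ContinuousLinearMap.snd ℂ ℂ ℂ).smulRight v
  have hl : HasStrictFDerivAt (fun z : ℂ × ℂ => q + z.1 • e + z.2 • v) l 0 := by
    have := (l.hasStrictFDerivAt (x := 0)).const_add q
    simpa [l, add_assoc] using this
  have hq : q + (0 : ℂ × ℂ).1 • e + (0 : ℂ × ℂ).2 • v = q := by simp
  have h1 : HasStrictFDerivAt (fun z : ℂ × ℂ => φ (q + z.1 • e + z.2 • v))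
      ((fderiv ℂ φ q).comp l) 0 :=
    HasStrictFDerivAt.comp 0 (g := φ) (by rw [hq]; exact hφ.hasStrictFDerivAt) hl
  have h2 : HasStrictFDerivAt (fun z : ℂ × ℂ => χ (q + z.1 • e + z.2 • v))
      ((fderiv ℂ χ q).comp l) 0 :=
    HasStrictFDerivAt.comp 0 (g := χ) (by rw [hq]; exact hχ.hasStrictFDerivAt) hl
  have h3 := h1.prodMk h2
  have hsurj : (((fderiv ℂ φ q).comp l).prod ((fderiv ℂ χ q).comp l)).range = ⊤ := by
    rw [LinearMap.range_eq_top]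
    rintro ⟨a, b⟩
    refine ⟨((a - b / fderiv ℂ χ q v * fderiv ℂ φ q v) / fderiv ℂ φ q e, b / fderiv ℂ χ q v), ?_⟩
    simp [l, h0]
    constructor <;> field_simp
    ring
  have hmap := h3.map_nhds_eq_of_surj hsurj
  simp only [hq, hφq, hχq] at hmap
  have h4 : ∀ᶠ w : ℂ × ℂ in 𝓝 (0, 0), w.2 = 0 → w.1 = 0 := by
    rw [← hmap, eventually_map]
    exact h
  have h5 : Tendsto (fun t : ℂ => (t, (0 : ℂ))) (𝓝[≠] 0) (𝓝 (0, 0)) :=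
    (Continuous.tendsto' (by fun_prop : Continuous fun t : ℂ => (t, (0 : ℂ))) 0 _ rfl).mono_left
      nhdsWithin_le_nhds
  obtain ⟨t, ht, ht0⟩ := ((h5.eventually h4).and
    (self_mem_nhdsWithin : ∀ᶠ t in 𝓝[≠] (0 : ℂ), t ≠ 0)).exists
  exact ht0 (ht rfl)

/-- Suppose the hypersurface `X = {ψ = 0}` is singular at `q`, whereas its slice by the hyperplane
`{T = T q}` is smooth. Then near `q` the hyperplane is transversal to no smooth point of `X`. -/
lemma eventually_not_transversal [CompleteSpace E] {X : Set E} {ψ φ : E → ℂ} {q e : E} {T : E →L[ℂ] ℂ}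
    (hψ : AnalyticAt ℂ ψ q) (hX : ∀ᶠ x in 𝓝 q, x ∈ X ↔ ψ x = 0) (hq : q ∈ X)
    (hφ : AnalyticAt ℂ φ q) (hTe : T e = 0) (hφe : fderiv ℂ φ q e ≠ 0)
    (hslice : ∀ᶠ x in 𝓝 q, T x = T q → (x ∈ X ↔ φ x = 0)) (hsing : ¬ IsSmoothGerm X q) :
    ∀ᶠ q' in 𝓝 q, q' ∈ X → T q' = T q →
      ¬ ∃ χ : E → ℂ, AnalyticAt ℂ χ q' ∧ (∃ v, T v = 0 ∧ fderiv ℂ χ q' v ≠ 0) ∧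
        ∀ᶠ x in 𝓝 q', x ∈ X ↔ χ x = 0 := by
  have hψq : ψ q = 0 := hX.self_of_nhds.1 hq
  have hφq : φ q = 0 := (hslice.self_of_nhds rfl).1 hq
  obtain ⟨V₁, hV₁, hinj⟩ := exists_nhds_line_injective hφ hφe
  have hTl : ∀ x : E, ∀ s : ℂ, T (x + s • e) = T x := fun x s => by simp [hTe]
  have hnz : ¬ ∀ᶠ t in 𝓝 (0 : ℂ), ψ (q + t • e) = 0 := by
    intro hz
    have htend : Tendsto (fun t : ℂ => q + t • e) (𝓝 0) (𝓝 q) :=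
      Continuous.tendsto' (by fun_prop) _ _ (by simp)
    obtain ⟨t, ⟨ht1, ht2, ht3, ht4⟩, ht0⟩ := ((hz.and ((htend.eventually hX).and
      ((htend.eventually hslice).and (htend.eventually hV₁)))).filter_mono
        nhdsWithin_le_nhds |>.and (self_mem_nhdsWithin : ∀ᶠ t in 𝓝[≠] (0 : ℂ), t ≠ 0)).exists
    exact ht0 (hinj q t (mem_of_mem_nhds hV₁) ht4
      (((ht3 (hTl q t)).1 (ht2.2 ht1)).trans hφq.symm))
  obtain ⟨r, δ, hb, hV⟩ := exists_isWeierstrassBox hψ hnz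
    (inter_mem hV₁ (hX.and (hslice.and hφ.eventually_analyticAt)))
  have h0r : (0 : ℂ) ∈ Metric.closedBall (0 : ℂ) r := Metric.mem_closedBall_self hb.r_pos.le
  have hφe' : ∀ᶠ x in 𝓝 q, fderiv ℂ φ x e ≠ 0 :=
    (((ContinuousLinearMap.apply ℂ ℂ e).analyticAt _).fun_comp hφ.fderiv).continuousAt.eventually_ne
      hφe
  filter_upwards [Metric.ball_mem_nhds q hb.δ_pos, hX.eventually_nhds, hslice.eventually_nhds,
    hφ.eventually_analyticAt, hφe'] with q' hq'B hXq' hslice' hφ' hφe' hq'X hTq'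
  rintro ⟨χ, hχ, ⟨v, hTv, hχv⟩, hXχ⟩
  refine hsing ?_
  have hψq' : ψ q' = 0 := hXq'.self_of_nhds.1 hq'X
  have hχe : fderiv ℂ χ q' e ≠ 0 := by
    refine fderiv_ne_zero_of_same_zeros hφ' hχ ((hslice'.self_of_nhds hTq').1 hq'X)
      (hXχ.self_of_nhds.1 hq'X) hφe' hχv ?_
    have htend : Tendsto (fun z : ℂ × ℂ => q' + z.1 • e + z.2 • v) (𝓝 0) (𝓝 q') :=
      Continuous.tendsto' (by fun_prop) _ _ (by simp)
    filter_upwards [htend.eventually hslice', htend.eventually hXχ] with z h1 h2 h3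
    exact (h1 (by simp [hTe, hTv, hTq'])).1 (h2.2 h3)
  -- the only zero on the line through `q'`
  have huq' : ∀ s ∈ Metric.closedBall (0 : ℂ) r, ψ (q' + s • e) = 0 → s = 0 := by
    intro s hs hs0
    have h1 := hV q' hq'B s hs
    have h2 := hV q' hq'B 0 h0r
    rw [zero_smul, add_zero] at h2
    refine hinj q' s h2.1 h1.1 ?_
    rw [(h2.2.2.1 hTq').1 hq'X]
    exact (h1.2.2.1 ((hTl q' s).trans hTq')).1 (h1.2.1.2 hs0)
  obtain ⟨V₂, hV₂, hinj₂⟩ := exists_nhds_line_injective hχ hχe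
  have htend : Tendsto (fun z : E × ℂ => z.1 + z.2 • e) (𝓝 (q', 0)) (𝓝 q') :=
    Continuous.tendsto' (by fun_prop) _ _ (by simp)
  have hev : ∀ᶠ x in 𝓝 q', ∀ s ∈ Metric.closedBall (0 : ℂ) r, ψ (x + s • e) = 0 →
      x + s • e ∈ V₂ ∧ χ (x + s • e) = 0 := by
    refine (isCompact_closedBall (0 : ℂ) r).eventually_forall_of_forall_eventually
      (P := fun x s => ψ (x + s • e) = 0 → x + s • e ∈ V₂ ∧ χ (x + s • e) = 0) fun s hs => ?_
    by_cases hs0 : s = 0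
    · rw [hs0]
      filter_upwards [htend.eventually hV₂, htend.eventually hXχ, htend.eventually hXq'] with
        z h1 h2 h3 h4 using ⟨h1, h2.1 (h3.2 h4)⟩
    · have hne : ψ (q' + s • e) ≠ 0 := fun h => hs0 (huq' s hs h)
      have hA := hb.analyticAt q' hq'B s hs
      have hc : ContinuousAt (fun z : E × ℂ => ψ (z.1 + z.2 • e)) (q', s) :=
        ContinuousAt.comp (f := fun z : E × ℂ => z.1 + z.2 • e) (g := ψ) hA.continuousAt
          (by fun_prop)
      filter_upwards [hc.eventually_ne hne] with z hz hz0
      exact absurd hz0 hz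
  obtain ⟨A, hA, hAo, hq'A⟩ := mem_nhds_iff.1 (inter_mem hev
    (Metric.isOpen_ball.mem_nhds hq'B))
  have hall : ∀ x ∈ Metric.ball q δ,
      {s ∈ Metric.closedBall (0 : ℂ) r | ψ (x + s • e) = 0}.Subsingleton := by
    intro x hx
    refine hb.subsingleton_zeros hx hψq hAo ⟨q', hq'A⟩ (fun y hy => (hA hy).2) ?_
    intro y hy s hs s' hs'
    have h1 := (hA hy).1 s hs.1 hs.2
    have h2 := (hA hy).1 s' hs'.1 hs'.2
    have h3 : y + s • e + (s' - s) • e = y + s' • e := by module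
    have h4 := hinj₂ (y + s • e) (s' - s) h1.1 (by rw [h3]; exact h2.1) (by rw [h3, h1.2, h2.2])
    exact (sub_eq_zero.1 h4).symm
  obtain ⟨h, hh, hhe, hiff⟩ := hb.exists_reduced_equation hψq hall
  refine ⟨h, hh, fun h0 => hhe (by rw [h0, zero_apply]), ?_⟩
  filter_upwards [hX, hiff] with x h1 h2 using h1.trans h2

end

/-- The set `X` is parametrized near the points `γ y`, `y ∈ Ω`, by the analytic map `γ` with
finite fibres. -/
structure IsHypersurfaceParam {K E : Type*} [NormedAddCommGroup K] [NormedSpace ℂ K]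
    [NormedAddCommGroup E] [NormedSpace ℂ E] (X : Set E) (γ : K → E) (Ω : Set K) : Prop where
  isOpen : IsOpen Ω
  analyticOnNhd : AnalyticOnNhd ℂ γ Ω
  finite_fibre : ∀ y ∈ Ω, {y' ∈ Ω | γ y' = γ y}.Finite
  mem : ∀ y ∈ Ω, γ y ∈ X
  lift : ∀ y ∈ Ω, ∀ V ∈ 𝓝 y, ∀ᶠ x in 𝓝 (γ y), x ∈ X → ∃ y' ∈ V, γ y' = x
  equation : ∀ y ∈ Ω, ∃ ψ : E → ℂ, AnalyticAt ℂ ψ (γ y) ∧ (¬ ∀ᶠ x in 𝓝 (γ y), ψ x = 0) ∧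
    ∀ᶠ x in 𝓝 (γ y), x ∈ X ↔ ψ x = 0

/-- The slice of `X` by the affine hyperplane `{T = T q}` is smooth at `q`. -/
def IsSmoothSliceGerm {E : Type*} [NormedAddCommGroup E] [NormedSpace ℂ E] (T : E →L[ℂ] ℂ)
    (X : Set E) (q : E) : Prop :=
  ∃ (h : E → ℂ) (e : E), AnalyticAt ℂ h q ∧ T e = 0 ∧ fderiv ℂ h q e ≠ 0 ∧
    ∀ᶠ x in 𝓝 q, T x = T q → (x ∈ X ↔ h x = 0)

lemma not_eventually_mem_of_finite {K : Type*} [TopologicalSpace K] [T1Space K] {δ : ℂ → K}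
    (hδ : ContinuousAt δ 0) (hne : ∀ᶠ t in 𝓝[≠] (0 : ℂ), δ t ≠ δ 0) {F : Set K} (hF : F.Finite) :
    ¬ ∀ᶠ t in 𝓝[≠] (0 : ℂ), δ t ∈ F := by
  intro h
  have h1 : ∀ᶠ t in 𝓝 (0 : ℂ), δ t ∈ (F \ {δ 0})ᶜ :=
    hδ.eventually ((hF.subset sdiff_subset).isClosed.isOpen_compl.mem_nhds (by simp))
  obtain ⟨t, ht1, ht2, ht3⟩ := (h.and (hne.and (h1.filter_mono nhdsWithin_le_nhds))).exists
  exact ht3 ⟨ht1, ht2⟩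

section

variable {K E : Type*} [NormedAddCommGroup K] [NormedSpace ℂ K] [FiniteDimensional ℂ K]
  [NormedAddCommGroup E] [NormedSpace ℂ E] [FiniteDimensional ℂ E] {X : Set E} {γ : K → E}
  {Ω : Set K}

omit [FiniteDimensional ℂ K] [FiniteDimensional ℂ E] in
lemma IsHypersurfaceParam.eventually_eq_const (hγ : IsHypersurfaceParam X γ Ω) {δ : ℂ → K}
    (hδ : ContinuousAt δ 0) (h0 : δ 0 ∈ Ω) (hne : ∀ᶠ t in 𝓝[≠] (0 : ℂ), δ t ≠ δ 0) :
    ¬ ∀ᶠ t in 𝓝 (0 : ℂ), γ (δ t) = γ (δ 0) := by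
  intro h
  refine not_eventually_mem_of_finite hδ hne (hγ.finite_fibre _ h0) ?_
  filter_upwards [(h.and (hδ.eventually (hγ.isOpen.mem_nhds h0))).filter_mono nhdsWithin_le_nhds]
    with t ht using ⟨ht.2, ht.1⟩

/-- A parametrization with a zero of its derivative which is a limit of such zeros is not finite. -/
lemma IsHypersurfaceParam.eventually_fderiv_ne_zero (hγ : IsHypersurfaceParam X γ Ω) {y : K}
    (hy : y ∈ Ω) : ∀ᶠ z in 𝓝[≠] y, fderiv ℂ γ z ≠ 0 := by
  by_cases hy0 : fderiv ℂ γ y = 0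
  swap
  · exact ((hγ.analyticOnNhd y hy).fderiv.continuousAt.eventually_ne hy0).filter_mono
      nhdsWithin_le_nhds
  let L : (K →L[ℂ] E) ≃L[ℂ] (Fin (Module.finrank ℂ (K →L[ℂ] E)) → ℂ) :=
    ContinuousLinearEquiv.ofFinrankEq (by simp)
  let f : Fin (Module.finrank ℂ (K →L[ℂ] E)) → K → ℂ := fun i z => L (fderiv ℂ γ z) i
  have hf : ∀ i, AnalyticOnNhd ℂ (f i) Ω := by
    intro i z hz
    let l : (K →L[ℂ] E) →L[ℂ] ℂ := (ContinuousLinearMap.proj i).comp L.toContinuousLinearMap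
    exact (l.analyticAt _).fun_comp (hγ.analyticOnNhd z hz).fderiv
  have hf0 : ∀ z, (∀ i, f i z = 0) ↔ fderiv ℂ γ z = 0 := by
    intro z
    rw [← map_eq_zero_iff L L.injective]
    exact funext_iff.symm
  by_cases hc : {z ∈ Ω | ∀ i, f i z = 0}.Countable
  · filter_upwards [isolated_of_countable_zeros hγ.isOpen hy hf ((hf0 y).2 hy0) hc] with z hz hz0
    obtain ⟨i, hi⟩ := hz
    exact hi ((hf0 z).2 hz0 i)
  · exfalso
    obtain ⟨δ, hδ, hδΩ, hne, hzero⟩ := exists_analytic_disc hγ.isOpen hf hc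
    refine hγ.eventually_eq_const hδ.continuousAt hδΩ hne ?_
    obtain ⟨ρ, hρ, hball⟩ := Metric.nhds_basis_ball.eventually_iff.1 (hzero.and
      (hδ.eventually_analyticAt.and (hδ.continuousAt.eventually (hγ.isOpen.mem_nhds hδΩ))))
    have hd : ∀ t ∈ Metric.ball (0 : ℂ) ρ, HasDerivAt (fun t => γ (δ t)) 0 t := by
      intro t ht
      obtain ⟨h1, h2, h3⟩ := hball ht
      have h4 := (hγ.analyticOnNhd _ h3).differentiableAt.hasFDerivAt.comp_hasDerivAt t
        h2.differentiableAt.hasDerivAt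
      rw [(hf0 _).1 h1, zero_apply] at h4
      exact h4
    filter_upwards [Metric.ball_mem_nhds (0 : ℂ) hρ] with t ht
    exact Metric.isOpen_ball.is_const_of_deriv_eq_zero (convex_ball (0 : ℂ) ρ).isPreconnected
      (fun s hs => (hd s hs).differentiableAt.differentiableWithinAt)
      (fun s hs => (hd s hs).deriv) ht (Metric.mem_ball_self hρ)

/-- A hypersurface parametrized by an immersion is smooth. -/
lemma IsHypersurfaceParam.isSmoothGerm_of_injective (hγ : IsHypersurfaceParam X γ Ω)
    (hdim : Module.finrank ℂ K + 1 = Module.finrank ℂ E) {y : K} (hy : y ∈ Ω)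
    (hinj : Function.Injective (fderiv ℂ γ y)) : IsSmoothGerm X (γ y) := by
  have : CompleteSpace E := FiniteDimensional.complete ℂ E
  have : CompleteSpace K := FiniteDimensional.complete ℂ K
  set D := fderiv ℂ γ y with hD
  obtain ⟨e, he⟩ : ∃ e, e ∉ LinearMap.range (D : K →ₗ[ℂ] E) := by
    by_contra! hcon
    have h1 : Function.Surjective (D : K →ₗ[ℂ] E) := hcon
    have := LinearMap.finrank_le_finrank_of_surjective h1
    omega
  let L : K × ℂ →L[ℂ] E := D.coprod ((1 : ℂ →L[ℂ] ℂ).smulRight e)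
  have hL : Function.Injective (L : K × ℂ →ₗ[ℂ] E) := by
    rw [← LinearMap.ker_eq_bot, LinearMap.ker_eq_bot']
    rintro ⟨w, s⟩ hws
    have hws' : D w + s • e = 0 := by simpa [L] using hws
    have hs : s = 0 := by
      by_contra hs
      refine he ⟨-(s⁻¹ • w), ?_⟩
      have : e = -(s⁻¹ • D w) := by
        rw [eq_neg_of_add_eq_zero_left hws', smul_neg, neg_neg, smul_smul, inv_mul_cancel₀ hs,
          one_smul]
      rw [this]
      simp
    rw [hs, zero_smul, add_zero] at hws'
    rw [hs, hinj (hws'.trans (map_zero D).symm)]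
    rfl
  let L' : (K × ℂ) ≃L[ℂ] E := (LinearMap.linearEquivOfInjective (L : K × ℂ →ₗ[ℂ] E) hL
    (by rw [Module.finrank_prod, Module.finrank_self, hdim])).toContinuousLinearEquiv
  let f : K × ℂ → E := fun z => γ z.1 + z.2 • e
  have hA : AnalyticAt ℂ f (y, 0) :=
    (AnalyticAt.fun_comp (f := Prod.fst) (g := γ) (hγ.analyticOnNhd y hy) analyticAt_fst).add
      (analyticAt_snd.smul analyticAt_const)
  have hfd : HasFDerivAt f L (y, 0) := by
    have h1 : HasFDerivAt (fun z : K × ℂ => γ z.1) (D.comp (ContinuousLinearMap.fst ℂ K ℂ)) (y, 0) :=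
      HasFDerivAt.comp (y, (0 : ℂ)) (g := γ) (f := Prod.fst)
        (hγ.analyticOnNhd y hy).differentiableAt.hasFDerivAt hasFDerivAt_fst
    have h2 : HasFDerivAt (fun z : K × ℂ => z.2 • e)
        ((ContinuousLinearMap.snd ℂ K ℂ).smulRight e) (y, 0) :=
      ((ContinuousLinearMap.snd ℂ K ℂ).smulRight e).hasFDerivAt
    refine (h1.add h2).congr_fderiv ?_
    ext z <;> simp [L]
  have hf0 : f (y, 0) = γ y := by simp [f]
  obtain ⟨S, hSA, hS0, hfS, hSf, hSd⟩ := exists_analytic_local_inverse hA L' (by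
    rw [hfd.fderiv]
    ext z <;> rfl)
  rw [hf0] at hSA hS0 hfS hSd
  refine ⟨fun x => (S x).2, analyticAt_snd.fun_comp hSA, ?_, ?_⟩
  · have h1 : HasFDerivAt (fun x => (S x).2) ((ContinuousLinearMap.snd ℂ K ℂ).comp
        (L'.symm : E →L[ℂ] K × ℂ)) (γ y) :=
      HasFDerivAt.comp (γ y) (g := Prod.snd) hasFDerivAt_snd hSd
    rw [h1.fderiv]
    intro h0
    have := DFunLike.congr_fun h0 (L' (0, 1))
    simp at this
  · have hV : {y' | S (f (y', 0)) = (y', 0)} ∈ 𝓝 y :=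
      (Continuous.tendsto' (by fun_prop : Continuous fun y' : K => (y', (0 : ℂ))) y _ rfl).eventually
        hSf
    have hΩ : ∀ᶠ x in 𝓝 (γ y), (S x).1 ∈ Ω := by
      have : ContinuousAt (fun x => (S x).1) (γ y) := continuous_fst.continuousAt.comp hSA.continuousAt
      refine this.eventually (hγ.isOpen.mem_nhds ?_)
      beta_reduce
      rwa [hS0]
    filter_upwards [hγ.lift y hy _ hV, hfS, hΩ] with x h1 h2 h3
    constructor
    · intro hx
      obtain ⟨y', hy', rfl⟩ := h1 hx
      have hy'' : S (f (y', 0)) = (y', 0) := hy'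
      simp only [f, zero_smul, add_zero] at hy''
      rw [hy'']
    · intro hx
      rw [← h2]
      simp only [f, hx, zero_smul, add_zero]
      exact hγ.mem _ h3

end

section

variable {K E : Type*} [NormedAddCommGroup K] [NormedSpace ℂ K] [FiniteDimensional ℂ K]
  [NormedAddCommGroup E] [NormedSpace ℂ E] [FiniteDimensional ℂ E] {X : Set E} {γ : K → E}
  {Ω : Set K}

/-- If a hyperplane transversal to `γ` cuts a singular hypersurface in a smooth slice, then the
hypersurface is singular along that slice. -/
lemma IsHypersurfaceParam.eventually_not_isSmoothGerm (hγ : IsHypersurfaceParam X γ Ω) {y : K}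
    (hy : y ∈ Ω) (hsing : ¬ IsSmoothGerm X (γ y)) {T : E →L[ℂ] ℂ}
    (hT : T.comp (fderiv ℂ γ y) ≠ 0) (hslice : IsSmoothSliceGerm T X (γ y)) :
    ∀ᶠ y' in 𝓝 y, T (γ y') = T (γ y) → ¬ IsSmoothGerm X (γ y') := by
  have : CompleteSpace E := FiniteDimensional.complete ℂ E
  have : CompleteSpace K := FiniteDimensional.complete ℂ K
  obtain ⟨ψ, hψ, -, hXψ⟩ := hγ.equation y hy
  obtain ⟨φ, e, hφ, hTe, hφe, hXφ⟩ := hslice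
  have h1 := eventually_not_transversal hψ hXψ (hγ.mem y hy) hφ hTe hφe hXφ hsing
  have hγy := hγ.analyticOnNhd y hy
  have hT' : ∀ᶠ y' in 𝓝 y, T.comp (fderiv ℂ γ y') ≠ 0 := by
    have : ContinuousAt (fun y' => T.comp (fderiv ℂ γ y')) y :=
      continuousAt_const.clm_comp hγy.fderiv.continuousAt
    exact this.eventually_ne hT
  filter_upwards [hγy.continuousAt.eventually h1, hT', hγ.isOpen.mem_nhds hy] with y' h2 h3 hy' hTy'
  rintro ⟨χ, hχ, hχ0, hXχ⟩
  refine h2 (hγ.mem y' hy') hTy' ⟨χ, hχ, ?_, hXχ⟩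
  by_contra! hcon
  obtain ⟨c, hc⟩ : ∃ c : ℂ, fderiv ℂ χ (γ y') = c • T := by
    by_cases hT0 : ∀ v, T v = 0
    · exact ⟨0, by ext v; simp [hcon v (hT0 v)]⟩
    · push Not at hT0
      obtain ⟨v₀, hv₀⟩ := hT0
      refine ⟨fderiv ℂ χ (γ y') v₀ / T v₀, ?_⟩
      ext v
      have h := hcon (v - (T v / T v₀) • v₀) (by simp [hv₀])
      rw [map_sub, map_smul, sub_eq_zero] at h
      rw [h, smul_apply, smul_eq_mul, smul_eq_mul]
      ring
  have hγy' := hγ.analyticOnNhd y' hy'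
  have hzero : (fun z => χ (γ z)) =ᶠ[𝓝 y'] fun _ => 0 := by
    filter_upwards [hγy'.continuousAt.eventually hXχ, hγ.isOpen.mem_nhds hy'] with z hz hzΩ
    exact hz.1 (hγ.mem z hzΩ)
  have h4 : HasFDerivAt (fun z => χ (γ z)) ((fderiv ℂ χ (γ y')).comp (fderiv ℂ γ y')) y' :=
    HasFDerivAt.comp y' hχ.differentiableAt.hasFDerivAt hγy'.differentiableAt.hasFDerivAt
  have h5 := h4.unique ((hasFDerivAt_const (0 : ℂ) y').congr_of_eventuallyEq hzero)
  rw [hc, ContinuousLinearMap.smul_comp] at h5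
  have hc0 : c ≠ 0 := by
    rintro rfl
    refine hχ0 (ContinuousLinearMap.ext fun v => ?_)
    rw [hc]
    exact zero_mul _
  refine h3 (ContinuousLinearMap.ext fun z => ?_)
  have h6 : c * T (fderiv ℂ γ y' z) = 0 := DFunLike.congr_fun h5 z
  exact (mul_eq_zero.1 h6).resolve_left hc0

/-- Along a singular slice some transversal functional takes all values close to a given one. -/
lemma IsHypersurfaceParam.exists_functional (hγ : IsHypersurfaceParam X γ Ω) {y : K}
    (hy : y ∈ Ω) (hD : fderiv ℂ γ y ≠ 0) (hinj : ¬ Function.Injective (fderiv ℂ γ y))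
    {S : Set K} (hS : ∀ T : E →L[ℂ] ℂ, T.comp (fderiv ℂ γ y) ≠ 0 →
      ∀ᶠ y' in 𝓝 y, T (γ y') = T (γ y) → y' ∈ S) :
    ∃ T : E →L[ℂ] ℂ, T.comp (fderiv ℂ γ y) ≠ 0 ∧
      ∀ V ∈ 𝓝 y, ∀ᶠ c in 𝓝 (T (γ y)), ∃ y' ∈ V, y' ∈ S ∧ T (γ y') = c := by
  have : CompleteSpace E := FiniteDimensional.complete ℂ E
  have : CompleteSpace K := FiniteDimensional.complete ℂ K
  have hγy := hγ.analyticOnNhd y hy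
  obtain ⟨w₀, hw₀⟩ : ∃ w, fderiv ℂ γ y w ≠ 0 := by
    by_contra! hcon
    exact hD (ContinuousLinearMap.ext hcon)
  obtain ⟨T₁, hT₁⟩ := SeparatingDual.exists_eq_one (R := ℂ) hw₀
  have hT₁0 : T₁.comp (fderiv ℂ γ y) ≠ 0 := by
    intro h
    have := DFunLike.congr_fun h w₀
    simp [hT₁] at this
  have hhA : AnalyticAt ℂ (fun z => T₁ (γ z) - T₁ (γ y)) y :=
    ((T₁.analyticAt _).fun_comp hγy).sub analyticAt_const
  have hhd : fderiv ℂ (fun z => T₁ (γ z) - T₁ (γ y)) y = T₁.comp (fderiv ℂ γ y) :=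
    ((T₁.hasFDerivAt.comp y hγy.differentiableAt.hasFDerivAt).sub_const _).fderiv
  obtain ⟨δ, π, hδ, hδ0, -, hδz, -, -, -, hπδ⟩ := exists_kernel_param (u := w₀) hhA (sub_self _) (by
    rw [hhd]
    simp [hT₁])
  have hδy : ContinuousAt δ 0 := hδ.continuousAt
  -- the kernel is nontrivial
  obtain ⟨w, hw, hDw⟩ : ∃ w, w ≠ 0 ∧ fderiv ℂ γ y w = 0 := by
    by_contra! hcon
    refine hinj ((injective_iff_map_eq_zero _).2 fun w hw => ?_)
    by_contra hw0
    exact hcon w hw0 hw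
  have hwk : w ∈ (fderiv ℂ (fun z => T₁ (γ z) - T₁ (γ y)) y : K →ₗ[ℂ] ℂ).ker := by
    rw [hhd]
    simp [hDw]
  have hκ : AnalyticAt ℂ (fun z => γ (δ z)) 0 :=
    AnalyticAt.fun_comp (g := γ) (by rwa [hδ0]) hδ
  have hline : Tendsto (fun t : ℂ => t • (⟨w, hwk⟩ : (fderiv ℂ (fun z => T₁ (γ z) - T₁ (γ y)) y :
      K →ₗ[ℂ] ℂ).ker)) (𝓝 0) (𝓝 0) := Continuous.tendsto' (by fun_prop) _ _ (by simp)
  have hnc : ¬ ∀ᶠ z in 𝓝 0, γ (δ z) = γ y := by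
    intro hc
    have h0 : δ ((0 : ℂ) • ⟨w, hwk⟩) = y := by rw [zero_smul, hδ0]
    refine hγ.eventually_eq_const (δ := fun t : ℂ => δ (t • ⟨w, hwk⟩)) ?_ ?_ ?_ ?_
    · refine ContinuousAt.comp (f := fun t : ℂ => t • _) (g := δ) ?_ (by fun_prop)
      rwa [zero_smul]
    · rwa [h0]
    · filter_upwards [(hline.eventually hπδ).filter_mono nhdsWithin_le_nhds, self_mem_nhdsWithin]
        with t ht ht0 heq
      rw [heq, zero_smul, hπδ.self_of_nhds] at ht
      rcases smul_eq_zero.1 ht.symm with h | h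
      · exact ht0 h
      · exact hw (congrArg Subtype.val h)
    · filter_upwards [hline.eventually hc] with t ht
      rw [ht, h0]
  -- a functional which is not constant along the slice
  obtain ⟨T, hT⟩ : ∃ T : E →L[ℂ] ℂ, ¬ ∀ᶠ z in 𝓝 0, T (γ (δ z)) = T (γ y) := by
    by_contra! hcon
    let L : E ≃L[ℂ] (Fin (Module.finrank ℂ E) → ℂ) := ContinuousLinearEquiv.ofFinrankEq (by simp)
    refine hnc ?_
    have h1 : ∀ᶠ z in 𝓝 0, ∀ i, L (γ (δ z)) i = L (γ y) i := by
      rw [eventually_all]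
      intro i
      exact hcon ((ContinuousLinearMap.proj i).comp L.toContinuousLinearMap)
    filter_upwards [h1] with z hz
    exact L.injective (funext hz)
  obtain ⟨T₂, hT₂, hT₂'⟩ : ∃ T : E →L[ℂ] ℂ, T.comp (fderiv ℂ γ y) ≠ 0 ∧
      ¬ ∀ᶠ z in 𝓝 0, T (γ (δ z)) = T (γ y) := by
    by_cases hTD : T.comp (fderiv ℂ γ y) = 0
    · refine ⟨T + T₁, by rwa [ContinuousLinearMap.add_comp, hTD, zero_add], fun hc => hT ?_⟩
      filter_upwards [hc, hδz] with z h1 h2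
      have h3 : T (γ (δ z)) + T₁ (γ (δ z)) = T (γ y) + T₁ (γ y) := h1
      linear_combination h3 - h2
    · exact ⟨T, hTD, hT⟩
  refine ⟨T₂, hT₂, fun V hV => ?_⟩
  have hopen := ((T₂.analyticAt _).fun_comp hκ).eventually_constant_or_nhds_le_map_nhds
  rw [hδ0] at hopen
  have hle := hopen.resolve_left hT₂'
  have hmem : ∀ᶠ z in 𝓝 0, δ z ∈ V ∧ δ z ∈ S := by
    rw [← hδ0] at hV
    have hS' := hS T₁ hT₁0
    have h1 : ∀ᶠ z in 𝓝 0, T₁ (γ (δ z)) = T₁ (γ y) → δ z ∈ S :=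
      hδy.eventually (by rwa [hδ0])
    filter_upwards [hδy.eventually hV, h1, hδz] with z hz1 hz2 hz3
    exact ⟨hz1, hz2 (sub_eq_zero.1 hz3)⟩
  have himg := hle (image_mem_map hmem)
  filter_upwards [himg] with c hc
  obtain ⟨z, hz, rfl⟩ := hc
  exact ⟨δ z, hz.1, hz.2, rfl⟩

/-- A closed set meeting all level sets of `T ∘ γ` near `y`, and relatively open in each of them,
is a neighborhood of `y`. -/
lemma mem_nhds_of_isOpen_levels {ρ : K → ℂ} {ρ' : K →L[ℂ] ℂ} {y : K}
    (hρ : HasStrictFDerivAt ρ ρ' y) (hρ' : ρ' ≠ 0) {S N : Set K} (hN : N ∈ 𝓝 y)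
    (hclosed : ∀ z ∈ N, z ∉ S → ∀ᶠ z' in 𝓝 z, z' ∉ S)
    (hopen : ∀ z ∈ N, z ∈ S → ∀ᶠ z' in 𝓝 z, ρ z' = ρ z → z' ∈ S)
    (hmeet : ∀ V ∈ 𝓝 y, ∀ᶠ c in 𝓝 (ρ y), ∃ y' ∈ V, y' ∈ S ∧ ρ y' = c) : S ∈ 𝓝 y := by
  have : CompleteSpace K := FiniteDimensional.complete ℂ K
  have hsurj : (ρ' : K →ₗ[ℂ] ℂ).range = ⊤ := by
    rw [LinearMap.range_eq_top]
    refine LinearMap.surjective fun h => hρ' ?_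
    ext z
    exact DFunLike.congr_fun h z
  let e := hρ.implicitToOpenPartialHomeomorph ρ ρ' hsurj
  have hy : y ∈ e.source := hρ.mem_implicitToOpenPartialHomeomorph_source hsurj
  have hfst : ∀ x, (e x).1 = ρ x := hρ.implicitToOpenPartialHomeomorph_fst hsurj
  have hN' : e.target ∩ e.symm ⁻¹' N ∈ 𝓝 (e y) := by
    refine inter_mem (e.open_target.mem_nhds (e.map_source hy)) ?_
    refine (e.symm.continuousAt (e.map_source hy)).preimage_mem_nhds ?_
    rwa [e.left_inv hy]
  obtain ⟨ε, hε, hball⟩ := Metric.mem_nhds_iff.1 hN'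
  have hball' : ∀ c ∈ Metric.ball (e y).1 ε, ∀ w ∈ Metric.ball (e y).2 ε,
      (c, w) ∈ e.target ∧ e.symm (c, w) ∈ N := by
    intro c hc w hw
    have : (c, w) ∈ Metric.ball (e y) ε := by
      rw [← Prod.mk.eta (p := e y), ← ball_prod_same]
      exact ⟨hc, hw⟩
    exact hball this
  let V : Set K := e.source ∩ e ⁻¹' Metric.ball (e y) ε
  have hV : V ∈ 𝓝 y := inter_mem (e.open_source.mem_nhds hy)
    ((e.continuousAt hy).preimage_mem_nhds (Metric.ball_mem_nhds _ hε))
  have hVmem : ∀ z ∈ V, (e z).1 ∈ Metric.ball (e y).1 ε ∧ (e z).2 ∈ Metric.ball (e y).2 ε := by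
    intro z hz
    have : e z ∈ Metric.ball (e y) ε := hz.2
    rw [← Prod.mk.eta (p := e y), ← ball_prod_same] at this
    exact this
  filter_upwards [hV, hρ.continuousAt.eventually (hmeet V hV)] with z hz hz'
  obtain ⟨y', hy'V, hy'S, hy'⟩ := hz'
  obtain ⟨hc, hw⟩ := hVmem z hz
  obtain ⟨hc', hw'⟩ := hVmem y' hy'V
  set c := (e z).1 with hcdef
  have hc'' : (e y').1 = c := by rw [hfst, hy', hcdef, hfst]
  have hρc : ∀ w ∈ Metric.ball (e y).2 ε, ρ (e.symm (c, w)) = c := by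
    intro w hw
    rw [← hfst, e.right_inv (hball' c hc w hw).1]
  have hcts : ∀ w ∈ Metric.ball (e y).2 ε, ContinuousAt (fun w => e.symm (c, w)) w := by
    intro w hw
    exact ContinuousAt.comp (f := fun w => (c, w)) (g := e.symm)
      (e.symm.continuousAt (hball' c hc w hw).1) (by fun_prop)
  let A : Set (ρ' : K →ₗ[ℂ] ℂ).ker := {w ∈ Metric.ball (e y).2 ε | e.symm (c, w) ∈ S}
  let _ : NormedSpace ℝ (ρ' : K →ₗ[ℂ] ℂ).ker := NormedSpace.restrictScalars ℝ ℂ _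
  have hsub : Metric.ball (e y).2 ε ⊆ A := by
    refine (convex_ball (e y).2 ε).isPreconnected.subset_of_closure_inter_subset ?_ ?_ ?_
    · rw [isOpen_iff_mem_nhds]
      rintro w ⟨hw, hwS⟩
      filter_upwards [Metric.isOpen_ball.mem_nhds hw,
        (hcts w hw).eventually (hopen _ (hball' c hc w hw).2 hwS)] with w' hw' h1
      exact ⟨hw', h1 ((hρc w' hw').trans (hρc w hw).symm)⟩
    · refine ⟨(e y').2, hw', hw', ?_⟩
      rw [← hc'', Prod.mk.eta, e.left_inv hy'V.1]
      exact hy'S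
    · rintro w ⟨hwA, hw⟩
      refine ⟨hw, ?_⟩
      by_contra hwS
      have h1 := (hcts w hw).eventually (hclosed _ (hball' c hc w hw).2 hwS)
      obtain ⟨w', hw'1, hw'2⟩ := ((mem_closure_iff_frequently.1 hwA).and_eventually h1).exists
      exact hw'2 hw'1.2
  have := (hsub hw).2
  rwa [hcdef, Prod.mk.eta, e.left_inv hz.1] at this

/-- A singular hypersurface with a finite parametrization has a singular slice by a hyperplane
transversal to the parametrization. -/
lemma IsHypersurfaceParam.exists_singular_slice (hγ : IsHypersurfaceParam X γ Ω)
    (hdim : Module.finrank ℂ K + 1 = Module.finrank ℂ E) {a : K} (ha : a ∈ Ω)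
    (hcl : γ a ∈ closure ({q ∈ X | ¬ IsSmoothGerm X q} \ {γ a})) :
    ∃ y ∈ Ω, ∃ T : E →L[ℂ] ℂ, T.comp (fderiv ℂ γ y) ≠ 0 ∧ ¬ IsSmoothSliceGerm T X (γ y) := by
  have : CompleteSpace E := FiniteDimensional.complete ℂ E
  have : CompleteSpace K := FiniteDimensional.complete ℂ K
  by_contra! hN
  -- a singular point where the derivative does not vanish
  obtain ⟨y, hy, hsing, hD⟩ : ∃ y ∈ Ω, ¬ IsSmoothGerm X (γ y) ∧ fderiv ℂ γ y ≠ 0 := by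
    have h1 := hγ.eventually_fderiv_ne_zero ha
    rw [eventually_nhdsWithin_iff] at h1
    have h2 := hγ.lift a ha _ (inter_mem h1 (hγ.isOpen.mem_nhds ha))
    obtain ⟨q, hq, hq'⟩ := ((mem_closure_iff_frequently.1 hcl).and_eventually h2).exists
    obtain ⟨y, hyV, rfl⟩ := hq' hq.1.1
    refine ⟨y, hyV.2, hq.1.2, hyV.1 ?_⟩
    rintro rfl
    exact hq.2 rfl
  have hinj : ¬ Function.Injective (fderiv ℂ γ y) := fun h =>
    hsing (hγ.isSmoothGerm_of_injective hdim hy h)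
  let S : Set K := {z | ¬ IsSmoothGerm X (γ z)}
  obtain ⟨T, hT, hmeet⟩ := hγ.exists_functional hy hD hinj (S := S) fun T hT =>
    hγ.eventually_not_isSmoothGerm hy hsing hT (hN y hy T hT)
  have hγy := hγ.analyticOnNhd y hy
  have hT' : ∀ᶠ z in 𝓝 y, T.comp (fderiv ℂ γ z) ≠ 0 := by
    have : ContinuousAt (fun z => T.comp (fderiv ℂ γ z)) y :=
      continuousAt_const.clm_comp hγy.fderiv.continuousAt
    exact this.eventually_ne hT
  have hS : S ∈ 𝓝 y := by
    refine mem_nhds_of_isOpen_levels (ρ := fun z => T (γ z))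
      (T.hasStrictFDerivAt.comp y hγy.hasStrictFDerivAt) hT
      (inter_mem hT' (hγ.isOpen.mem_nhds hy)) ?_ ?_ hmeet
    · rintro z ⟨-, hz⟩ hzS
      have hzS' : IsSmoothGerm X (γ z) := not_not.1 hzS
      filter_upwards [(hγ.analyticOnNhd z hz).continuousAt.eventually
        ((isOpen_setOf_isSmoothGerm X).mem_nhds hzS')] with z' hz'
      exact not_not.2 hz'
    · rintro z ⟨hz, hzΩ⟩ hzS
      exact hγ.eventually_not_isSmoothGerm hzΩ hzS hz (hN z hzΩ T hz)
  obtain ⟨ψ, hψ, hψ0, hXψ⟩ := hγ.equation y hy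
  obtain ⟨q, hq, hq0, h, hh, hh0, hiff⟩ := exists_smooth_zero hψ
    (hXψ.self_of_nhds.1 (hγ.mem y hy)) hψ0
    (inter_mem (hγ.lift y hy S hS) hXψ.eventually_nhds)
  obtain ⟨z, hz, rfl⟩ := hq.1 (hq.2.self_of_nhds.2 hq0)
  refine hz ⟨h, hh, hh0, ?_⟩
  filter_upwards [hq.2, hiff] with x h1 h2 using h1.trans h2

end

section

variable {E : Type*} [NormedAddCommGroup E] [NormedSpace ℂ E] [FiniteDimensional ℂ E]

/-- A holomorphic map with an isolated zero has finite fibers and is open near that zero. -/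
lemma exists_nhds_finite_fibre_open {g : E → E} {U : Set E} {a : E} (hU : IsOpen U) (ha : a ∈ U)
    (hg : AnalyticOnNhd ℂ g U) (hiso : ∀ x ∈ U, g x = g a → x = a) :
    ∃ N ⊆ U, IsOpen N ∧ a ∈ N ∧ (∀ x ∈ N, {y ∈ N | g y = g x}.Finite) ∧
      ∀ x ∈ N, 𝓝 (g x) ≤ map g (𝓝 x) := by
  have : ProperSpace E := FiniteDimensional.proper ℂ E
  obtain ⟨r, hr, hrU⟩ := Metric.nhds_basis_closedBall.mem_iff.1 (hU.mem_nhds ha)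
  have hS : g a ∉ g '' Metric.sphere a r := by
    rintro ⟨x, hx, hxa⟩
    have := hiso x (hrU (Metric.sphere_subset_closedBall hx)) hxa
    rw [this, Metric.mem_sphere, dist_self] at hx
    exact hr.ne hx
  have hcpt : IsCompact (g '' Metric.sphere a r) := (isCompact_sphere a r).image_of_continuousOn
    (hg.continuousOn.mono (Metric.sphere_subset_closedBall.trans hrU))
  have hev : Metric.ball a r ∩ g ⁻¹' (g '' Metric.sphere a r)ᶜ ∈ 𝓝 a :=
    inter_mem (Metric.ball_mem_nhds a hr)
      ((hg a ha).continuousAt.preimage_mem_nhds (hcpt.isClosed.isOpen_compl.mem_nhds hS))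
  obtain ⟨N, hN, hNo, haN⟩ := mem_nhds_iff.1 hev
  have hball : Metric.ball a r ⊆ U := Metric.ball_subset_closedBall.trans hrU
  have hfin : ∀ x ∈ N, {y ∈ Metric.ball a r | g y = g x}.Finite := by
    intro x hx
    refine finite_fibre Metric.isOpen_ball Metric.isBounded_ball
      (hg.mono (Metric.closure_ball_subset_closedBall.trans hrU)) fun y hy hyx => ?_
    exact (hN hx).2 ⟨y, Metric.frontier_ball_subset_sphere hy, hyx⟩
  refine ⟨N, fun x hx => hball (hN hx).1, hNo, haN, fun x hx => (hfin x hx).subset ?_,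
    fun x hx => ?_⟩
  · exact fun y hy => ⟨(hN hy.1).1, hy.2⟩
  · refine nhds_le_map_of_isolated (hg x (hball (hN hx).1)) ?_
    have h1 : ({y ∈ Metric.ball a r | g y = g x} \ {x})ᶜ ∈ 𝓝 x :=
      ((hfin x hx).subset sdiff_subset).isClosed.isOpen_compl.mem_nhds (fun h => h.2 rfl)
    filter_upwards [mem_nhdsWithin_of_mem_nhds h1, self_mem_nhdsWithin,
      mem_nhdsWithin_of_mem_nhds (Metric.isOpen_ball.mem_nhds (hN hx).1)] with y h2 h3 h4 h5
    exact h2 ⟨⟨h4, h5⟩, h3⟩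

/-- A smooth preimage of a hypersurface under a finite map parametrizes the hypersurface. -/
lemma exists_isHypersurfaceParam {g : E → E} {X N : Set E} {φ : E → ℂ} {a : E}
    (hN : IsOpen N) (ha : a ∈ N) (hg : AnalyticOnNhd ℂ g N)
    (hfin : ∀ x ∈ N, {y ∈ N | g y = g x}.Finite) (hopen : ∀ x ∈ N, 𝓝 (g x) ≤ map g (𝓝 x))
    (heq : ∀ x ∈ N, ∃ ψ : E → ℂ, AnalyticAt ℂ ψ (g x) ∧ (¬ ∀ᶠ z in 𝓝 (g x), ψ z = 0) ∧
      ∀ᶠ z in 𝓝 (g x), z ∈ X ↔ ψ z = 0)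
    (hφ : AnalyticAt ℂ φ a) (hφa : fderiv ℂ φ a ≠ 0) (hX : ∀ᶠ x in 𝓝 a, g x ∈ X ↔ φ x = 0)
    (haX : g a ∈ X) :
    ∃ (Ψ : (fderiv ℂ φ a).ker → E) (Ω : Set (fderiv ℂ φ a).ker),
      IsHypersurfaceParam X (fun y => g (Ψ y)) Ω ∧ 0 ∈ Ω ∧ Ψ 0 = a ∧
      ∀ y ∈ Ω, Ψ y ∈ N ∧ AnalyticAt ℂ Ψ y ∧ ∀ᶠ z in 𝓝 y, φ (Ψ z) = 0 := by
  have : CompleteSpace E := FiniteDimensional.complete ℂ E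
  obtain ⟨u, hu⟩ : ∃ u, fderiv ℂ φ a u ≠ 0 := by
    by_contra! hcon
    exact hφa (ContinuousLinearMap.ext hcon)
  obtain ⟨Ψ, π, hΨ, hΨ0, -, hφΨ, hπ, -, hΨπ, hπΨ⟩ :=
    exists_kernel_param hφ (hX.self_of_nhds.1 haX) hu
  have hev : ∀ᶠ y in 𝓝 0, AnalyticAt ℂ Ψ y ∧ Ψ y ∈ N ∧ (∀ᶠ z in 𝓝 y, φ (Ψ z) = 0) ∧
      (∀ᶠ x in 𝓝 (Ψ y), g x ∈ X ↔ φ x = 0) ∧ (∀ᶠ x in 𝓝 (Ψ y), φ x = 0 → Ψ (π x) = x) ∧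
      π (Ψ y) = y := by
    have hc : Tendsto Ψ (𝓝 0) (𝓝 a) := by
      simpa only [hΨ0] using hΨ.continuousAt.tendsto
    filter_upwards [hΨ.eventually_analyticAt, hc.eventually (hN.mem_nhds ha), hφΨ.eventually_nhds,
      hc.eventually hX.eventually_nhds, hc.eventually hΨπ.eventually_nhds, hπΨ] with y h1 h2 h3 h4 h5
      h6 using ⟨h1, h2, h3, h4, h5, h6⟩
  obtain ⟨Ω, hΩ, hΩo, h0⟩ := mem_nhds_iff.1 hev
  refine ⟨Ψ, Ω, ⟨hΩo, ?_, ?_, ?_, ?_, ?_⟩, h0, hΨ0, fun y hy =>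
    ⟨(hΩ hy).2.1, (hΩ hy).1, (hΩ hy).2.2.1⟩⟩
  · exact fun y hy => (hg _ (hΩ hy).2.1).fun_comp (hΩ hy).1
  · intro y hy
    refine Finite.of_finite_image (f := Ψ) ((hfin _ (hΩ hy).2.1).subset ?_) ?_
    · rintro _ ⟨z, hz, rfl⟩
      exact ⟨(hΩ hz.1).2.1, hz.2⟩
    · intro z hz z' hz' h
      rw [← (hΩ hz.1).2.2.2.2.2, h, (hΩ hz'.1).2.2.2.2.2]
  · intro y hy
    obtain ⟨-, -, h3, h4, -, -⟩ := hΩ hy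
    exact h4.self_of_nhds.2 h3.self_of_nhds
  · intro y hy V hV
    obtain ⟨-, h2, -, h4, h5, h6⟩ := hΩ hy
    have hV' : ∀ᶠ x in 𝓝 (Ψ y), π x ∈ V := by
      refine hπ.continuousAt.eventually ?_
      rwa [h6]
    have himg := hopen _ h2 (image_mem_map (h4.and (h5.and hV')))
    filter_upwards [himg] with q hq hqX
    obtain ⟨x, ⟨h7, h8, h9⟩, rfl⟩ := hq
    exact ⟨π x, h9, congrArg g (h8 (h7.1 hqX))⟩
  · exact fun y hy => heq _ (hΩ hy).2.1

end

section

variable {n : ℕ} {X : Set (Cn n)}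

lemma smoothPointAt_iff_isSmoothGerm {p : Cn n} : SmoothPointAt X p ↔ IsSmoothGerm X p := by
  constructor
  · rintro ⟨V, φ, hV, hp, hφ, hd, hXV⟩
    refine ⟨φ, hφ p hp, hd, ?_⟩
    filter_upwards [hV.mem_nhds hp] with x hx
    have h := Set.ext_iff.1 hXV x
    exact ⟨fun hxX => (h.1 ⟨hxX, hx⟩).2, fun hx0 => (h.2 ⟨hx, hx0⟩).1⟩
  · rintro ⟨φ, hφ, hd, hXφ⟩
    obtain ⟨V, hVs, hV, hp⟩ := mem_nhds_iff.1 (hφ.eventually_analyticAt.and hXφ)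
    refine ⟨V, φ, hV, hp, fun x hx => (hVs hx).1, hd, Set.ext fun x => ?_⟩
    exact ⟨fun hx => ⟨hx.2, (hVs hx.2).2.1 hx.1⟩, fun hx => ⟨(hVs hx.1).2.2 hx.2, hx.1⟩⟩

lemma SmoothPointWithinHyperplane.isSmoothSliceGerm {T : Cn n →L[ℂ] ℂ} {c : ℂ} {W' : Set (Cn n)}
    {q : Cn n} (hW' : W' ∈ 𝓝 q) (hc : T q = c)
    (h : SmoothPointWithinHyperplane T c (X ∩ {x : Cn n | T x = c} ∩ W') q) :
    IsSmoothSliceGerm T X q := by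
  obtain ⟨V, φ, hV, hq, hφ, ⟨e, hTe, hφe⟩, hXV⟩ := h
  refine ⟨φ, e, hφ q hq, hTe, hφe, ?_⟩
  filter_upwards [hV.mem_nhds hq, hW'] with x hx hxW hTx
  have h := Set.ext_iff.1 hXV x
  rw [hc] at hTx
  exact ⟨fun hxX => (h.1 ⟨⟨⟨hxX, hTx⟩, hxW⟩, hx⟩).2.2, fun hx0 => (h.2 ⟨hx, hTx, hx0⟩).1.1.1⟩

lemma IsHypersurfaceIn.exists_equation {W : Set (Cn n)} (hX : IsHypersurfaceIn W X) {q : Cn n}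
    (hq : q ∈ W) : ∃ ψ : Cn n → ℂ, AnalyticAt ℂ ψ q ∧ (¬ ∀ᶠ z in 𝓝 q, ψ z = 0) ∧
      ∀ᶠ z in 𝓝 q, z ∈ X ↔ ψ z = 0 := by
  obtain ⟨V, hV, hVc, hqV, -, ψ, hψ, ⟨x, hx, hx0⟩, hXV⟩ := hX.2 q hq
  refine ⟨ψ, hψ q hqV, fun h => ?_, ?_⟩
  · exact hx0 (hψ.eqOn_zero_of_preconnected_of_eventuallyEq_zero hVc hqV h hx)
  · filter_upwards [hV.mem_nhds hqV] with z hz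
    have h := Set.ext_iff.1 hXV z
    exact ⟨fun hzX => (h.1 ⟨hzX, hz⟩).2, fun hz0 => (h.2 ⟨hz, hz0⟩).1⟩

/-- If `g` is open, `g⁻¹(X) = {φ = 0}` near `p` and `T ∘ g`, `φ` have independent derivatives
at `p`, then `X` and `g⁻¹(X)` are sliced properly by `{T = T (g p)}` and its preimage near `p`. -/
lemma exists_slice_of_transversal {g : Cn n → Cn n} {N W : Set (Cn n)} (hN : IsOpen N)
    (hg : AnalyticOnNhd ℂ g N) (hmaps : MapsTo g N W) (hopen : ∀ x ∈ N, 𝓝 (g x) ≤ map g (𝓝 x))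
    (hX : IsHypersurfaceIn W X) {p : Cn n} (hp : p ∈ N) {φ : Cn n → ℂ} (hφ : AnalyticAt ℂ φ p)
    (hXφ : ∀ᶠ x in 𝓝 p, g x ∈ X ↔ φ x = 0) (hφp : fderiv ℂ φ p ≠ 0) {T : Cn n →L[ℂ] ℂ}
    {u : Cn n} (hφu : fderiv ℂ φ p u = 0) (hTu : T (fderiv ℂ g p u) ≠ 0) :
    ∃ U' : Set (Cn n), IsOpen U' ∧ p ∈ U' ∧ U' ⊆ N ∧ IsOpen (g '' U') ∧
      IsHypersurfaceInSlice T (T (g p)) (g '' U') (X ∩ {x : Cn n | T x = T (g p)} ∩ g '' U') ∧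
      (∀ x ∈ U' ∩ g ⁻¹' {x : Cn n | T x = T (g p)},
        SmoothPointAt (U' ∩ g ⁻¹' {x : Cn n | T x = T (g p)}) x) ∧
      ∀ x ∈ U' ∩ g ⁻¹' (X ∩ {x : Cn n | T x = T (g p)}),
        SmoothPointWithinPreimageHyperplane g T (T (g p))
          (U' ∩ g ⁻¹' (X ∩ {x : Cn n | T x = T (g p)})) x := by
  set c := T (g p)
  let χ : Cn n → ℂ := fun x => T (g x)
  have hχ : ∀ x ∈ N, AnalyticAt ℂ χ x := fun x hx => (T.analyticAt _).fun_comp (hg x hx)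
  have hχu : fderiv ℂ χ p u ≠ 0 := by
    have : fderiv ℂ χ p = T.comp (fderiv ℂ g p) :=
      (T.hasFDerivAt.comp p (hg p hp).differentiableAt.hasFDerivAt).fderiv
    rwa [this]
  obtain ⟨u₁, hu₁⟩ : ∃ u₁, fderiv ℂ φ p u₁ ≠ 0 := by
    by_contra! hcon
    exact hφp (ContinuousLinearMap.ext hcon)
  have hcφ : ∀ v, ContinuousAt (fun x => fderiv ℂ φ x v) p := fun v =>
    hφ.fderiv.continuousAt.clm_apply continuousAt_const
  have hcχ : ∀ v, ContinuousAt (fun x => fderiv ℂ χ x v) p := fun v =>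
    (hχ p hp).fderiv.continuousAt.clm_apply continuousAt_const
  have hdet : ∀ᶠ x in 𝓝 p,
      fderiv ℂ φ x u₁ * fderiv ℂ χ x u - fderiv ℂ φ x u * fderiv ℂ χ x u₁ ≠ 0 := by
    refine (((hcφ u₁).mul (hcχ u)).sub ((hcφ u).mul (hcχ u₁))).eventually_ne ?_
    change fderiv ℂ φ p u₁ * fderiv ℂ χ p u - fderiv ℂ φ p u * fderiv ℂ χ p u₁ ≠ 0
    rw [hφu, zero_mul, sub_zero]
    exact mul_ne_zero hu₁ hχu
  obtain ⟨U', hU', hU'o, hpU'⟩ := mem_nhds_iff.1 ((hN.eventually_mem hp).and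
    (hφ.eventually_analyticAt.and (hXφ.and (hdet.and ((hcχ u).eventually_ne hχu)))))
  have hU'N : U' ⊆ N := fun x hx => (hU' hx).1
  have hdir : ∀ x ∈ U', ∃ e, fderiv ℂ χ x e = 0 ∧ fderiv ℂ φ x e ≠ 0 := by
    intro x hx
    obtain ⟨-, -, -, h1, h2⟩ := hU' hx
    refine ⟨u₁ - (fderiv ℂ χ x u₁ / fderiv ℂ χ x u) • u, ?_, fun h => h1 ?_⟩
    · rw [map_sub, map_smul, smul_eq_mul, div_mul_cancel₀ _ h2, sub_self]
    · rw [map_sub, map_smul, smul_eq_mul] at h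
      field_simp at h
      linear_combination h
  have hχc : ∀ x ∈ U', AnalyticAt ℂ (fun x => χ x - c) x ∧
      fderiv ℂ (fun x => χ x - c) x = fderiv ℂ χ x := fun x hx =>
    ⟨(hχ x (hU'N hx)).sub analyticAt_const, fderiv_sub_const _⟩
  have hW'o : IsOpen (g '' U') := by
    rw [isOpen_iff_mem_nhds]
    rintro _ ⟨x, hx, rfl⟩
    exact hopen x (hU'N hx) (image_mem_map (hU'o.mem_nhds hx))
  refine ⟨U', hU'o, hpU', hU'N, hW'o, ⟨fun x hx => ⟨hx.2, hx.1.2⟩, ?_⟩, ?_, ?_⟩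
  · rintro _ ⟨⟨x, hx, rfl⟩, hxc⟩
    obtain ⟨V, hV, -, hxV, -, ψ, hψ, -, hXV⟩ := hX.2 (g x) (hmaps (hU'N hx))
    refine ⟨V ∩ g '' U', hV.inter hW'o, ⟨hxV, mem_image_of_mem g hx⟩, inter_subset_right, ψ,
      hψ.mono inter_subset_left, ?_, ?_⟩
    · by_contra! hcon
      obtain ⟨e, hχe, hφe⟩ := hdir x hx
      have hgV : ∀ᶠ z in 𝓝 x, χ z - c = 0 → g z ∈ X ∧ φ z = 0 := by
        filter_upwards [hU'o.mem_nhds hx, (hg x (hU'N hx)).continuousAt.eventually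
          (hV.mem_nhds hxV)] with z hz hzV hzc
        have hz0 := hcon (g z) ⟨hzV, mem_image_of_mem g hz⟩ (sub_eq_zero.1 hzc)
        have hzX : g z ∈ X := ((Set.ext_iff.1 hXV (g z)).2 ⟨hzV, hz0⟩).1
        exact ⟨hzX, (hU' hz).2.2.1.1 hzX⟩
      have hx0 : χ x - c = 0 := sub_eq_zero.2 hxc
      have htend : Tendsto (fun z : ℂ × ℂ => x + z.1 • e + z.2 • u) (𝓝 0) (𝓝 x) :=
        Continuous.tendsto' (by fun_prop) _ _ (by simp)
      refine fderiv_ne_zero_of_same_zeros (v := u) (hU' hx).2.1 (hχc x hx).1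
        (hgV.self_of_nhds hx0).2 hx0 hφe ?_ ?_ ?_
      · rw [(hχc x hx).2]
        exact (hU' hx).2.2.2.2
      · filter_upwards [htend.eventually hgV] with z hz hz0 using (hz hz0).2
      · rw [(hχc x hx).2]
        exact hχe
    · ext z
      have h := Set.ext_iff.1 hXV z
      constructor
      · rintro ⟨⟨⟨h1, h2⟩, h3⟩, h4, -⟩
        exact ⟨⟨h4, h3⟩, h2, (h.1 ⟨h1, h4⟩).2⟩
      · rintro ⟨⟨h1, h2⟩, h3, h4⟩
        exact ⟨⟨⟨(h.2 ⟨h1, h4⟩).1, h3⟩, h2⟩, h1, h2⟩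
  · rintro x ⟨hx, -⟩
    refine ⟨U', fun x => χ x - c, hU'o, hx, fun z hz => (hχc z hz).1, fun h => ?_, ?_⟩
    · rw [(hχc x hx).2] at h
      exact (hU' hx).2.2.2.2 (by rw [h, zero_apply])
    · ext z
      exact ⟨fun hz => ⟨hz.2, sub_eq_zero.2 hz.1.2⟩, fun hz => ⟨⟨hz.1, sub_eq_zero.1 hz.2⟩, hz.1⟩⟩
  · rintro x ⟨hx, -⟩
    refine ⟨U', φ, hU'o, hx, fun z hz => (hU' hz).2.1, hdir x hx, Set.ext fun z => ?_⟩
    constructor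
    · rintro ⟨⟨h1, h2, h3⟩, -⟩
      exact ⟨h1, h3, (hU' h1).2.2.1.1 h2⟩
    · rintro ⟨h1, h2, h3⟩
      exact ⟨⟨h1, (hU' h1).2.2.1.2 h3, h2⟩, h1⟩

end

/-- **Slicing proposition.**  Let `U, W` be neighborhoods of `0` in `ℂⁿ`, let
`g : (U, 0) → (W, 0)` be a finite holomorphic map, and let `X ⊆ W` be an irreducible
analytic hypersurface, singular at `0`, whose singular locus has positive dimension and
passes through the origin (i.e. `0` is a non-isolated singular point), and such that
`g⁻¹(X)` is smooth.  Then there are open sets `U' ⊆ U` and `W' ⊆ W` with `g(U') = W'`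
and an affine hyperplane `H = {T = c}` in `ℂⁿ` such that:
(1) `X ∩ H` is a singular hypersurface within `H ∩ W'`;
(2) `g⁻¹(H)` is smooth within `U'`; and
(3) `g⁻¹(X ∩ H)` is a smooth hypersurface in `g⁻¹(H) ∩ U'`. -/
theorem slicing_proposition
    {n : ℕ} (g : Cn n → Cn n) (U W : Set (Cn n))
    (hUopen : IsOpen U) (hU0 : (0 : Cn n) ∈ U)
    (hWopen : IsOpen W) (hW0 : (0 : Cn n) ∈ W)
    (hghol : AnalyticOnNhd ℂ g U) (hmaps : MapsTo g U W) (hg0 : g 0 = 0)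
    (hfin : U ∩ g ⁻¹' {0} = {0})
    (X : Set (Cn n)) (hX : IsHypersurfaceIn W X)
    (hXirr : IsIrreducibleAnalyticSubsetOf W X)
    (hX0 : (0 : Cn n) ∈ X) (hXsing : ¬ SmoothPointAt X 0)
    (hposdim : (0 : Cn n) ∈ closure ({p ∈ X | ¬ SmoothPointAt X p} \ {0}))
    (hpre : ∀ p ∈ U ∩ g ⁻¹' X, SmoothPointAt (U ∩ g ⁻¹' X) p) :
    ∃ (U' W' : Set (Cn n)) (T : Cn n →L[ℂ] ℂ) (c : ℂ),
      IsOpen U' ∧ IsOpen W' ∧ U' ⊆ U ∧ W' ⊆ W ∧ g '' U' = W' ∧ T ≠ 0 ∧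
      -- (1) `X ∩ H` is a singular hypersurface within `H ∩ W'`
      IsHypersurfaceInSlice T c W' (X ∩ {x : Cn n | T x = c} ∩ W') ∧
      (∃ p ∈ X ∩ {x : Cn n | T x = c} ∩ W',
        ¬ SmoothPointWithinHyperplane T c (X ∩ {x : Cn n | T x = c} ∩ W') p) ∧
      -- (2) `g⁻¹(H)` is smooth within `U'`
      (∀ p ∈ U' ∩ g ⁻¹' {x : Cn n | T x = c},
        SmoothPointAt (U' ∩ g ⁻¹' {x : Cn n | T x = c}) p) ∧
      -- (3) `g⁻¹(X ∩ H)` is a smooth hypersurface in `g⁻¹(H) ∩ U'`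
      (∀ p ∈ U' ∩ g ⁻¹' (X ∩ {x : Cn n | T x = c}),
        SmoothPointWithinPreimageHyperplane g T c
          (U' ∩ g ⁻¹' (X ∩ {x : Cn n | T x = c})) p) := by
  obtain ⟨N, hNU, hN, h0N, hfinN, hopen⟩ := exists_nhds_finite_fibre_open hUopen hU0 hghol
    (fun x hx hx0 => hfin.subset ⟨hx, hx0.trans hg0⟩)
  have hgN : AnalyticOnNhd ℂ g N := hghol.mono hNU
  obtain ⟨φ, hφ, hφ0, hXφ'⟩ := smoothPointAt_iff_isSmoothGerm.1 (hpre 0 ⟨hU0, by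
    rw [mem_preimage, hg0]
    exact hX0⟩)
  have hXφ : ∀ᶠ x in 𝓝 0, g x ∈ X ↔ φ x = 0 := by
    filter_upwards [hXφ', hUopen.mem_nhds hU0] with x h1 h2
    exact ⟨fun h => h1.1 ⟨h2, h⟩, fun h => (h1.2 h).2⟩
  -- shrink so that the equation stays good on the whole neighborhood
  obtain ⟨M, hM, hMo, h0M⟩ := mem_nhds_iff.1 ((hN.eventually_mem h0N).and
    (hXφ.eventually_nhds.and (hφ.eventually_analyticAt.and
      (hφ.fderiv.continuousAt.eventually_ne hφ0))))
  have hMN : M ⊆ N := fun x hx => (hM hx).1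
  obtain ⟨Ψ, Ω, hΓ, h0Ω, hΨ0, hΨ⟩ := exists_isHypersurfaceParam hMo h0M (hgN.mono hMN)
    (fun x hx => (hfinN x (hMN hx)).subset fun y hy => ⟨hMN hy.1, hy.2⟩)
    (fun x hx => hopen x (hMN hx))
    (fun x hx => hX.exists_equation (hmaps (hNU (hMN hx)))) hφ hφ0 hXφ (by rwa [hg0])
  have hdim : Module.finrank ℂ (fderiv ℂ φ 0).ker + 1 = Module.finrank ℂ (Cn n) := by
    rw [← Module.Dual.finrank_ker_add_one_of_ne_zero (f := (fderiv ℂ φ 0 : Cn n →ₗ[ℂ] ℂ))]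
    exact fun h => hφ0 (ContinuousLinearMap.ext fun v => DFunLike.congr_fun h v)
  obtain ⟨y, hy, T, hT, hslice⟩ := hΓ.exists_singular_slice hdim h0Ω (by
    simp only [smoothPointAt_iff_isSmoothGerm] at hposdim
    simp only [hΨ0, hg0]
    exact hposdim)
  obtain ⟨hyM, hΨy, hφΨ⟩ := hΨ y hy
  obtain ⟨hyN, hXφy, hφy, hφy0⟩ := hM hyM
  have hd : fderiv ℂ (fun y => g (Ψ y)) y = (fderiv ℂ g (Ψ y)).comp (fderiv ℂ Ψ y) :=
    ((hgN _ hyN).differentiableAt.hasFDerivAt.comp y hΨy.differentiableAt.hasFDerivAt).fderiv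
  obtain ⟨w, hw⟩ : ∃ w, T (fderiv ℂ g (Ψ y) (fderiv ℂ Ψ y w)) ≠ 0 := by
    by_contra! hcon
    refine hT (ContinuousLinearMap.ext fun w => ?_)
    rw [hd]
    exact hcon w
  have hφw : fderiv ℂ φ (Ψ y) (fderiv ℂ Ψ y w) = 0 := by
    have h1 : HasFDerivAt (fun z => φ (Ψ z)) ((fderiv ℂ φ (Ψ y)).comp (fderiv ℂ Ψ y)) y :=
      hφy.differentiableAt.hasFDerivAt.comp y hΨy.differentiableAt.hasFDerivAt
    have h2 := h1.unique ((hasFDerivAt_const (0 : ℂ) y).congr_of_eventuallyEq hφΨ)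
    exact DFunLike.congr_fun h2 w
  obtain ⟨U', hU'o, hyU', hU'N, hW'o, h1, h2, h3⟩ := exists_slice_of_transversal hN hgN
    (hmaps.mono_left hNU) hopen hX hyN hφy hXφy hφy0 hφw hw
  refine ⟨U', g '' U', T, T (g (Ψ y)), hU'o, hW'o, hU'N.trans hNU, ?_, rfl, ?_, h1,
    ⟨g (Ψ y), ⟨⟨hXφy.self_of_nhds.2 hφΨ.self_of_nhds, rfl⟩, mem_image_of_mem g hyU'⟩, fun h => ?_⟩,
    h2, h3⟩
  · exact (hmaps.mono_left (hU'N.trans hNU)).image_subset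
  · rintro rfl
    exact hw rfl
  · exact hslice (h.isSmoothSliceGerm (hW'o.mem_nhds (mem_image_of_mem g hyU')) rfl)
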